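/- arXiv:math/9411218 — 4 statements merged into one kernel-verified Lean document; each statement's English description precedes it below -/
import Mathlib

section
/- There exists a connected finite simple graph with exactly 2754 vertices, maximum degree at most 5, and diameter at most 6. -/
/-- A quaternary tree with natural numbers at its leaves. -/
inductive QuadTree where
  | leaf (n : ℕ)
  | node (a b c d : QuadTree)

namespace QuadTree

/-- The leaf reached by following the base-four digits of `x`, least significant digit first. -/
noncomputable def get (t : QuadTree) : ℕ → ℕ :=
  QuadTree.rec (fun n _ => n)
    (fun _ _ _ _ ga gb gc gd x =>
      Nat.rec (ga (Nat.div x 4)) (fun r _ => Nat.rec (gb (Nat.div x 4)) (fun r _ =>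
        Nat.rec (gc (Nat.div x 4)) (fun _ _ => gd (Nat.div x 4)) r) r) (Nat.mod x 4)) t

/-- The tree of depth `depth` tabulating `x ↦ f (i + s * x)` for `x < 4 ^ depth`. -/
def build (f : ℕ → ℕ) : (depth i s : ℕ) → QuadTree
  | 0, i, _ => leaf (f i)
  | n + 1, i, s =>
    node (build f n i (4 * s)) (build f n (i + s) (4 * s)) (build f n (i + 2 * s) (4 * s))
      (build f n (i + 3 * s) (4 * s))

/-- `k n`, written so that the kernel evaluates `n` to a numeral before it unfolds `k`. -/
def force {β : Type} (n : ℕ) (k : ℕ → β) : β :=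
  Nat.rec (k 0) (fun m _ => k (Nat.succ m)) n

/-- `k (build f depth i s)`, written so that the kernel evaluates all leaves before it
unfolds `k`. -/
def buildThen {β : Type} (f : ℕ → ℕ) : (depth i s : ℕ) → (QuadTree → β) → β
  | 0, i, _, k => force i fun i => force (f i) fun n => k (leaf n)
  | n + 1, i, s, k =>
    buildThen f n i (4 * s) fun a =>
    buildThen f n (i + s) (4 * s) fun b =>
    buildThen f n (i + 2 * s) (4 * s) fun c =>
    buildThen f n (i + 3 * s) (4 * s) fun d => k (node a b c d)

theorem force_eq {β : Type} (n : ℕ) (k : ℕ → β) : force n k = k n := by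
  cases n <;> rfl

theorem buildThen_eq {β : Type} (f : ℕ → ℕ) (depth i s : ℕ) (k : QuadTree → β) :
    buildThen f depth i s k = k (build f depth i s) := by
  induction depth generalizing i s k with
  | zero => simp only [buildThen, build, force_eq]
  | succ n ih => simp only [buildThen, build, ih]

theorem get_node (a b c d : QuadTree) (x : ℕ) :
    (node a b c d).get x = match x % 4 with
      | 0 => a.get (x / 4)
      | 1 => b.get (x / 4)
      | 2 => c.get (x / 4)
      | _ => d.get (x / 4) := by
  change Nat.rec (motive := fun _ => ℕ) (a.get (x / 4)) (fun r _ =>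
    Nat.rec (motive := fun _ => ℕ) (b.get (x / 4)) (fun r _ =>
      Nat.rec (motive := fun _ => ℕ) (c.get (x / 4)) (fun _ _ => d.get (x / 4)) r) r) (x % 4) = _
  rcases x % 4 with _ | _ | _ | _ <;> rfl

theorem get_build (f : ℕ → ℕ) (depth i s x : ℕ) :
    (build f depth i s).get x = f (i + s * (x % 4 ^ depth)) := by
  induction depth generalizing i s x with
  | zero => simp [build, get, Nat.mod_one]
  | succ n ih =>
    have hx : x % 4 ^ (n + 1) = x % 4 + 4 * (x / 4 % 4 ^ n) := by
      rw [pow_succ', Nat.mod_mul]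
    have key : ∀ r, x % 4 = r →
        i + s * (x % 4 ^ (n + 1)) = i + r * s + 4 * s * (x / 4 % 4 ^ n) := by
      intro r hr
      rw [hx, hr]
      ring
    have hlt := Nat.mod_lt x (show 4 > 0 by norm_num)
    rw [build, get_node]
    generalize hr : x % 4 = r at hlt
    rw [key r hr]
    interval_cases r <;> simp [ih]

end QuadTree

/-- Multiplication of `GF(4) = {0, 1, ω, ω²}`, coded as `{0, 1, 2, 3}`, read off from its table.
Addition is bitwise exclusive or. -/
def gfMul (a b : ℕ) : ℕ := Nat.mod (Nat.shiftRight 2625168384 (8 * a + 2 * b)) 4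

/-- The expression `k a³ + x + a₂ a² + a a₁` in the equations for incidence in the hexagon. -/
def hexCubic (k a x a₁ a₂ : ℕ) : ℕ :=
  Nat.xor (Nat.xor (gfMul k (gfMul a (gfMul a a))) x)
    (gfMul a (Nat.xor (gfMul a₂ a) a₁))

/-- The expression `k² a³ + y + k l + k a² a₂ + a₁ a₂ + a a₂²` in the equations for incidence
in the hexagon. -/
def hexQuartic (k a y l a₁ a₂ : ℕ) : ℕ :=
  Nat.xor (Nat.xor y (gfMul k (Nat.xor l (gfMul (gfMul a a) (Nat.xor (gfMul k a) a₂)))))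
    (gfMul a₂ (Nat.xor a₁ (gfMul a a₂)))

/-- The code of the line `[k, b, k₁, b₁, k₂]` through the point `(a, l, a₁, l₁, a₂)`
with code `p` in the split Cayley hexagon of order four. -/
def lineThrough (p k : ℕ) : ℕ :=
  let a := p / 256
  let l := p / 64 % 4
  let a₁ := p / 16 % 4
  let l₁ := p / 4 % 4
  let a₂ := p % 4
  256 * k + 64 * Nat.xor (gfMul k a) a₂ + 16 * hexQuartic k a l₁ l a₁ a₂ +
    4 * Nat.xor (gfMul k (gfMul a a)) a₁ + hexCubic k a l a₁ a₂

/-- The code of the point `(a, l, a₁, l₁, a₂)` on the line `[k, b, k₁, b₁, k₂]`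
with code `m` in the split Cayley hexagon of order four. -/
def pointOn (m a : ℕ) : ℕ :=
  let k := m / 256
  let a₂ := Nat.xor (gfMul k a) (m / 64 % 4)
  let a₁ := Nat.xor (gfMul k (gfMul a a)) (m / 4 % 4)
  let l := hexCubic k a (m % 4) a₁ a₂
  256 * a + 64 * l + 16 * a₁ + 4 * hexQuartic k a (m / 16 % 4) l a₁ a₂ + a₂

/-- The `d`-th vertex of the `i`-th inserted complete graph; the vertex with `d = 0` is the
replaced point of the hexagon. -/
def cliqueVertex (i d : ℕ) : ℕ :=
  if d = 0 then 381 + 104 * i else 2729 + 3 * i + d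

/-- `cliqueVertex i d` if `p` is the `i`-th replaced point, and `p` otherwise. -/
def expandPoint (p d : ℕ) : ℕ :=
  if 381 ≤ p ∧ p ≤ 1109 ∧ (p - 381) % 104 = 0 then cliqueVertex ((p - 381) / 104) d else p

/-- The neighbour of `i` along the edge of colour `c ∈ {1, 2, 3}` in the Wagner graph. -/
def wagnerNeighbor (i c : ℕ) : ℕ :=
  match c with
  | 1 => Nat.xor i 1
  | 2 => if i % 2 = 0 then (i + 7) % 8 else (i + 1) % 8
  | _ => Nat.xor i 4

/-- The neighbours of the vertex `v` of `H₄(K₄)`, for `j < 5`. The vertices below `1365` are the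
points of the hexagon, the next `1365` are its lines, and the last `24` are the new vertices of
the eight complete graphs that replace the points `381 + 104 i`. -/
def compoundNeighbor (v j : ℕ) : ℕ :=
  if v < 1365 then
    if j = 0 then 1365 + (v - 1) / 4
    else if v < 341 then 1365 + (4 * v + j)
    else
      let w := expandPoint v (j - 1)
      if j = 1 ∨ w = v then 1706 + lineThrough (v - 341) (j - 1) else w
  else if v < 2730 then
    if j = 0 then (v - 1366) / 4
    else if v < 1706 then 4 * (v - 1365) + j
    else expandPoint (341 + pointOn (v - 1706) (j - 1)) ((v - 1706) / 256)
  else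
    let i := (v - 2730) / 3
    let c := (v - 2730) % 3 + 1
    if j = 0 then 1706 + lineThrough (40 + 104 * i) c
    else if j = 1 then cliqueVertex (wagnerNeighbor i c) c
    else cliqueVertex i ((c + j - 1) % 4)

/-- The five neighbours of `v`, packed into one number, twelve bits each. -/
def neighborCode (v : ℕ) : ℕ :=
  compoundNeighbor v 0 + 4096 * (compoundNeighbor v 1 + 4096 * (compoundNeighbor v 2 +
    4096 * (compoundNeighbor v 3 + 4096 * compoundNeighbor v 4)))

/-- The `j`-th entry of a packed list of neighbours. -/
def slot (c j : ℕ) : ℕ := Nat.mod (Nat.shiftRight c (12 * j)) 4096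

/-- The graph `H₄(K₄)`. -/
def compoundGraph : SimpleGraph (Fin 2754) where
  Adj v w := v ≠ w ∧ (∃ j < 5, slot (neighborCode v) j = w) ∧
    ∃ j < 5, slot (neighborCode w) j = v
  symm := ⟨fun _ _ h => ⟨h.1.symm, h.2.2, h.2.1⟩⟩
  loopless := ⟨fun _ h => h.1 rfl⟩

/-- Whether `p i` holds for all `i < n`. -/
def allBelow (p : ℕ → Bool) : ℕ → Bool
  | 0 => true
  | n + 1 => cond (p n) (allBelow p n) false

theorem allBelow_iff (p : ℕ → Bool) (n : ℕ) : allBelow p n = true ↔ ∀ i < n, p i = true := by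
  induction n with
  | zero => simp [allBelow]
  | succ n ih =>
    rw [Nat.forall_lt_succ_right, ← ih, allBelow]
    cases p n <;> simp

open QuadTree

/-- Whether `v` occurs in the packed list `c`. -/
def isSlot (c v : ℕ) : Bool :=
  (Nat.beq (slot c 0) v).or <| (Nat.beq (slot c 1) v).or <| (Nat.beq (slot c 2) v).or <|
    (Nat.beq (slot c 3) v).or (Nat.beq (slot c 4) v)

/-- Whether the neighbour lists tabulated in `A` are symmetric and loopless. -/
noncomputable def symmetricCheck (A : QuadTree) : Bool :=
  allBelow (fun v => force v fun v => force (A.get v) fun c => allBelow (fun j =>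
    force (slot c j) fun w =>
      cond (Nat.ble 2754 w) false <| cond (Nat.beq v w) false <| isSlot (A.get w) v) 5) 2754

/-- The set of natural numbers with indicator bits `b`, preceded by the twelve bit tag `v`.
The kernel hashes numerals by their lowest bits, so the tag avoids hash collisions. -/
def tagged (v b : ℕ) : ℕ := Nat.add v (Nat.mul 4096 b)

/-- The union of the sets tabulated in `t` over `v` and the neighbours of `v`. -/
noncomputable def enlarge (A t : QuadTree) (v : ℕ) : ℕ :=
  force (A.get v) fun c =>
    tagged v <| Nat.shiftRight (Nat.lor (t.get v) <| Nat.lor (t.get (slot c 0)) <|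
      Nat.lor (t.get (slot c 1)) <| Nat.lor (t.get (slot c 2)) <|
      Nat.lor (t.get (slot c 3)) (t.get (slot c 4))) 12

/-- Whether `r` enlargements of the sets tabulated in `t` make all of them full. -/
noncomputable def coverCheck (A : QuadTree) : ℕ → QuadTree → Bool
  | 0, t => allBelow (fun v => Nat.beq (t.get v) (tagged v (2 ^ 2754 - 1))) 2754
  | r + 1, t => buildThen (enlarge A t) 6 0 1 (coverCheck A r)

/-- The singletons, as tagged sets. -/
def taggedSingleton (v : ℕ) : ℕ := tagged v (Nat.shiftLeft 1 v)

/-- The table of all neighbour lists. -/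
def neighborTable : QuadTree := build neighborCode 6 0 1

theorem checks_build_of_buildThen {f g : ℕ → ℕ} {n : ℕ} {P : QuadTree → Bool}
    {Q : QuadTree → QuadTree → Bool}
    (h : (buildThen f n 0 1 fun A => cond (P A) (buildThen g n 0 1 (Q A)) false) = true) :
    P (build f n 0 1) = true ∧ Q (build f n 0 1) (build g n 0 1) = true := by
  rwa [buildThen_eq, buildThen_eq, Bool.cond_false_right, Bool.and_eq_true] at h

theorem checks_neighborTable : symmetricCheck neighborTable = true ∧
    coverCheck neighborTable 6 (build taggedSingleton 6 0 1) = true :=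
  checks_build_of_buildThen (P := symmetricCheck) (Q := fun A => coverCheck A 6)
    (by decide +kernel)

theorem get_build_of_lt (f : ℕ → ℕ) {v : ℕ} (hv : v < 2754) : (build f 6 0 1).get v = f v := by
  rw [get_build, Nat.mod_eq_of_lt (by omega), zero_add, one_mul]

theorem isSlot_iff (c v : ℕ) : isSlot c v = true ↔ ∃ j < 5, slot c j = v := by
  simp only [isSlot, Bool.or_eq_true, Nat.beq_eq]
  constructor
  · rintro (h | h | h | h | h) <;> exact ⟨_, by norm_num, h⟩
  · rintro ⟨j, hj, h⟩
    interval_cases j <;> simp [h]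

theorem testBit_tagged {v : ℕ} (hv : v < 2754) (b w : ℕ) :
    (tagged v b).testBit (w + 12) = b.testBit w := by
  change (v + 2 ^ 12 * b).testBit (w + 12) = _
  rw [add_comm v, Nat.testBit_two_pow_mul_add _ (by omega)]
  simp

theorem slot_neighborCode {v j : ℕ} (hv : v < 2754) (hj : j < 5) :
    ∃ hw : slot (neighborCode v) j < 2754,
      compoundGraph.Adj ⟨v, hv⟩ ⟨slot (neighborCode v) j, hw⟩ := by
  have h := checks_neighborTable.1
  simp only [symmetricCheck, force_eq, allBelow_iff] at h
  have h := h v hv j hj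
  rw [neighborTable, get_build_of_lt _ hv] at h
  by_cases hw : 2754 ≤ slot (neighborCode v) j
  · simp [Nat.ble_eq_true_of_le hw] at h
  by_cases hvw : v = slot (neighborCode v) j
  · simp [← hvw] at h
  rw [not_le] at hw
  rw [get_build_of_lt _ hw] at h
  have hs : isSlot (neighborCode (slot (neighborCode v) j)) v = true := by
    revert h
    cases Nat.ble 2754 (slot (neighborCode v) j) <;>
      cases Nat.beq v (slot (neighborCode v) j) <;> simp
  exact ⟨hw, fun e => hvw (Fin.mk.inj_iff.mp e), ⟨j, hj, rfl⟩, (isSlot_iff _ _).mp hs⟩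

/-- Every element of the `v`-th set tabulated in `t` can be reached from `v` by a walk of length at most `k`. -/
def IsBallTable (t : QuadTree) (k : ℕ) : Prop :=
  ∀ v w : Fin 2754, (t.get v).testBit (w + 12) = true → ∃ p : compoundGraph.Walk v w, p.length ≤ k

theorem isBallTable_taggedSingleton : IsBallTable (build taggedSingleton 6 0 1) 0 := by
  intro v w h
  rw [get_build_of_lt _ v.2, taggedSingleton, testBit_tagged v.2] at h
  change (1 <<< (v : ℕ)).testBit w = true at h
  rw [Nat.one_shiftLeft, Nat.testBit_two_pow, decide_eq_true_eq, Fin.val_inj] at h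
  subst h
  exact ⟨.nil, le_rfl⟩

theorem IsBallTable.enlarge {t : QuadTree} {k : ℕ} (ht : IsBallTable t k) :
    IsBallTable (build (enlarge neighborTable t) 6 0 1) (k + 1) := by
  intro v w h
  rw [get_build_of_lt _ v.2, _root_.enlarge, force_eq, neighborTable, get_build_of_lt _ v.2,
    testBit_tagged v.2] at h
  have lor_eq : ∀ a b, Nat.lor a b = a ||| b := fun _ _ => rfl
  have shiftRight_eq : ∀ a b, Nat.shiftRight a b = a >>> b := fun _ _ => rfl
  simp only [lor_eq, shiftRight_eq, Nat.testBit_shiftRight, add_comm 12, Nat.testBit_or, Bool.or_eq_true] at h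
  have step : ∀ j < 5, (t.get (slot (neighborCode v) j)).testBit (w + 12) = true →
      ∃ p : compoundGraph.Walk v w, p.length ≤ k + 1 := by
    intro j hj hb
    obtain ⟨hu, hadj⟩ := slot_neighborCode v.2 hj
    obtain ⟨p, hp⟩ := ht ⟨_, hu⟩ w hb
    exact ⟨.cons hadj p, Nat.succ_le_succ hp⟩
  rcases h with h | h | h | h | h | h
  · obtain ⟨p, hp⟩ := ht v w h
    exact ⟨p, hp.trans k.le_succ⟩
  all_goals exact step _ (by norm_num) h

theorem IsBallTable.exists_walk {r k : ℕ} {t : QuadTree} (ht : IsBallTable t k)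
    (h : coverCheck neighborTable r t = true) (v w : Fin 2754) :
    ∃ p : compoundGraph.Walk v w, p.length ≤ k + r := by
  induction r generalizing k t with
  | zero =>
    rw [coverCheck, allBelow_iff] at h
    refine ht v w ?_
    rw [Nat.eq_of_beq_eq_true (h v v.2), testBit_tagged v.2, Nat.testBit_two_pow_sub_one]
    exact decide_eq_true w.2
  | succ r ih =>
    rw [coverCheck, buildThen_eq] at h
    obtain ⟨p, hp⟩ := ih ht.enlarge h
    exact ⟨p, by omega⟩

theorem ncard_neighborSet_compoundGraph_le (v : Fin 2754) :
    (compoundGraph.neighborSet v).ncard ≤ 5 := by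
  have hsub : (compoundGraph.neighborSet v).image Fin.val ⊆
      ((Finset.range 5).image (slot (neighborCode v)) : Finset ℕ) := by
    rintro _ ⟨w, hw, rfl⟩
    obtain ⟨j, hj, h⟩ := hw.2.1
    simpa using ⟨j, hj, h⟩
  rw [← Set.ncard_image_of_injective _ Fin.val_injective]
  refine (Set.ncard_le_ncard hsub (Finset.finite_toSet _)).trans ?_
  rw [Set.ncard_coe_finset]
  exact Finset.card_image_le.trans_eq (Finset.card_range 5)

/-- There exists a connected finite simple graph with exactly 2754 vertices,
maximum degree at most 5, and diameter at most 6. -/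
theorem exists_connected_graph_card_2754_maxDegree_le_5_diam_le_6 :
    ∃ G : SimpleGraph (Fin 2754), G.Connected ∧
      (∀ v : Fin 2754, (G.neighborSet v).ncard ≤ 5) ∧ G.diam ≤ 6 := by
  have hwalk (v w : Fin 2754) : ∃ p : compoundGraph.Walk v w, p.length ≤ 6 := by
    simpa using isBallTable_taggedSingleton.exists_walk checks_neighborTable.2 v w
  have hconn : compoundGraph.Connected := ⟨fun v w => (hwalk v w).choose.reachable⟩
  refine ⟨compoundGraph, hconn, ncard_neighborSet_compoundGraph_le, ?_⟩
  obtain ⟨v, w, hvw⟩ := compoundGraph.exists_dist_eq_diam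
  obtain ⟨p, hp⟩ := hwalk v w
  exact hvw ▸ (SimpleGraph.dist_le p).trans hp
end

section
/- There exists a connected finite simple graph with exactly 7860 vertices, maximum degree at most 6, and diameter at most 6. -/
namespace HexagonExpansion

/-! ### Decimal lookup tables -/

/-- Strings of `n` decimal digits. -/
inductive DecimalPath : ℕ → Type
  | nil : DecimalPath 0
  | d0 {n : ℕ} (p : DecimalPath n) : DecimalPath (n + 1)
  | d1 {n : ℕ} (p : DecimalPath n) : DecimalPath (n + 1)
  | d2 {n : ℕ} (p : DecimalPath n) : DecimalPath (n + 1)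
  | d3 {n : ℕ} (p : DecimalPath n) : DecimalPath (n + 1)
  | d4 {n : ℕ} (p : DecimalPath n) : DecimalPath (n + 1)
  | d5 {n : ℕ} (p : DecimalPath n) : DecimalPath (n + 1)
  | d6 {n : ℕ} (p : DecimalPath n) : DecimalPath (n + 1)
  | d7 {n : ℕ} (p : DecimalPath n) : DecimalPath (n + 1)
  | d8 {n : ℕ} (p : DecimalPath n) : DecimalPath (n + 1)
  | d9 {n : ℕ} (p : DecimalPath n) : DecimalPath (n + 1)

/-- Ten elements of a type. -/
structure Ten (α : Type) where
  (x0 x1 x2 x3 x4 x5 x6 x7 x8 x9 : α)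

/-- Tables with `10 ^ n` entries, arranged as a tree so that lookups are cheap in the kernel. -/
@[reducible] def Table (α : Type) (n : ℕ) : Type :=
  Nat.rec α (fun _ T => Ten T) n

variable {α β : Type} {n : ℕ}

namespace DecimalPath

/-- Prepend the digit `r`. -/
noncomputable def cons (r : ℕ) (p : DecimalPath n) : DecimalPath (n + 1) :=
  Nat.rec (.d0 p) (fun r _ => Nat.rec (.d1 p) (fun r _ => Nat.rec (.d2 p) (fun r _ =>
    Nat.rec (.d3 p) (fun r _ => Nat.rec (.d4 p) (fun r _ => Nat.rec (.d5 p) (fun r _ =>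
      Nat.rec (.d6 p) (fun r _ => Nat.rec (.d7 p) (fun r _ => Nat.rec (.d8 p) (fun _ _ =>
        .d9 p) r) r) r) r) r) r) r) r) r

/-- The `n` lowest decimal digits of a number, least significant digit first. -/
noncomputable def ofNat (n : ℕ) : ℕ → DecimalPath n :=
  Nat.rec (fun _ => .nil) (fun _ ih i => cons (Nat.mod i 10) (ih (Nat.div i 10))) n

/-- The table entry at the end of a path. -/
noncomputable def get (p : DecimalPath n) : Table α n → α :=
  DecimalPath.rec (motive := fun n _ => Table α n → α) (fun a => a)
    (fun _ ih T => ih T.x0)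
    (fun _ ih T => ih T.x1)
    (fun _ ih T => ih T.x2)
    (fun _ ih T => ih T.x3)
    (fun _ ih T => ih T.x4)
    (fun _ ih T => ih T.x5)
    (fun _ ih T => ih T.x6)
    (fun _ ih T => ih T.x7)
    (fun _ ih T => ih T.x8)
    (fun _ ih T => ih T.x9) p

end DecimalPath

open DecimalPath

namespace Table

/-- The table whose entry at `ofNat n i` is `f i`. -/
noncomputable def tabulate (n : ℕ) : (ℕ → α) → Table α n :=
  Nat.rec (fun f => f 0) (fun _ ih f => Ten.mk
    (ih fun i => f (Nat.mul 10 i))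
    (ih fun i => f (Nat.add (Nat.mul 10 i) 1))
    (ih fun i => f (Nat.add (Nat.mul 10 i) 2))
    (ih fun i => f (Nat.add (Nat.mul 10 i) 3))
    (ih fun i => f (Nat.add (Nat.mul 10 i) 4))
    (ih fun i => f (Nat.add (Nat.mul 10 i) 5))
    (ih fun i => f (Nat.add (Nat.mul 10 i) 6))
    (ih fun i => f (Nat.add (Nat.mul 10 i) 7))
    (ih fun i => f (Nat.add (Nat.mul 10 i) 8))
    (ih fun i => f (Nat.add (Nat.mul 10 i) 9))) n

/-- Apply a function depending on the index to all entries of a table. -/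
noncomputable def mapIdx (n : ℕ) : (ℕ → α → β) → Table α n → Table β n :=
  Nat.rec (fun f a => f 0 a) (fun _ ih f T => Ten.mk
    (ih (fun i => f (Nat.mul 10 i)) T.x0)
    (ih (fun i => f (Nat.add (Nat.mul 10 i) 1)) T.x1)
    (ih (fun i => f (Nat.add (Nat.mul 10 i) 2)) T.x2)
    (ih (fun i => f (Nat.add (Nat.mul 10 i) 3)) T.x3)
    (ih (fun i => f (Nat.add (Nat.mul 10 i) 4)) T.x4)
    (ih (fun i => f (Nat.add (Nat.mul 10 i) 5)) T.x5)
    (ih (fun i => f (Nat.add (Nat.mul 10 i) 6)) T.x6)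
    (ih (fun i => f (Nat.add (Nat.mul 10 i) 7)) T.x7)
    (ih (fun i => f (Nat.add (Nat.mul 10 i) 8)) T.x8)
    (ih (fun i => f (Nat.add (Nat.mul 10 i) 9)) T.x9)) n

/-- Whether all entries of a table are `true`. -/
noncomputable def all (n : ℕ) : Table Bool n → Bool :=
  Nat.rec (fun a => a) (fun _ ih T =>
    ih T.x0 && ih T.x1 && ih T.x2 && ih T.x3 && ih T.x4 &&
      ih T.x5 && ih T.x6 && ih T.x7 && ih T.x8 && ih T.x9) n

theorem get_tabulate {i : ℕ} (hi : i < 10 ^ n) (f : ℕ → α) :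
    (ofNat n i).get (tabulate n f) = f i := by
  induction n generalizing i f with
  | zero => obtain rfl : i = 0 := by simpa using hi
            rfl
  | succ n ih =>
    have hdiv : i / 10 < 10 ^ n := by
      rw [pow_succ] at hi
      omega
    have hmod : i % 10 < 10 := Nat.mod_lt _ (by norm_num)
    change (cons (i % 10) (ofNat n (i / 10))).get (tabulate (n + 1) f) = f i
    generalize hr : i % 10 = r at hmod
    interval_cases r <;>
      · refine (ih hdiv _).trans (congrArg f ?_)
        simp only [Nat.add_eq, Nat.mul_eq]
        omega

theorem get_mapIdx {i : ℕ} (hi : i < 10 ^ n) (f : ℕ → α → β) (T : Table α n) :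
    (ofNat n i).get (mapIdx n f T) = f i ((ofNat n i).get T) := by
  induction n generalizing i f with
  | zero => obtain rfl : i = 0 := by simpa using hi
            rfl
  | succ n ih =>
    have hdiv : i / 10 < 10 ^ n := by
      rw [pow_succ] at hi
      omega
    have hmod : i % 10 < 10 := Nat.mod_lt _ (by norm_num)
    change (cons (i % 10) (ofNat n (i / 10))).get (mapIdx (n + 1) f T) =
      f i ((cons (i % 10) (ofNat n (i / 10))).get T)
    generalize hr : i % 10 = r at hmod
    interval_cases r <;>
      · refine (ih hdiv _ _).trans (congrArg (f · _) ?_)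
        simp only [Nat.add_eq, Nat.mul_eq]
        omega

theorem get_of_all {T : Table Bool n} (hT : all n T = true) (p : DecimalPath n) :
    p.get T = true := by
  induction p with
  | nil => exact hT
  | _ p ih =>
    change (_ && _) = true at hT
    simp only [Bool.and_eq_true] at hT
    exact ih (by tauto)

end Table

open Table

/-- Six elements of a type. -/
structure Six (α : Type) where
  (x0 x1 x2 x3 x4 x5 : α)

namespace Six

/-- The list of the six elements. -/
def toList (s : Six α) : List α :=
  [s.x0, s.x1, s.x2, s.x3, s.x4, s.x5]

/-- Apply a function to all six elements. -/
def map (f : α → β) (s : Six α) : Six β :=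
  ⟨f s.x0, f s.x1, f s.x2, f s.x3, f s.x4, f s.x5⟩

/-- Bitwise disjunction of six numbers. -/
def lor (s : Six ℕ) : ℕ :=
  Nat.lor s.x0 (Nat.lor s.x1 (Nat.lor s.x2 (Nat.lor s.x3 (Nat.lor s.x4 s.x5))))

/-- Bitwise conjunction of six numbers. -/
def land (s : Six ℕ) : ℕ :=
  Nat.land s.x0 (Nat.land s.x1 (Nat.land s.x2 (Nat.land s.x3 (Nat.land s.x4 s.x5))))

/-- Whether all six elements satisfy a predicate. -/
def all (f : α → Bool) (s : Six α) : Bool :=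
  f s.x0 && f s.x1 && f s.x2 && f s.x3 && f s.x4 && f s.x5

theorem toList_map (f : α → β) (s : Six α) : (s.map f).toList = s.toList.map f := rfl

theorem testBit_lor (s : Six ℕ) (v : ℕ) :
    s.lor.testBit v = true ↔ ∃ x ∈ s.toList, x.testBit v = true := by
  have h : s.lor = s.x0 ||| (s.x1 ||| (s.x2 ||| (s.x3 ||| (s.x4 ||| s.x5)))) := rfl
  simp [h, toList]

theorem testBit_land (s : Six ℕ) (v : ℕ) :
    s.land.testBit v = true ↔ ∀ x ∈ s.toList, x.testBit v = true := by
  have h : s.land = s.x0 &&& (s.x1 &&& (s.x2 &&& (s.x3 &&& (s.x4 &&& s.x5)))) := rfl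
  simp [h, toList]

theorem all_eq_true (f : α → Bool) (s : Six α) :
    s.all f = true ↔ ∀ x ∈ s.toList, f x = true := by
  simp [all, toList, and_assoc]

end Six

/-! ### The graph

The points of the generalized hexagon of order five are the vertices below `3906` and its lines the
vertices from `3906` to `7811`. Both are numbered by a breadth-first search from a flag, which turns
them into two trees: an inner point `i` is adjacent to the lines numbered `5 * i + 1, …, 5 * i + 5`,
and dually. The leaves `781 + v` of each tree are labelled by `v < 3125`, whose base five digits
are coordinates. The sixteen point leaves with `v = 150 * j + 1` are expanded into complete graphs,
with additional vertices `7812 + 3 * j + i` for `i < 3`. -/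

/-- The `k`-th line leaf adjacent to the point leaf `v`. The base five digits of a point leaf are
the hexagon coordinates `a, l, a₁, l₁, a₂`, those of a line leaf are `k, b, k₁, b₁, k₂`. -/
def lineThrough (v k : ℕ) : ℕ :=
  let a := v / 625
  let l := v / 125 % 5
  let a₁ := v / 25 % 5
  let l₁ := v / 5 % 5
  let a₂ := v % 5
  let k₂ := ((k * a + 2 * a₂) * a + 3 * a₁) * a + l
  let b := 4 * a * k + a₂
  625 * k + 125 * (b % 5)
    + 25 * ((k * (k₂ + 3 * l) + l₁ + 2 * a₁ * (a * k + a₂) + 3 * a * a₂ * a₂) % 5)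
    + 5 * (((a * k + 3 * a₂) * a + a₁) % 5)
    + k₂ % 5

/-- The `a`-th point leaf adjacent to the line leaf `v`. -/
def pointOn (v a : ℕ) : ℕ :=
  let k := v / 625
  let b := v / 125 % 5
  let k₁ := v / 25 % 5
  let b₁ := v / 5 % 5
  let k₂ := v % 5
  let a₂ := (b + a * k) % 5
  let a₁ := ((4 * a * k + 2 * a₂) * a + b₁) % 5
  let l := (((4 * a * k + 3 * a₂) * a + 2 * a₁) * a + k₂) % 5
  625 * a + 125 * l + 25 * a₁
    + 5 * ((k₁ + 4 * k * (k₂ + 3 * l) + 3 * a₁ * (a * k + a₂) + 2 * a * a₂ * a₂) % 5)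
    + a₂

/-- The six neighbours in the opposite tree, numbered from `s`, of the inner tree vertex `i`. -/
def treeNeighbors (i s : ℕ) : Six ℕ :=
  ⟨(bif Nat.beq i 0 then 0 else (i - 1) / 5) + s,
    5 * i + 1 + s, 5 * i + 2 + s, 5 * i + 3 + s, 5 * i + 4 + s, 5 * i + 5 + s⟩

/-- Whether the point leaf `v` is expanded into a complete graph. -/
def expanded (v : ℕ) : Bool :=
  Nat.beq (v % 150) 1 && Nat.ble v 2251

/-- The vertex at which the `k`-th line through the point leaf `v` is attached. -/
def attachment (k v : ℕ) : ℕ :=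
  bif expanded v && Nat.ble 2 k then 7812 + 3 * (v / 150) + (k - 2) else v + 781

/-- The neighbours of the vertex `u` in the expanded graph. -/
def neighbors (u : ℕ) : Six ℕ :=
  bif Nat.ble u 780 then treeNeighbors u 3906
  else bif Nat.ble u 3905 then
    let v := u - 781
    let line (k : ℕ) := lineThrough v k + 4687
    let c := 7812 + 3 * (v / 150)
    bif expanded v then ⟨(u - 1) / 5 + 3906, line 0, line 1, c, c + 1, c + 2⟩
    else ⟨(u - 1) / 5 + 3906, line 0, line 1, line 2, line 3, line 4⟩
  else bif Nat.ble u 4686 then treeNeighbors (u - 3906) 0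
  else bif Nat.ble u 7811 then
    let v := u - 4687
    let point (a : ℕ) := attachment (v / 625) (pointOn v a)
    ⟨(u - 3907) / 5, point 0, point 1, point 2, point 3, point 4⟩
  else bif Nat.ble u 7859 then
    let j := (u - 7812) / 3
    let i := (u - 7812) % 3
    let copy (j i : ℕ) := 7812 + 3 * (j % 16) + i % 3
    ⟨150 * j + 782, lineThrough (150 * j + 1) (i + 2) + 4687, copy j (i + 1), copy j (i + 2),
      copy (j + (2 * i + 1)) i, copy (j + (15 - 2 * i)) i⟩
  else ⟨0, 0, 0, 0, 0, 0⟩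

/-- The generalized hexagon with sixteen points expanded into complete graphs. -/
def graph : SimpleGraph (Fin 7860) where
  Adj u v := u ≠ v ∧ (v : ℕ) ∈ (neighbors u).toList ∧ (u : ℕ) ∈ (neighbors v).toList
  symm := ⟨fun _ _ h => ⟨h.1.symm, h.2.2, h.2.1⟩⟩
  loopless := ⟨fun _ h => h.1 rfl⟩

theorem ncard_neighborSet_le (u : Fin 7860) : (graph.neighborSet u).ncard ≤ 6 := by
  have hsub : Fin.val '' graph.neighborSet u ⊆ ((neighbors u).toList.toFinset : Set ℕ) := by
    rintro _ ⟨v, hv, rfl⟩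
    simpa using hv.2.1
  calc (graph.neighborSet u).ncard
      = (Fin.val '' graph.neighborSet u).ncard :=
        (Set.ncard_image_of_injective _ Fin.val_injective).symm
    _ ≤ ((neighbors u).toList.toFinset : Set ℕ).ncard :=
        Set.ncard_le_ncard hsub (Finset.finite_toSet _)
    _ ≤ 6 := by
        rw [Set.ncard_coe_finset]
        exact List.toFinset_card_le _

/-! ### Breadth-first search -/

/-- The table of neighbours. -/
noncomputable def adjacency : Table (Six ℕ) 4 :=
  tabulate 4 neighbors

/-- The table of neighbours, given by their decimal digits. -/
noncomputable def paths : Table (Six (DecimalPath 4)) 4 :=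
  mapIdx 4 (fun _ s => s.map (ofNat 4)) adjacency

/-- The table of closed neighbourhoods, encoded as bit sets. -/
noncomputable def closedNeighborhoods : Table ℕ 4 :=
  mapIdx 4 (fun u s => Nat.lor (Nat.shiftLeft 1 u) (s.map (Nat.shiftLeft 1)).lor) adjacency

/-- The vertices reached by first moving to a neighbour `k` times and then at most once. -/
noncomputable def reach (k : ℕ) : Table ℕ 4 :=
  Nat.rec closedNeighborhoods
    (fun _ T => mapIdx 4 (fun _ s => (s.map fun p => p.get T).lor) paths) k

/-- Every neighbour is a vertex, adjacency is symmetric, and all pairs are within distance six. -/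
noncomputable def certificate : Bool :=
  all 4 (mapIdx 4 (fun _ s => s.all fun w => Nat.ble w 7859) adjacency) &&
    all 4 (mapIdx 4 (fun u s => Nat.ble 7860 u ||
      Nat.testBit (s.map fun p => p.get closedNeighborhoods).land u) paths) &&
    all 4 (mapIdx 4 (fun u r => Nat.ble 7860 u || Nat.beq r (2 ^ 7860 - 1)) (reach 5))

set_option maxHeartbeats 0 in
theorem certificate_eq_true : certificate = true := by
  decide +kernel

theorem get_adjacency (u : Fin 7860) : (ofNat 4 u).get adjacency = neighbors u :=
  get_tabulate (by omega) _

theorem get_paths (u : Fin 7860) : (ofNat 4 u).get paths = (neighbors u).map (ofNat 4) := by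
  rw [paths, get_mapIdx (by omega), get_adjacency]

theorem testBit_get_closedNeighborhoods (u : Fin 7860) (v : ℕ) :
    ((ofNat 4 u).get closedNeighborhoods).testBit v = true ↔
      v = u ∨ v ∈ (neighbors u).toList := by
  have hbit (i : ℕ) : (Nat.shiftLeft 1 i).testBit v = true ↔ v = i := by
    change (1 <<< i).testBit v = true ↔ v = i
    rw [Nat.one_shiftLeft, Nat.testBit_two_pow, decide_eq_true_iff, eq_comm]
  rw [closedNeighborhoods, get_mapIdx (by omega), get_adjacency]
  change (Nat.shiftLeft 1 u ||| (((neighbors u).map (Nat.shiftLeft 1)).lor)).testBit v = true ↔ _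
  rw [Nat.testBit_or, Bool.or_eq_true, hbit, Six.testBit_lor, Six.toList_map]
  simp only [List.mem_map, exists_exists_and_eq_and, hbit, exists_eq_right']

theorem lt_of_mem_neighbors {u : Fin 7860} {w : ℕ} (hw : w ∈ (neighbors u).toList) :
    w < 7860 := by
  have h := certificate_eq_true
  simp only [certificate, Bool.and_eq_true] at h
  have hu := get_of_all h.1.1 (ofNat 4 u)
  rw [get_mapIdx (by omega), get_adjacency, Six.all_eq_true] at hu
  exact Nat.lt_succ_of_le (Nat.le_of_ble_eq_true (hu w hw))

theorem eq_or_adj_of_mem_neighbors {u w : Fin 7860} (hw : (w : ℕ) ∈ (neighbors u).toList) :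
    u = w ∨ graph.Adj u w := by
  have h := certificate_eq_true
  simp only [certificate, Bool.and_eq_true] at h
  have hu := get_of_all h.1.2 (ofNat 4 u)
  rw [get_mapIdx (by omega), get_paths, Bool.or_eq_true, Six.testBit_land] at hu
  have hlt : ¬ Nat.ble 7860 u = true := by
    rw [Nat.ble_eq]
    omega
  have hmem := (hu.resolve_left hlt) ((ofNat 4 w).get closedNeighborhoods) (by
    simp only [Six.toList_map, List.map_map, List.mem_map]
    exact ⟨w, hw, rfl⟩)
  rw [testBit_get_closedNeighborhoods, ← Fin.ext_iff] at hmem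
  by_cases huw : u = w
  · exact .inl huw
  · exact .inr ⟨huw, hw, hmem.resolve_left huw⟩

theorem exists_walk_of_mem_neighbors {u : Fin 7860} {w : ℕ} (hw : w ∈ (neighbors u).toList) :
    ∃ (x : Fin 7860) (p : graph.Walk u x), (x : ℕ) = w ∧ p.length ≤ 1 := by
  rcases eq_or_adj_of_mem_neighbors (w := ⟨w, lt_of_mem_neighbors hw⟩) hw with h | h
  · exact ⟨u, .nil, congrArg Fin.val h, by simp⟩
  · exact ⟨_, h.toWalk, rfl, by simp⟩

theorem exists_walk_of_testBit_reach (k : ℕ) (u : Fin 7860) (v : ℕ)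
    (h : ((ofNat 4 u).get (reach k)).testBit v = true) :
    ∃ (x : Fin 7860) (p : graph.Walk u x), (x : ℕ) = v ∧ p.length ≤ k + 1 := by
  induction k generalizing u with
  | zero =>
    rcases (testBit_get_closedNeighborhoods u v).1 h with rfl | hv
    · exact ⟨u, .nil, rfl, by simp⟩
    · exact exists_walk_of_mem_neighbors hv
  | succ k ih =>
    change ((ofNat 4 u).get (mapIdx 4 (fun _ (s : Six (DecimalPath 4)) =>
      (s.map fun p => p.get (reach k)).lor) paths)).testBit v = true at h
    rw [get_mapIdx (by omega), get_paths, Six.testBit_lor] at h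
    simp only [Six.toList_map, List.map_map, List.mem_map] at h
    obtain ⟨_, ⟨w, hw, rfl⟩, hv⟩ := h
    obtain ⟨y, q, rfl, hq⟩ := exists_walk_of_mem_neighbors hw
    obtain ⟨x, p, rfl, hp⟩ := ih y hv
    exact ⟨x, q.append p, rfl, by rw [SimpleGraph.Walk.length_append]; omega⟩

theorem exists_walk_length_le_six (u v : Fin 7860) : ∃ p : graph.Walk u v, p.length ≤ 6 := by
  have h := certificate_eq_true
  simp only [certificate, Bool.and_eq_true] at h
  have hu := get_of_all h.2 (ofNat 4 u)
  rw [get_mapIdx (by omega), Bool.or_eq_true] at hu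
  have hlt : ¬ Nat.ble 7860 u = true := by
    rw [Nat.ble_eq]
    omega
  have hrow := Nat.eq_of_beq_eq_true (hu.resolve_left hlt)
  obtain ⟨x, p, hx, hp⟩ := exists_walk_of_testBit_reach 5 u v (by
    rw [hrow, Nat.testBit_two_pow_sub_one]
    simp)
  obtain rfl := Fin.ext hx
  exact ⟨p, hp⟩

end HexagonExpansion

/-- There exists a connected finite simple graph with exactly 7860 vertices,
maximum degree at most 6, and diameter at most 6. -/
theorem exists_connected_graph_card_7860_maxDegree_le_6_diam_le_6 :
    ∃ G : SimpleGraph (Fin 7860), G.Connected ∧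
      (∀ v : Fin 7860, (G.neighborSet v).ncard ≤ 6) ∧ G.diam ≤ 6 := by
  have hconn : HexagonExpansion.graph.Connected :=
    ⟨fun u v => (HexagonExpansion.exists_walk_length_le_six u v).choose.reachable⟩
  refine ⟨HexagonExpansion.graph, hconn, HexagonExpansion.ncard_neighborSet_le, ?_⟩
  obtain ⟨u, v, huv⟩ := HexagonExpansion.graph.exists_dist_eq_diam
  obtain ⟨p, hp⟩ := HexagonExpansion.exists_walk_length_le_six u v
  exact huv ▸ (SimpleGraph.dist_le p).trans hp
end

section
/- There exists a connected finite simple graph with exactly 10566 vertices, maximum degree at most 7, and diameter at most 6. -/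
namespace HexagonCompound

/-- Whether `p` holds for all numbers below `2 ^ n`. -/
def allBelow : ℕ → (ℕ → Bool) → Bool
  | 0, p => p 0
  | n + 1, p => (allBelow n fun i ↦ p (2 * i)) && allBelow n fun i ↦ p (2 * i + 1)

/-- `T i`, in a form that makes the kernel evaluate `i` first and remember the value of `T`
at the resulting literal. -/
def call (T : ℕ → ℕ) : ℕ → ℕ
  | 0 => Nat.add (T 0) 0
  | n + 1 => Nat.add (T (Nat.succ n)) 0

/-- The `k` lowest digits of `w` in base `8192`. -/
def digits : ℕ → ℕ → List ℕ
  | 0, _ => []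
  | k + 1, w => w % 8192 :: digits k (w / 8192)

/-- Reduce modulo `N` the elements, all below `2 * N`, of the set with characteristic bits `a`. -/
def fold (N a : ℕ) : ℕ := a % 2 ^ N ||| a >>> N

/-- The set `T r ∪ ⋃ d ∈ D, (d + T (r + d))` of residues modulo `N`, for a family `T` of such sets
that has period `m`. -/
def step (N m : ℕ) (T : ℕ → ℕ) (D : List ℕ) (r : ℕ) : ℕ :=
  fold N (D.foldr (fun d a ↦ call T ((r + d) % m) <<< d ||| a) (T r))

/-- For the graph on the residues modulo `N` in which `x` is joined to `x + d` for
`d ∈ D (x % m)`, the set of displacements that at most `k` steps can achieve from the vertices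
congruent to `r` modulo `m`. -/
def reach (N m : ℕ) (D : ℕ → List ℕ) (k : ℕ) : ℕ → ℕ :=
  (fun T r ↦ step N m T (D r) r)^[k] fun _ ↦ 1

/-- Whether every `d ∈ D r` has its negative in `D (r + d)`. -/
def symmCheck (N m n : ℕ) (D : ℕ → List ℕ) : Bool :=
  allBelow n fun r ↦ Nat.ble m r || (D r).all fun d ↦ (D ((r + d) % m)).any fun e ↦ Nat.beq (d + e) N

/-- Whether every displacement can be achieved in at most `k` steps. -/
def diamCheck (N m n : ℕ) (D : ℕ → List ℕ) (k : ℕ) : Bool :=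
  allBelow n fun r ↦ Nat.ble m r || Nat.beq (call (reach N m D k) r) (2 ^ N - 1)

/-- Whether every vertex can be reached in at most `k` steps from `x` or from `x + 1`,
for each `x`. -/
def pairCheck (N m n : ℕ) (D : ℕ → List ℕ) (k : ℕ) : Bool :=
  allBelow n fun r ↦ Nat.ble m r || Nat.beq (step N m (reach N m D k) [1] r) (2 ^ N - 1)

/-- The number with base `2 ^ b` digits `l`, lowest first. -/
def concat (b : ℕ) (l : List ℕ) : ℕ := l.foldr (fun a c ↦ a ||| c <<< b) 0

/-- The displacements to the neighbours of each vertex in the incidence graph of the split Cayley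
hexagon of order 5, four vertices to an entry. -/
def hexagonTable : ℕ :=
  concat 312 [
   7954546289452734274533817631269546360934818117858717136612384262696346438363169144981761843201,
   7950127075143642707181180905560484747729051136554194337230219460195477761882920507647778250759,
   7954577738696393023740605312154917066817465628116052769874894938473537709977004327142192078851,
   7943975730843571108631640629794538888058205755372760578723409118327414232873468475855904088115,
   7939899420784541355475518630347945702471621481548714059144715036971535177196527456788616355907,
   7937866611205932111495188529618402443115743194293980750849257443636312054735483756062750449747,
   7933793782591719480818206666423805128165056644825942819519001193431150355060133676044488843363,
   7929720954129185225937914659824075306459358055070197948106220906006064353702211883521440391283,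
   7927664773181023755071652299786424789702516870850705018902545280103922304515381963642794713219,
   7923588463121994001915806390413663227030409833261410822111328995518932117732208170324540432531,
   7921556399679951092462351460858072279022011442245434076878816083658103602346626704628413407395,
   7917484566046144556105819525127751380423974129806695722907806205236464018476703796237708992691,
   7913409499295205816108471267355022013950020568354767829118124512561169894460151217084819873987,
   7911624642569403977265029514322925416231705017839080518186171984693793622101128139638730875173,
   7907551565323905114673014980937937335386552479843043512007479669295773792078802322121785778473,
   7905605063633153040474247181648063782976323936094229246699312039671219108594350220602279158287,
   7901529499741154975548573977998562024904376365621140074941359574486581092746726512270719477889,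
   7897452941141916410308017618217717158640980106225998639356269983814876211598993742395601693559,
   7895356214814526349079982749498130780071201767550748458412489661662990698217116464341276173625,
   7891278910048267193555816851698268971109328920920430156116555609292308490629201883497761761157,
   7889327658628153421940348728108995571396052781817575365275562817741556418200830020861153190397,
   7885251846013765758795114376264520414282361338809779434509737473736288653606971483205346370711,
   7881179763080813852627340182442070006121314981676538060328696035976791380358560831776386999435,
   7879171542889921176350233965793105859838688229849389835190495941944866987164784179974775728713,
   7875096476290823852386119256353274521449759610445078726645122753639722846097538912840808523299,
   7872921954818640336712729164967863584370643599759264753933159336278277562588764169166580801863,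
   7868847634265068976389486424864734891200840760034639341409273762097488991135849644186633658697,
   7864776048351837400312742723116489277247437427244129309597813125919240282127407926687879995713,
   7862855886279995021002209384083456118123727046485784117503019825270710685630369870491403593995,
   7858780073665607360119930942615726457849172756727034092704616951359626489869225679266829083335,
   7856697796782669335366052525304240823230946731933305601943914648602356926768204099247291671105,
   7852626460016738005459581495082103927661314258359630748217322785647610808477175896279957283517,
   7848549652664785284237033232500877051148512647880227738243671234978458666166771540711742759915,
   7846586924956210327600214284691326614494398189412095175410541374533186573641231065795131990707,
   7842512107443627024237481973735190682448767616183869446750355504183206336349857907650033773709,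
   7840340823700980843355779639229975624824752180874799136459185071306187279136158090249364628021,
   7836261529945451461462236932250473879475970859019098473279743678533107231630741393578938672295,
   7832192430709139975452079397574472152213411471567614535840915098574340438288033999668632382387,
   7830123806998841316005825570139201465082985276269009825317508741420941270480518023549268582633,
   7826044513212887319774062447680877257424314520065527546730310005090276552696668153133753802987,
   7824055974628525209148531847068987072061107076070948125814110194926617135899343075327745253839,
   7819986876151068759164057213281970375844125269344212794418217526878130866454377781442153047423,
   7815909571384920764045834649134797024932388445597500836070970755328027786083841393267029420497,
   7813982163762310670120230888012131442381343821387217912079060341531568794236501275508725916671,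
   7809908340623001270889374362350463192069446232955539528509267289850789066231739513105753711613,
   7807824350158050024059162932533744252406266771199182438845410331854360115834545709110067405245,
   7803745553543591074087331010035110583267030939400482139922923532927063418599775613333490476755,
   7799676206192048140542311958082129831359662350115525639096295640976117045233714714313088574747,
   7797652085537257674793900001874922172463147687330998476254642894732272656265125331223986236121,
   7793581245578548747655670568233063526572504399637789874785591359861834187832217374140958533599,
   7791416394464967231362276264895392887884577731708551904926535096533329880947322885886072496399,
   7787343317219486895505644002400122318600136059669183049422456022934301357798290449588740006149,
   7783270488908790338191713503911460495410834485696872050583095828130740321593786256277644501251,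
   7781398043789237406140786772267506701876834939030178475964572185421356729172584395467568442199,
   7777322479472276814789421127302838627506622774970405974388373273382877781888924077149060244669,
   7775257369293673515127897546107544595509337563281573618292717019827459415448874765000261919235,
   7771180313553364501680938659363809961105995316703762818130661966542242173348793186987217546385,
   7767106987494435662748129816308259369137540777489486098662808205546132059044438692319373583049,
   7764971485401862601770205488680993586416987459991591767047069780214245627644536110893775840077,
   7760894180635714606651700828230816158426370547749498211780403873431128872005098287453746815679,
   7758921310797935345665993014629779441273688028199001638986716710824771692074874231436876505577,
   7754843757491567431468583819352664924298636470490569250140989875914626345659819629778159526591,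
   7750771177417545077096876135403545203376231981606705219890687409447858007713122031422796966071]

/-- The displacements to the neighbours of a vertex of the hexagon of order 5. -/
def hexagonDisp (r : ℕ) : List ℕ := digits 6 (hexagonTable >>> (78 * r) % 2 ^ 78)

/-- The displacements to the neighbours of each vertex in the incidence graph of the split Cayley
hexagon of order 4 with eight pairwise opposite points replaced by copies of `K₄`, which are joined
according to the Wagner graph; six vertices to an entry. -/
def modifiedTable : ℕ :=
  concat 390 [
   426086166888790465302908262324626271196737583035989172609202852389882393649912168171057579889486197375074090219128149,
   431627750472998306491479288222737493492457889851095251441440646685357502681145336930152276255270150402783928245880144,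
   437785065566562579164652976416242858939167993748627382730945040076967747918449297586709483227285867490564732598830411,
   445173843678839702845529622197444249588002382653454012703677073260106882404314564052223321805187370456060332558378382,
   452562621791116826526406267978645640236836771558280642673396103740990953780339434702831588557415820025621922180294054,
   459951399903393950207282913759847030885671160463107272643115134221875025156364305353439855309644269595183511802209726,
   467340178015671073888159559541048421534505549367933902612834164702759096532389176004048122061872719164745101424125398,
   474728956127948197569036205322249812183339938272760532582553195183643167908414046654656388814101168734306691046041070,
   482117734240225321249912851103451202832174327177587162552272225664527239284438917305264655566329618303868280667956742,
   489506512352502444930789496884652593481008716082413792521991256145411310660463787955872922318558067873429870289872414,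
   495041594280843864447348652589701219968091538715460022599895962488493475871505423007843770455815116962968911858820662,
   498434619238170635019916678012902167823855141094066499239777159721691768952067707988730942683818560772085295855347200,
   503976202822378476208487703911013390119575447909172578071964737203283784537198357377144126944711143793143328270870078,
   509517786406586297711802206762017292536616457171321576706458438368155106524855546563374377903024366817437929836422713,
   515059369990794151955525996208730938714168466547680226391897774672121447493436845993839900591220668706942811020125530,
   520600953575001998612223834064371972056010093680257384475527337619956470787973738788227123383576396246650798751163833,
   526142537159209837476840964880533024846749964695467256243987013493794210475670760255333146485268169645798989061383465,
   531684120743417667797509952013053747584971286944218592286214051831879941646367503521865348204706769935196542857487840,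
   537225704327625504406524772896733753064582467513460793383956848778882111622737777155033447837186570520855407626806713,
   542767287911833353660582846432201446822943974111657477157729268015009077551735995497425752813675608859804502276580614,
   548308871496041189312675475223313735371058696038969739645990382228139302011973910301518576791954945768013996190623206,
   549222847858892823761827239757256430972663376739772643918327137816823059402254060414128111815016887451030444920710458,
   556005515362996556486601195195676688854742810442392176734109443461450969204710621682481816174652327095104942441989881,
   561547098947204397743523806243257033788956485282720982360611785488010347184344186908080438115363448228875321267570420,
   567088682531412209814319558467522012056859238508192500867325432258594700319255019549021722220658347709643137585775846,
   572630266115620057359588003266261639706525343679853343779033362315485929341815153053815200266895083036781644322587904,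
   578171849699827884467732488373733598552276794694351245489536944630012297443707699420953228847574949378042204636349907,
   583713433284035740625300662005582678755856983000710975549222823388527047887313142042283369629026976604839657819784391,
   589255016868243575525525854152534618280544656650573243291082934735825652599938422659794064844938780626351541740963088,
   594796600452451410015641535402671821974272122149099150272477874712694175125666387103512695515735360510269351835682167,
   600338184036659265899803368436644411588678043226423849750307111400995108031273557516928825921285018116689398301033845,
   605879767620867096562230281316510747443406595061609395559415919610117674951529902086984666792585023049592995486877073,
   608034827903614636833066271629809110226549944641613712616822365645677767837438769673343011468330472332734290978023344,
   613576411487822478089988882677389455157059195557772130436438548127429313992749179097978366697401227022669654265358253,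
   619117995072030268219925801922066066505644281242689530610215570226194761650226176769597712701681787402398775838844840,
   624659578656238110228715849613806760515159860338785986486428163560616504442156054778154684977709321255898185182438581,
   630201162240445963105407936071137954065500363151063653052383127070365351160589291156260364669095979123315590704244052,
   635742745824653790350255591477548158004823880864098154787975377936408343037841272602643809858548459208911232859891085,
   641284329408861635366515385745930248098880866513803568862319808815278090429720969140238050712570029049191153969276288,
   646825912993069481749806883003694790845893625551160244122533857435153151768429225107953315858831551908114692225393905,
   652367496577277325193980218834287060224863791193195721036872296734792279020796147129182170204665200842456481814455417,
   657909080161485170620349523999483886188690546395181462689647134434401518691330886862886358101619472906571804435866882,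
   765662094298147056041518543057698250763598319209974319129433404622180673750723492990427199257253639704672715215152319,
   659436683491810995943434317842614215176998206836707110940705505020993271383395274611232439631624518922490052084540767,
   658211985106083270505321674751512087288898528770899461523716054931835214534237641016638229293578499408462803236604000,
   661907800878695286501291956606890944645638096511998593295737800521621060966853672728387690680954440319741873080436514,
   661903892564391368184904897444481236640809938880382036453897517077734852113091006441703836956818715028568519711491209,
   661903216803264093080813399902812701693298103598406411469458771405874726340959792573616287227753440708052249622799596,
   661903817823770566949427807671618893733389531184480157302611020510047995737644539596033709246504925781650744685052997,
   661901600941841003127631607531350288037494458063598369590964136269109526968664341137813490397898499377842388348118352,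
   661903179446834208764648968395486070651890977147931078477342020426822652466456126477812058471567292302130315634910413,
   661903854946430986560260997725658235634641289259813302257077429317653159739601320875093394952195746820111607001326636,
   661900247951968500287236844068321844226711269280621509618820298723165407322336702315420706408779893026878805604672777,
   660953989678339013628788275018162911694702637471969141633126288706606939058526462334582857886841537570655802991600776,
   659751313842781719973390364529048347479522818635489850370944877133949186218104868761974865621027464562178798948304254,
   658524060031699664845671253194440103991475471141820961690593768164140207617862692258467777012182959085149266652055630,
   637277789507386813012223564862470515090538122926839188769293134068907983841442849779350272525759330407553903764931966,
   642510379674174485785058588825381681717621533949187742502897431724382308775348318079918945261455883628294137152889997,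
   651440891316033404882168311719331317953601799986141684992913157111075301608994500993618839005233236131265307818870000,
   636043733271081365944709683712500264500974510984228927327636270062789896717189143759529411186802725977680626248229936,
   635425747431501265035371214858211400848579587638564530311245946287822426155827201351031788142327213117732345131336810,
   634504066807606013831668460271384823605608045560665836946536624206677667943584379730401650082620941075748783701066899,
   631427061763229020689314654033873040231643851818173426535986886795882389881990079962858983086423020182731459764618397,
   625273917740957426816164961516750996684597527386296930664710186957559704302200213673037299087637069790374559383561405,
   643438412564853914290104388243961924882218278884979696817102098091435453046124546768557699357439373598403228294547499,
   641279180664912898057482556045913057948662509187147633769553437637377497293860286897828827601632396756479432436721571,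
   624651008929441257314539321347206568509624982784856881776965652441040234428966382979184060806228723739736115517056686,
   626189999921047870583582775787197842246747344564103832162126965040072359738393031851827097391270595605801136934585322,
   628041289779801805032999187028401935410276695220309614518631278954355773304311930143209898419414498964692355889759360,
   622803175460187942833100703329962530107568119473918322568029628452088312050240317853182437410095034806385783980344537,
   623421086655604643289582267341241503261470122197707459630841316519550767511874820103748921591079780595243405128361134,
   609874805474714679680109400477269738080431689402311986203726192379763569357175464895317724859269233205909983286354935,
   610187481333467329588879841476261584522435318304628950644237384456803087406921506203091092191578908810888327241548767,
   616955831098904094287933623966782900759489931851334541936216312219249255700622097290798693714813766135478980502381660,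
   626168015498148539849541369161135995055010051199123666227034645566409382807865747980910262355074870979256775801087017,
   623413646725136802186116821777370306991769747737570756378112538098514323180786598520084821793322139324269801989817386,
   621865110550038693691312956989746486773551664225295395861929510301560704378233647513149593234558369709285887808341802,
   616034262576676748273002125221680454268596449995852886669161637367275826492396655212142370328994672324397244777129584,
   612950795902691570166619381172460747136724496403438877127107634577792590616571183897081537115135751188735696140370949,
   596947863311195811006434659922633569251662701290655934948975350561228983826057449440639025372323548574816650751001626,
   593866651027106692459414533800470526860038954739227766817811165195793467485911091278906497090343070232424110187742117,
   605869469889722029252177466412319121917258162099262641735498735233307444322162620686743039265702524589347131865564277,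
   599714785576670696260601468281301642015585262791337003781981377980067549057529872214173859358598110620340448689046578,
   600641050174996989722140958022709978459407180588903577773145776993445155943129653768997591914099366120584646126642045,
   601252798377216616687213479836647679360375348438028045146973291628341839329170902773941025063950729411488021656241244,
   607694642243933320473679662160488399799487383160670993293918444084142016152790497341227535977747115904566285262554048,
   605556906852739334470470594660282206270238468525279490062735387252923327529543351459365001241556181950632312838735793,
   603395119518272793423450632219517736265262183555431998436566358432614201043597445706206493837289846726453801371952306,
   607720685003317981510307077971927403731918600638910683754393199640814370899039229079727341679374515575991332202750801,
   607714447411847098089727548567525655694838876069234200873130774134574292427792643376538663273379724791495272553726849,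
   607719707491361884015435397781555516627897993319618087148640116078810981588781527550371558941302718460737889201611875,
   607719406561341865118429950014337425004595278581027167914411796765909705203154558262169835833624105977172232215356218,
   607714823141980035903700609933879170552673511620685638367017530384994666226159204191359581327382691849063147588756382,
   607720947650216557882136403191896913566795425813456688675542121253911914477336232077839692897249673640747371954660299,
   607719030689005284104569286925130251509495219013894254307579490199982381775612604672158702175682924732400619161830359,
   607717227875231862001132315472779421385047613076892977766646567275596423287901615275163635363536272913328092155429890,
   606172488064542219662974807496147162127251131323642588224170325946295969751992472866235196746921211311996562415478710,
   605566264565744672431130837651977907992646562312081977479306178182358932206752390686782570626875343503783760411731557,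
   595403649449985741757375356594326814389040245436598126141434402905878927294142175890717901221161364229254116659995893,
   583399816507739110063514883965598150763386923448745844929735396351465975411663232858946176809291443784147314119713566,
   585248551670657175640942462833576426456501714318947694481010395827423106921740922870534788597038288234191839174615988,
   594175267861246572625374924381835333947260751400465739109711215691376959261875932890754185937511234719913675830543329,
   577237353161247533926329906320421840173452648740368140155568654742408082581904402767108728803190100262396870222087192,
   583085976202963070188608490608800560668904958030715793107181155866735705666083307897009697375320288532908289693082452,
   578475579826529448109193273031472145992487303451314605878476492742423185534862327238575357591063945742116260818158355,
   575394516918044391568523490693491667601264407909379237602572488914345778648795771030603836000329738751072941435331515,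
   589218375016391744707762381711249875034405977916873371307049112795001224027125026315885515088643160750418732680471367,
   587715387430937142318156620826411029609292091324368997893642627370831027285207416594684152123978532776439770906002214,
   586459985061360027389706423545048003017552153913162888005555699181494935541599233218836681048557834184681846729622896,
   571078121129314568239130827815879335343068139373258493703987554513393686516027509939937238264641633270436849556907835,
   564613467294968585460084525818014137182525451596765607229503746294951084527653186778742075781565342148157101616972598,
   572005212960505066484107503088235494609386107782495815419839702783635557366657072077793073519899030421187622786179947,
   570469003744389537933132659125535988575841301845416422390843655041456227184960617987248208955050430668480722978104011,
   636358477333882018729274467332793675478671645197237129879855236646170284535640235629533002353178189346107836145869756,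
   569230700879690099422836574124913931864649062610897801989830070020960301876964222847426320166686071449104365237773141,
   553538979807838754962629182837891824613955994835557449889109155137704747064453069263485467522700054622824531306750691,
   563388278416965915959384042844832595144260753135375779982904314280159443595696390715578431139236663050656851684443082,
   571050838096204310790631335743203360791062008261766831887739542964418903628083995522329347956414631193400462023934689,
   568627635478350142906869681393300736587920840068824066136392936332508527042448712921153371758406185011694525961209327,
   567987438517071169965994030553700407404855177039365102305075462756981762933022173363820348790592482731334451643679739,
   560001905532298081811384327641204504325643174989358405850639212546972937007771940796526305850209134912792328929960638,
   555683744433087596585582623036070194761728180168984666094870506196674138902445399171485210434866645972764166899499747,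
   547380988476217069012874592509937193867464385265418203402687053510737249269749119762322473748689417845689031381820310,
   540601854556393661185471710188548419842086392073924866104513769459365479402244534697102832505540299746914985097683610,
   552305073846094737994610480547413729383709536490443023978615101177533799206696685961512417236310285276740859014210265,
   546143363010244932733288431220893495949741572235251667517457301121570600279088478178752691308072520826622493767746298,
   533827530002362089537112494740433746750573886238559457749613143795499193669232890533444546361368959865105558000927494,
   545220065703674371322366450244991021630462665705017710177132015704119404715566570567654545542940085091285732769170310,
   552594075652732271861632828338467483500901914607399610028106572502709156572566379434692425759512694070109090131003141,
   550144791611323034078973364121929582998361368521611957986862633830483984512959241153951552362810331622532646273213919,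
   553535109152782083042012610407072310811940156667170234335698559593961699604003982297294230594263109639415208773469945,
   553534432171631128711268239365845100699672727061446545244101544578904907901712493693003849454261101917450018148860498,
   553527631108817597710894243726167699992257891526677040040365532443962422477007548400416139968337266191553940149895945,
   553528871818177994455452353371654787437051795122137386197651547498136670280710251834905939113175706485231178329932620,
   553534018864814061025151003560244709511639348185729114718067615445213268255006333784802735073134167866286392077468468,
   553532703800175325454311759791024148005745928822745022422301446883202731529836646622386511744399685401917575866073746,
   553533380088686345315857714454922186754416434269065762579216527801354254300286445475904591963548666520265878970081836,
   553526766675398558501368794466227104733264670229240464981942069435159577043582267454739269909538256522888905062015724,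
   553808288735993223593580570401106013864403582660462089262435189213649439835373108054222462220694731367819665778696860,
   551672883493572953500807026786828708559266427464002507651113193874916901824067147850851971489248565321455802326844158,
   550770369431485075378280650512872886008080387223397812038000765516423891610635186105146267418282124119166967415899063,
   541832865696313127627848711277583075271529706940846167323740128277247975201478325485307604707917495946191089111033007,
   532288877494496090675886400504994603884081129236986788387769118306619617894017584743378540319147569320056454227509861,
   529212287059716158981440325501927229115268970777320525321694845332190735745136388716000062426049339894303063213220536,
   529516545090508058420847416826088831900160231270617418315338907023553502438205234453447931580402985769030203571929648,
   523356562002220845833243663618725447168754002213554563463234208872778168336005746746133147016247868094812232608482018,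
   525514741443046327235162650890534045881685479972877430431945957042699691010805197467829157866763757207179608223646401,
   526134229849837354131715594447790903433554499858726303031678278808682645713390094370066366619893182826637853239067146,
   516590466585350702316202987976855159551888797355352577268567746076781419257977458828631990079696566838798935213900525,
   534417970106915686610878155838074120170665909420298159475999099822079437913355691377408550076787698164134312699044404,
   532901979218928554050653792276022336724171589717334019700962529793678182240660326698241003050585681027386313198314550,
   531343784726544588001876430984297003863642454010065911692217562950244912020728195553907257104585278538402135255663481,
   522124234715218618067608986975983583534273200899559743719541013237649236139816892887866383949377421480571665687331314,
   507348369707330060669451366330310083209590583613647016310953736947033244525431439535987340062550832586239428644495876,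
   517506135059433810670362291187017006120514520184796759389251550416846533180589134178498582645849547596187950487012035,
   514435857883297191655572567849551697669060009933302397421576972801049346115093044690778811690442084499122694976422348,
   504272266641044091520887958721330939184103427797046145770540930050328201891073519369449050420264510231701900452258306,
   515659579201905087700439002916709340791921668359608111313745211770994289054777691324725608071989376043079379065963132,
   510426538514087573164508939153014713732351871503091968622817321443585651047357092595047374423643203627788699928330864,
   504890402897419496952739018647247744816819168912068118480418660599684928369806829519488645406656143829740099515982490,
   516267344665986716920031700060261949509136038615801322459201389589978623606039459877191128008812525500756581063730832,
   515057603657392376360061953291908328193244435639495344464355222122687084822848946883801835299174372379048151446496865,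
   507043471712401653578253577715658235705356846927125409099615219312744066344375178275565947890956178136286060394513768,
   503966767891541950288690496617690475902341485042203506366862244294107751163205253696068340602021294243570514095006145,
   488881759462198789999240795516661325337401999660478060903754295421311778337060594396727828299014235026138641539899987,
   490113824382112611791666873225798800636719443947724408336548113402096638123349417942223938817966410138923556993008260,
   499341078948039927301179712959608837090984501934439934673798437067203010225703610785283664023344858029348692736975498,
   495038060099998550036972608173944984288762810086302658415298429116941756097772566765157545150238519286249128774869492,
   495343521204009361668312689406965498088823451875785292039205952515528891620486956816837353120099471791545155067912572,
   480871914259173990734769491996269601962274299114270356354814198325427376449412823466051049914678653666634316609307137,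
   499621059873822725262010227464464468962141827819333986719794225100763562596310477339539284566389664845729719418053050,
   496874094560308576572212522395672905063075280019296739656151956310046910043576038555313773963036634959431122131829302,
   496265090102667836553438685046328817220208563562599777794396160471527595527776262698924495739503594957044157453616718,
   499345888336635739883653303243744977484326432694320861080878972403100591723225201933000941531111631627981308230534179,
   499341904873551691982482031243815462371714677047264508774075969304302606052259951173066451147034760756593295994765725,
   499341003698207564012901717302815475687424278840727126115144137666405041070265603822416148408965629953866337107206657,
   499341604686598332760356524821151671553328470845670091587528065840963664985535690123353868143205867608674770300805443,
   499339162399633189775795445119056865530946515756452317112818488713386420455411959574741908448589332237766677915247144,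
   499341304518145245149956573052829357081943721967220634401760243218867131481307740411724466104758334050112542292533768,
   499342280576156488883674389117463703419812914668842936440378581213124475395060970397033142604082388591574772779196717,
   499337959684373086880927694019003579944021090779679081155751427999894072256811727497896762265988628717396368583393842,
   498392528106907288482912527125369701911761272362377800982866995722382671208692433680648862603590156015106924821881242,
   497177300246815544629701161665030587805989041470858020904243881684046461168115244025613546271607600380725984351282723,
   495630943776151454243470493816017990045459856403240208611112568785102638227868935272571456175161740860215361653572347,
   478099882165871198189120773674926776223968669839626600594877868078910422518471171451200573648230317540616329468313882,
   486416240321746765643531233089300523100536350647596609121386358818374892824818068139497911369967112576742025034719624,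
   488878377551650706279514900905273770677147014578810122611283948120210983253516856696319248419018229471732726192447994,
   479950045765578799747765622197047211854081069783372375599181865358957422855833956940758029561043478873406583831888177,
   483946475080733598966734312195439339281008273943573537361897145621238469140174049232719961097869059163620817051074930,
   471942079130522848400318374301515914164651521710000246350334509015466005213336536940860296793794059915355284350763415,
   476248892030661861117975089703861349053929071728976901348991228072260723637498313861299370824684695006118735237489068,
   469476484667115282410845579465996469152601450953322851012837496774778049245673064395298195235956140084265747343770058,
   489506512352132279470889466860414455969120307111382337802030687395512456764189380383648720853897996976442819639215643,
   478392941841217227942325218007966231672004446767426161361581703630924222006586659253764913852123321273793197267001918,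
   462089096437834200895901063059268731357878599671317449806873837089812705455839885744839545932243350382710066339898875,
   469788296147519179970244172570696917987614391207546324460231229068706446036238154695229360449154337545339939108937961,
   457169182221849909605359696353843823060995385532862813087099594165796098541560527726330877356237601876600209619509626,
   460240736885867790402267211423861334549524055524836410588273989510464356664059363582657568843109143983164277131813332,
   465172563556761480305498105724378873517005762445666995139248754542213299172811598138718394030593872954398531782672806,
   457782020097323940668186357315057367914392878057627663377750507506351642842347762485106846039861982716861109207531764,
   453775256410389204880285160896973583777947658233571192773691286593042403302409833695456545495223575769406973284393185,
   447002885531865100587672102361039179080757666570143758559595848482300055556986529640231238619231011422522137671082338,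
   462990108510878353813258540760900141028607893534279466189070266412641288729399965191494807608903773451937716171415834,
   462070945831984188731534678171757763883110535751227260014582476804471971645812048919214283814315575864670674238349608,
   459006493954383455458627917195322989929518621338497696296361409288945552630897206179689869483833081176909200217236911,
   453472199723304906898056752054585053799119376316012778270820265416067063698523348860532861151714517474890832631333431,
   438694268167699923884327225469270416148989522275902501091226620301080751479377280329960031215977869521958865109942542,
   447310676477098509351578678865058510127941509617712704787000731818720578720297998045789171505518432847769598446870812,
   443928999865744185462277023110720405764645702631546831038142195713459037181791465138664903100847093525990321253679268,
   436845833168749282165980520797566660686223371869636432658284414117595355531871895931860403681801907220186741533507943,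
   437152722704951985556725304461283078631301875081800512581011288539643285238765633330805351634549560473097479107977518,
   432840197227211499107643405023371757037591048962143769593550990835320638955176792970461906280791485224747999520202878,
   435918328264762579915030541328476741332036221832031867270120388626418659161744695881780455332527732768212835283444055,
   444822609043523878881837482572671659919183803510066410298359560420992240407017771629092346751042010123632602876141773,
   442087294051828076302081844744662297575372799360574203985747454940821026309865590831258570497794426187667462110889314,
   440853350669369035577190198773008010109733270534475182106683082150558355399331333168740695550929242371859567504131212,
   419310940287774340239554926640981218148453984318018264364645972064270103573413047289590806145408184781900254322319446,
   427929039428660744219411748813857849372544993425821010072467539231832537186617668856684608082858823453348436143857861,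
   429161178593712889002899353990659596280728931580450493858915072275674024409896774476627851335029320611681924082114877,
   421773227172997916806512959670168267091588054002453725262368728479119753069436259999428025429131539639699224176377957,
   424234161783917744413770021754861893841774011174952838400869049241723066698865395286284549608196221350930325841838260,
   413153850562564228376448166726942270760850684159305188696571691252497015306036202313887162311672320587323246174413023,
   416846773894181978526767528767734390388968072461752124299263231738406008562985862518864439599644586359048716568682719,
   410690436032855988996501164885417733803385253275912537857046753939416439256281800538597869949927678171081619121029384,
   419926032869669663699332050984073258284892977936165324278919728126384437793294335151409712927973449232601651522258198,
   420231080327410508896421817545054091156588165305519846581399111973665160330643937688363545715275116376695610869556011,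
   415308271982098239295216003534847587805651460515163214663201804804824044782633721566372549257152578459110672866575465,
   845656568532247557875729841760032149849599056146462114167677046995385883632447423557213497456529730508562919198564356,
   746258169874030549443125460562231803502214373778939160011400761960916515078220728222842040598420015205678703455380842,
   748411539233642669074895976020756603171102324066688653210789661878930194246364408246963634483511209918090021910529382,
   821038206386444907146720997226051528235886473590696694081739256604264674481025478597532330390672316104210534712206689,
   809674305942122669197328183322805112193697007273562470704305457138395069875892004121506301282342359398898403797968221,
   782889911246396899939887908868707216624533215670994699644192151697558425610076841534689537306202921059601193888163160,
   776118781049635070870123410199853347692195569644352722738156352414586946811348361059286977426511489531593000624842068,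
   763809599274885933393034088269396323066106077163196146182494472739594068033974029351283687266611573600880811002496335,
   816726357284433881908451424398428980740085049049789436726914541163100566967733530098108604145679470765963666287502667,
   790588357908763098955325497681350295521392290638557565256385951063935298238002026492376037143316471556452799344772422,
   753957820173646652753093342754641767329275455591802898686816271890762571170130169505099724338462787587993380545406274,
   741952483687207394870533272380907646335355357997793618380373073046846284853967927300857085410801750451393539792315709,
   746262604344419929578045780248817820090887824499210221483759247126558542958729052265507952056715877145915647127389457,
   790585689886422992237995515559487514415188969502542969605172234161896369496631823026367859522190923531938575557059892,
   762880065202517974711239359625761873782262930858520005420366310518548563264180947497938233936818943416049028956202287,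
   720704899020670106797040343601091672136961477057016477214142086764351118631460872847045300682267810074578355164472618,
   772731768379799787681505107262458996999163115916011598192779233680254621957050781256480106111307979936888924461794597,
   743797348350946068250924268719279673606475169724179188386231616135226181125783564058325804020459635139686286364837152,
   774578963008762289040831356325768277314778154721938329761437257902773714538145951893623993666891509106617321353397532,
   798869279180632719624852306513724530176744191748543308284097090453320511315940274421871680592906411510131671241475351,
   732100591741227370725660682284952142985615791631050612305830586419226151974256611077150318913876428411346634435847442,
   782554573726532843568179169217851352799203535398053251672238920616192092251916232863451225564660318642065134657963277,
   787172597705929801737458280370156513825647560591546056075596713726555744733291297964635443344511526926056018553267464,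
   797947071978564288877947377683770883932916553475522541679729000283927904588009078551303961539744423403724799990342916,
   777629623592960030703852854197494178415325218157426513008093710929681124715212593047284541849142892432238166534284543,
   791787840744882513386938173437407607146754432070661993264743460969371838367781532054051067322074818016929197428106490,
   695152792929800024879713439467688011502195054329641971246681387456748561515558904189407603112152228406869220211631349,
   693305635973824511242779932429404704469799498476461565177208122205517658654042773884478531048685927395577338518635760,
   785630600823028321816389248020827355428877126814990642445731569405959214683284672598940576809931106203074472838972652,
   722556339727476591044839509434030018474833133765420362662773327967824248446944198142775952372158095853770164450051303,
   703461673463706990271972801721232367791942092941487562371581601042636086554584898893072637287239066603699190124692706,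
   712704447671470788502372335350301132573148520590684755129766800654451521107056196616985831377940152435018597001004253,
   716706965537366746536502984426618988987022381373538045231366999487741113063207874319374030908760681003795509186184408,
   735171583369786054490692167948992525387786130786062232510352040200415525325340589387179550937307201790137553502504092,
   712704823474942493490192969124518135334756027859531333449068241632297145413374063263922627253080001178503712227853519,
   773008067286192256030166297178078752137986781174911877414134937573010486212188583756613530217044663809536782144111818,
   712086724703474307659908731347471987369355004678692360099841085651865875117212819282439327040845703438299206270362821,
   694541909101314705289795657743110582098083534230768935529040870979058512231840523929508069933831822902668444281414848,
   762542547886521392302597891423581548469017706078199781613628449045157080225611474566559572717560235031322283420468412,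
   670831999587586039480028102491767215697689020027012753230858892992303639116328629719574473966235623141308597026694327,
   668984767478248996952093278269277657123815492474706040356140243740309885215296474851007754493155467545935854293238962,
   737326379661690688343311287403607050292964699589947958423380531408447834944104740497318314166602204234278670117840045,
   676063612714683471585928697484263963997388226343551777922073746893991313194642408599630427888546357887856531389695144,
   750226940870819839279227852542209401117134251551926652539188135706382596941602816441621371196155958019269313692484772,
   738248887275330319550179662065606724658319183366708749861999307713530343775655079857200626745810300779236664245765279,
   699460959856484647552746726607106423874568332132797873833897388458779887075152206782676326144054815564674774633063578,
   753305635907095073431397972600118812784111674681114827936172307553435055615846755580972779926905123964826004731937941,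
   672983827931653808505036902216012745876282138949498287353090779120094533133999514405148738698519909116624304439444624,
   704384782368506643245555753475921497527250219984822646770526971140843452701564049091501431198352742182701384899404940,
   682533678829655180512525989399408745974892784856012488507138345000483935964536140186315972306823081456947235140789383,
   721009494659156137254535204818760697324915837587944326085418895539004353290790914744285603750671650650367367163462786,
   751451714584267071854386079118607458732413352593644361110046423254631571865772297112431873196549821857875423442781309,
   674219688160585368093762925798967247388039399251979725632159784896098333225916858535813916758519387718939701989581944,
   691760745723175503350105071229765005266467861095342218636960594547215577730231096740681882930040555082161622107047031,
   657285906326711876364632223594579135285150897358416253595942858829271294145150464500093438741419680301256161728947314,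
   716085558701458684731962603161772383884838424472766277132976782801173905069450839581409138128643313731319184466609262,
   695761797846247998440276553777537850689654721745617957609871270963466614231488520625407793872678157471329791604573289,
   646818658780411902369046683843680751677513518919390076858888838420624714601124940778223594399942464025251934667695205,
   707157452013024096515320142520766852727411057242093710220683889966015520363876342225606987399840272445458442819134560,
   665597906362721624909160194871689097073080682871456973361363854755059910616769767901270331738431068995338687451898972,
   687142195491312953224746018900458403922731729751863142321735695559656196612289791498728761684362459634274380605097047,
   665291054949084268147096805458857921118900423551954151467899464779984672174725138595265030090129760473503055969698899,
   668978642346181954958873704672261201731412489462936431093299751176255618069320530164005396310399037116834279813309518,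
   690533941428491392214133892504634930005203312878730319987459941864430625531424831446980411829684468938884625388872778,
   680676563709138065426781406783085509360302371466111278404791750732683370727501044271567542126878339828297290295444549,
   656978679586535736062825379208365519733607232226428257656406063947003254918553804429726299627268393981381403984192577,
   632655856933886371900411448848943094490800729869042199283376394519623966850825420358390380804394973057289423939961916,
   639738385441918302588167111248982567347082884411437033366694983357382263151122150985347509240484471106316971053474872,
   665898556830475044568819020026505584318744771549046932364498619775053659411378355402989748542811124471126770256978995,
   692995927645217592979633806033867991627312971826712732474969269048038247973530956459816809044829705006417770822140975,
   647127013073132315035818802801871745373052695207429656318288880514916933087784972231301673352099256852457272687518762,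
   639429843146436385381848858423716806694666278754232722391133287870169001662659560902798589844527054540550006657926182,
   622805693331767941047383102264351349372275613000358769244833576455447630113999201750518961478264864322752327116489761,
   632964887799564264419132403473459560043005396688387957657712493339396595772383128013752226793701017032243581103293469,
   661587421667024797455630577086755021191854937375217230621367012588721463111042842361095413110374663890165957382423576,
   667751462023248154277025385427141673512332875854974497146150212683553069543457308855633432261955941729205094836790292,
   626192480197461364424582516374112207642408790160874038413273241108706292196589028432745329690621572717487531354113039,
   643425822312101383467884543920756150708426903716698915809868154094468635903137966209491006575923186209585241606972427,
   602794720106750968836348147247975465844668558755546053467343174878858213872014552293990927171564944435431977728992262,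
   672675284975614604797777839514829997004488145449146085620923120610514261435780577175594512337080356568259904010118146,
   663749958778134370285517380528855852456509276498584120644336818639034471093335890662739207559572309686721761008993277,
   664364600462820130427872950929375890374181051502819050881499918679603462082482947525810797229267416860271334917850105,
   657898780939447854467839028421933570426119865772153230359537870691015144804738084453222483251715036579728180460504052,
   665902651693245651292514481805046691198362749713575730491884620074897944933665146029362833899792358310264069695259632,
   626190525934770105064134359253336064830704298882842314732203941018495157186243250286104623216736595912191115575567339,
   604024266471566228046228646297757646019750902727348181403305278881802163396729771134396868044576502458441878640722919,
   606182371093900019602764252539107052032822346708165040910936794235824456098492072513146992616554717895948352222807010,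
   595712605024693883137729631812485651802312213581862127913843073758340062197008437557419647770822862497331836433908702,
   606487643828207469580115152598529922177316056846024416436287058946036516689053954036861497316911867472146863715951577,
   645891903749425973065650908294693462366288010518541267652577496501078426710359103334644169284192048123793355260896213,
   618797426242806700872823521705799526407265649611102858682942898651602072923463384810415285834703889335699056379167696,
   636042792597172358199259238478782101644653776134434909452826905561915442210876132036247398925335928557446816820200396,
   674180379075687336905550468217546642758479812310612500297992339311588117790083395195254662048971289020947335907787719,
   622496474412819497088591364532925373196682499344016313244181283777565260478874505477757695782748270822300943162123206,
   639112019195017437364931142542666424187297536155144804269869276571521556626160702022071961038263536786891386326393793,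
   571703510777031481822904471499095228738261444777064033266332852256511672060791680670733193249193529859352699313849277,
   589862704444595320714316867695230062244409723421624125409663272665627644556239679415342652525533924414494603107410872,
   627415074509267350938357992277451517722455546258066698463027705772430932488088698510637027092242416212040105505350580,
   578166248874938678792730627509605102269785171087134550318463378719239874074255183109746104343358351557577322118775727,
   595401995603543963631673068749522680876017105409934852114063859073737691714279458559580462316042330653946218827367339,
   612337618281907645615273777322546978027782388683066851604398973581676014663202736039177443225616481060417799742137254,
   563697836328718726554636801089475823552718617145380608453626728594560456813834188046522100741295436760398370121794466,
   616330742445385421235904708640514508881022747501328408886143098818058603223605651722419014115861795174423578515776413,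
   594481818032962646256848151257150856011377522212539145716677629171753539476997963553111492045757496444731794618786550,
   578470769671961083817263923317701653978326938132966093928703693249091504657117013575741080710738362544207930038412180,
   603717790425589920089736478038673312009239100898398427966591642241757041405361459703132973605155224983589098703152016,
   577545406184666346250395465948958001242692562873551631914179085786320921996583477146495997169188562753134513286202251,
   567079849428470428192396095351408621077293704446412244660357602966835185266120383756665377875061964450288553148367751,
   613558447466771634766292867461402047720020883276344682697739182086563437175934630106691090910463919258523086669579138,
   547073160720287213419184669254371388929571187940249434821193224516291979898973522246867875877340571534992408848794494,
   573544804610203368058399946577086775459710335169589753532547341418230860034693226548105189322595436245061082427261817,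
   539377381107851301035513450027628214597615507581163489853336448548732926803864680153254566342685371539438277530215285,
   551381252011958245083804754413562882433312201517982861501979420485399304821903365621892857110446686187315163775427440,
   569848386587561826351061251708470732664784699125094158457315393022122565574249683187886396131525546245774491088069484,
   578780175900742149038966525715759924452558820327219870374224046061989405077731402460126695912401581330207106645435239,
   522741731466199263447762638077857241720250619932565143690099533995200034410416459561839236058260760602475159417824099,
   555379860903106101447781661698126476666893027252750928337048304626202711716638253995802068126134721078439548927533918,
   518123519745572438833721071574792740768074885638372887245392396264640998592949274373905646480265859907975472118219610,
   529524587041743457829831258700771422683265359130274319515022696766347104207338901695420387403502704860351461232993109,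
   583389820711405026134453661488302203532734955248141533098702578644354484152864849699498326863473369671308299470635857,
   594470658033807856081000391643403044425134365516922174539671409376056214683910983416764337667515047067515449668363084,
   531987738465819800032901638315192603533992008507427920926823559756423692533953548406589562243334362451873479171064648,
   584927345620601433963121298930398835614208858671276402909339840380421791130908124626789158777787384012311008352363331,
   559078533957650300445095709662397605348950058293826115907515092841074828794560205460297863009257888111619715260318527,
   566465583175590326192065500394204692151465008501305906320675586917116098849401495157811196951495773884096913114039098,
   537215706333803353367563851756366644309809274665504329023907931742430206946424253554853460142183202050993853929136950,
   526752104271409799538921359860864368588369639574414111716254537186198489016813459994322878398181135619247643546436401,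
   511977216271082332178598115283640461227055352066759138572251455047700341573681878967955364116723958260874159941944109,
   577847297393628227027358793451692945879877972806101932301865418268272301382752181429912550985877799213742031285044008,
   567995217692729020265761829188505208573027123885911266678647660332840454504316239590023277851299225827680145592222500,
   576307066931249003653868631814858217031868832738402047558568841626098981189336471581066037136954740227263357850338079,
   515361785355721953907676626189328223454867018182948015039483213720876482126166896130499488888678118717959834940506907,
   569534658994312664017439856774868717965405581126996682111355216639737614555601588633888415430745510872978069371454230,
   514748158305709825730909995294338734785150292674121053242177181549148817299773046135736353317061561647523675622236946,
   571075678433944862285347858936154399076947086360218815628363545484728310376534288511562735368951362467367002114081552,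
   548606663663066397214996254133360367829040591656692846739338616516448421197863024919399397335499468090739994058040075,
   502741769837316985861715776417098732669086692665335758595484710373663166230103158956350921000767191551923051356922631,
   559069365173956958223983195047194207562555364472178071355614372187643635918888409086078944626688150111257467281515266,
   517817871973847582842572473573890480105133572508861714603409037303459138167813616203072582373404506841539486801470206,
   513816894724316905796500539766347494993574774609213889825624609445684287937556380633449533556544130892915186261959417,
   528289665963673174746296713466447444178244874792073978654129580937006005144794923034646737290193139342139086264091381,
   515353968805103683032045693651539447144644375261654557312690980700237455643891412013095430485311737618168300591596272,
   518741619182223539341674012830186630085641679194300106866840093870395450796578570803377444615145732236050677323080428,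
   551371781734013965115387951070254676422916420766736923926579243892632741024699446100228943426378528254921964977038055,
   499962635113663606025491237624038655832404399693701433633164996279126058869586037273957488083255355457562895562547939,
   544599110989645897812871857267083128970218465602670427566651386812289165965903810419379844599000533915868908939928286,
   507966618432393633073317776946651225605731818335962031970994384337759951700330697649478999198903010958165918736614106,
   539981237399523388300579828082864801150223316773930572185215652553977995251498363299209606706316042011816706252235477,
   534441119383847672351143029916224140360172579052567501694564220588640702456578865131299643878197889647030910768939729,
   539365130031606493226432195339899759616609493366985448600592483579615282589324990661580284765671621409194843596554956,
   470725384880710565671959957766194472509175145459687096586800519267651926987558128466634078407005723764625268997792456,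
   515972104630266632886906709027438613203029697267143108993283943374925149157296502346033822044358594042846874639475395,
   508584528953456780310384952407339487531273190535174560583995280980852660763064846171387085756663215701608918576636607,
   536285758587484961453794245229402577708453018245796675995818354178044116442294418755588521831656961556798345934840506,
   485184252124153028194796069593235393988283899609656960296177020465320929127205039754963559536138804908862446212080310,
   498118108071209836742995651513147406842343808464839185615317444461421714165061621641005920101116811262924799168414385,
   516277378066336503886521598190869791482346729729057224462713559816015872846631794961227086247354142197950226315027117,
   481489562427036848417768860738207248020763418909516801949498837280062056972783379110634612975386866400413238696174248,
   480567280392692216487570605388469620047236981735112353724321031904377429001608196522461309018406636562249273331892900,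
   458718469903000447244453831871685728847286724129125491629201397696657200569756450233983312841727012328184589239624351,
   508888825386622543831386141813464468563713181359513699160501587927528691982384868512505142599917949635624005667685019,
   489189587676921336516404407138088890988422015039700859504282365529389800429707033440936998732573381006531837543170710,
   494115364534150145645172472298777582335383969185256767884962042344878622676766548726048465901362522969155108110885522,
   477794609734398536187954400681369101102974387148089219759624709157688254038725701669847744304333040865135253417960077,
   499961658037260029821812099257530519852255504390447605961233415063665511918319940046297094894220359451198409133228681,
   439323904631831780832819603137446189043771538161328802940470238593612020411782415996214646776857193497013407126831748,
   457170497901149651034749447979418739135390476119447033348098990375969231365082365244010883965700509431810635447222912,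
   485802199987909684672067433771241370342099997916185102032805534620893582523731045850541780300011784732960043396334203,
   433782170685861393272158408716232460983010079867600697399379722897755800902242497851066874408279684443220889249931895,
   449172113824438644436379348794611861163636553762069911317734949048418525738470549850843692491606256389785353107481202,
   436242841906793010156298064211497047885157332740303063516988156280445831612717681328949946277154144928909241947218542,
   451011191046225349000842086291647888015419213114865145836858159081551258139566915843603688217348589645297582993957481,
   489184139415833891153659026152327525113815686798507906148596128539106804433282087434617423100433217932157350176047717,
   523331157578362991829991452732913871484478194772301102151271386964223269072557249088894420345833659137076705836188256,
   504562094441781633695904169812821647110730004884413157319164574142502823300693826004064317236354682487402492207006033,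
   512564988068880152744863569233719691787513194137824551961677685912592057197819825182584472414065766697812869571199578,
   502098717557560790829225917240793947773883524380105844120778209671274252280579068328101665330141632828740980564288092,
   511641390690158263299094342759545498257095714067544576173888069712344196039542823392253852802976223057092435280134748,
   500558937804358947592389023609917678502594072972832693638962681285395073091219381022925733904806510804102604083446364,
   503945536052763148964573157249533309359990551115907502913120281205861292694215412045389696542111466541088443500806748,
   503635641299492572890280739665144015683771041513527130115832617497597745408220541588230391844072294149477918307525212,
   497480806193506557660566214672656863618809228984649934079612083815381561927584458592174588948130191634776861938311772,
   495940725817685724270912955709208436440853126624390427138807037440097715698420385581637476177214396816356655999779420,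
   489782508966358578311621723126670462299406370245021174150211739939251472339801458485432648752762871234739417834717788,
   501167378772402008234361191631466302567583348837629103264889343909648206356088246206252778840750426540551321739780700,
   503016602684404459085840818374849548581133252611521715125779105303764130510397549277174481173625406124644118559466074,
   502710540848983352616417968735130838808570508350562446386727929532960278915918225872433553987722860411848344548360852,
   501481407868941158976330009361041787142484774736831871981030477438377672049799856988881239598839456063180530846950094,
   478711142178720921453588447561555418117304299675038265954415531885678023229409301169170871529593264603642561670595340,
   486714035805819440502489425808921774292891844751416512097175646220689715392017280605107087950404571098199049015919370,
   479018143651364447092078688073432643796234314751754106863739340169681554558893093137511390863213451726176652175786764,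
   486713735063912765458525401548884490058550062760321633375766529905798545523178278498470038827311987848398494598259468,
   482402562589860071497608011464503634224235278603235212960077333170936976844187885541376480135166097325353369185321740,
   475015888689172844444947677489261038908791276307958950693122401971361591135024558890108282735106260379274722679702284,
   478400345374078209730153099309962942731387970223486610918532071590953928122834877483735762000581864105545009881285388,
   469472914790715624157787969005263322536191653149362624490079067513332966081653035094353769679263791782579679567422220,
   471936667386671588014320081447189463232827336148363321322247484286480514426399432987860139789969459757230398898832140,
   465470697547401700146995598006981087952930938620615140156606995673712984055587494325726555031562922264288429993100044,
   480243593942367920332001402633853470250131113020389949015138229586482470564930411865580387595912616219661281433625356,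
   476552211383150090323119758515927550318710078398862181629383029463306748479367895724169543983406844217041330767504198,
   477477499808874201182762678820345958094207317196608975612416475202913502212090080235151663689687757448648756319757184,
   468559050887242111939698703348528458075567414595123229785905728870989531046802289493724921105404749656154756508804026,
   452860189915660209211231012923731487365684519545062674626440239589011161768406240860435834742217193462868108592235452,
   464557322108674184722769405718406873506047804611444921146053084953389202212621163777364387835763118329921931967538106,
   450396211731146220531605832436969504657388725427185989938321128235569174424816856505287233434291980233039042245043132,
   459323453995353685309172309629598882267569735304032644178662299987384761618690859139984539809717289382195595114152892,
   455935503013932030940891510739599166774835149682433293821304885502622577282050633561500582084684649718839810117911484,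
   448857145820210130251174074858212796248107879382325630592775137928210044676280998301127921947568194067113523045008316,
   447933059985931356752570221122931288960208421043924176855806594549424118716791241410124489513403667675131941071283132,
   443621962490954454570013243695488511547847229382183188111031208732263313671643669446330572472201751351548790760407996,
   447624367493797518477894763575594469286666418228683193019786385241195524969227950279715600372482168481214498395407292,
   451312368124198811727107495533621772921223636248796701577622916480237564308413261297781670069202930737604926958502844,
   451622413601646713380650390215738989512683131800219705964203017169824565572722444984183150751894293146146544486433720,
   448240926176455510054461881607039322910447744780543026695056297874759995015462994174227154201851995186758305328817202,
   430703138152242597845627541204354574312887657905181346370043283573065991044638437278339706540206758101311547723613292,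
   438705994198072235345056216845201786002048087522116401712242646389150008104603799921829318031497103643427868620801130,
   428547664608554727306373895828336993139925756888781790742458433428822394073600048306639703499436655538767638885336172,
   438398128319533338208223807287330911106162913522841727432224390820585362911905831982742522147855366103104478978385004,
   426084437902632218380370573399250808031515453123721873621725033290825319548780333958945665082103627554675774327235692,
   431010026706769664467123229626198645777259046735747608329069494155186727304738390616650706669931001178941787716822124,
   429776647428686895235207224437528904200817915129027965429342985214845838861827545813255392965168395257850712695399532,
   423621849913140396401853739889353792676516209943984381036222813556954477071622470741038956810916332386791337810617452,
   422389560115701261380342482256283511674914636464606847221783823503836917854032817260560625725633011093606685681828972,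
   416231380854815871562154469959304111850894868381026784163887793718541117174687070251635393954856823451898862153745516,
   430078951215259276702821731319773584332118307355624116462873512323041327119102806611219328465749614366195604350354540,
   427926333714989087456104199213227337437490550140069026595941551743601221775329981593890436130457516277598058334528618,
   425158135016675326066017203575088699420670189477696400524741946928902204464253538605286908956705748632016162427045028,
   421466263910139949931046054895685024660840240192352304109134215669183035948996142284114900415268983039702775078102238,
   847554383092390878217762269574823466998383770254395297169207859025302604682777803117670960849469988815310785746059265,
   847554385038547692271822336043474636974421134845852543777361921254475420576474180880780086342105108339012176523051009,
   847554384992430255088536005356691248598622013063399079494479057040002076617730130059559103737648051962013629661855745,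
   847554384997019435538497389199663837517046334267713128342541984817326019706680612098162175675275355022583205059379201]

/-- The displacements to the neighbours of a vertex of the modified hexagon of order 4. -/
def modifiedDisp (r : ℕ) : List ℕ := digits 5 (modifiedTable >>> (65 * r) % 2 ^ 65)

theorem symmCheck_hexagon : symmCheck 7812 252 8 hexagonDisp = true := by decide +kernel

theorem diamCheck_hexagon : diamCheck 7812 252 8 hexagonDisp 6 = true := by decide +kernel

theorem pairCheck_hexagon : pairCheck 7812 252 8 hexagonDisp 5 = true := by decide +kernel

theorem symmCheck_modified : symmCheck 2754 2754 12 modifiedDisp = true := by decide +kernel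

theorem diamCheck_modified : diamCheck 2754 2754 12 modifiedDisp 6 = true := by decide +kernel

theorem of_allBelow {n : ℕ} {p : ℕ → Bool} (h : allBelow n p = true) {i : ℕ} (hi : i < 2 ^ n) :
    p i = true := by
  induction n generalizing p i with
  | zero => simp_all [allBelow]
  | succ n ih =>
    simp only [allBelow, Bool.and_eq_true] at h
    rcases Nat.even_or_odd' i with ⟨j, rfl | rfl⟩
    · exact ih h.1 (i := j) (by omega)
    · exact ih h.2 (i := j) (by omega)

theorem call_eq (T : ℕ → ℕ) (i : ℕ) : call T i = T i := by
  cases i <;> rfl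

theorem length_digits (k w : ℕ) : (digits k w).length = k := by
  induction k generalizing w <;> simp_all [digits]

theorem val_add_natCast_mod {N m : ℕ} [NeZero N] (hm : m ∣ N) (x : ZMod N) (d : ℕ) :
    (x + (d : ZMod N)).val % m = (x.val % m + d) % m := by
  rw [ZMod.val_add, ZMod.val_natCast, Nat.mod_mod_of_dvd _ hm, Nat.mod_add_mod, Nat.add_mod,
    Nat.mod_mod_of_dvd _ hm, ← Nat.add_mod]

theorem exists_mem_neg {N m n : ℕ} [NeZero N] {D : ℕ → List ℕ} (hm : m ∣ N) (hn : m ≤ 2 ^ n)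
    (h : symmCheck N m n D = true) {x y : ZMod N} (hxy : ∃ d ∈ D (x.val % m), y = x + d) :
    ∃ d ∈ D (y.val % m), x = y + d := by
  obtain ⟨d, hd, rfl⟩ := hxy
  have hr := Nat.mod_lt x.val (Nat.pos_of_dvd_of_pos hm (NeZero.pos N))
  have key := of_allBelow h (hr.trans_le hn)
  simp only [Bool.or_eq_true, Nat.ble_eq, hr.not_ge, false_or, List.all_eq_true] at key
  obtain ⟨e, he, hde⟩ := List.any_eq_true.1 (key d hd)
  refine ⟨e, by rwa [val_add_natCast_mod hm], ?_⟩
  rw [add_assoc, ← Nat.cast_add, Nat.eq_of_beq_eq_true hde]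
  simp

section Reach

variable {V : Type*} {G : SimpleGraph V} {N m : ℕ} [NeZero N] {φ : ZMod N → V} {D : ℕ → List ℕ}

theorem testBit_fold {N a e : ℕ} (h : (fold N a).testBit e = true) :
    ∃ e', a.testBit e' = true ∧ (e' : ZMod N) = e := by
  simp only [fold, Nat.testBit_or, Nat.testBit_mod_two_pow, Nat.testBit_shiftRight,
    Bool.or_eq_true, Bool.and_eq_true] at h
  rcases h with h | h
  · exact ⟨e, h.2, rfl⟩
  · exact ⟨N + e, h, by simp⟩

theorem edist_le_of_testBit_step (hm : m ∣ N) {T : ℕ → ℕ} {k : ℕ∞} {l : List ℕ} {x : ZMod N}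
    (hT : ∀ (x : ZMod N) (e : ℕ), (T (x.val % m)).testBit e = true →
      G.edist (φ x) (φ (x + e)) ≤ k) {e : ℕ}
    (h : (step N m T l (x.val % m)).testBit e = true) :
    ∃ d ∈ 0 :: l, G.edist (φ (x + (d : ZMod N))) (φ (x + e)) ≤ k := by
  obtain ⟨e', h', he⟩ := testBit_fold h
  simp only [call_eq] at h'
  rw [← he]
  clear h he
  induction l with
  | nil => exact ⟨0, by simp, by simpa using hT x e' h'⟩
  | cons d l ih =>
    simp only [List.foldr_cons, Nat.testBit_or, Bool.or_eq_true, Nat.testBit_shiftLeft,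
      Bool.and_eq_true, decide_eq_true_eq] at h'
    rcases h' with ⟨hd, h'⟩ | h'
    · refine ⟨d, by simp, ?_⟩
      rw [← val_add_natCast_mod hm] at h'
      simpa [add_assoc, hd] using hT _ _ h'
    · obtain ⟨d', hd', h⟩ := ih h'
      exact ⟨d', by simp at hd' ⊢; tauto, h⟩

theorem edist_le_of_testBit_reach (hm : m ∣ N)
    (hD : ∀ x : ZMod N, ∀ d ∈ D (x.val % m), G.edist (φ x) (φ (x + (d : ZMod N))) ≤ 1)
    (k : ℕ) (x : ZMod N) (e : ℕ) (h : (reach N m D k (x.val % m)).testBit e = true) :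
    G.edist (φ x) (φ (x + e)) ≤ k := by
  induction k generalizing x e with
  | zero =>
    obtain rfl : e = 0 := Nat.testBit_one_eq_true_iff_self_eq_zero.1 h
    simp
  | succ k ih =>
    rw [reach, Function.iterate_succ_apply'] at h
    obtain ⟨d, hd, hk⟩ := edist_le_of_testBit_step hm ih h
    have h1 : G.edist (φ x) (φ (x + (d : ZMod N))) ≤ 1 := by
      rcases List.mem_cons.1 hd with rfl | hd
      · simp
      · exact hD x d hd
    calc
      _ ≤ _ := SimpleGraph.edist_triangle
      _ ≤ 1 + (k : ℕ∞) := add_le_add h1 hk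
      _ = _ := by push_cast; rw [add_comm]

theorem testBit_of_beq_two_pow_sub_one {a : ℕ} (h : Nat.beq a (2 ^ N - 1) = true) (z : ZMod N) :
    a.testBit z.val = true := by
  rw [Nat.eq_of_beq_eq_true h, Nat.testBit_two_pow_sub_one]
  simpa using z.val_lt

theorem edist_le_of_diamCheck {n k : ℕ} (hm : m ∣ N) (hn : m ≤ 2 ^ n)
    (hD : ∀ x : ZMod N, ∀ d ∈ D (x.val % m), G.edist (φ x) (φ (x + (d : ZMod N))) ≤ 1)
    (h : diamCheck N m n D k = true) (x y : ZMod N) : G.edist (φ x) (φ y) ≤ k := by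
  have hr := Nat.mod_lt x.val (Nat.pos_of_dvd_of_pos hm (NeZero.pos N))
  have key := of_allBelow h (hr.trans_le hn)
  simp only [Bool.or_eq_true, Nat.ble_eq, hr.not_ge, false_or, call_eq] at key
  simpa using edist_le_of_testBit_reach hm hD k x _ (testBit_of_beq_two_pow_sub_one key (y - x))

theorem edist_le_of_pairCheck {n k : ℕ} (hm : m ∣ N) (hn : m ≤ 2 ^ n)
    (hD : ∀ x : ZMod N, ∀ d ∈ D (x.val % m), G.edist (φ x) (φ (x + (d : ZMod N))) ≤ 1)
    (h : pairCheck N m n D k = true) (x y : ZMod N) :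
    G.edist (φ x) (φ y) ≤ k ∨ G.edist (φ (x + 1)) (φ y) ≤ k := by
  have hr := Nat.mod_lt x.val (Nat.pos_of_dvd_of_pos hm (NeZero.pos N))
  have key := of_allBelow h (hr.trans_le hn)
  simp only [Bool.or_eq_true, Nat.ble_eq, hr.not_ge, false_or] at key
  obtain ⟨d, hd, hk⟩ := edist_le_of_testBit_step hm (edist_le_of_testBit_reach hm hD k)
    (testBit_of_beq_two_pow_sub_one key (y - x))
  simp only [List.mem_cons, List.not_mem_nil, or_false] at hd
  rcases hd with rfl | rfl
  · left; simpa using hk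
  · right; simpa using hk

end Reach

/-- Both hexagons, and edges from the vertex `b` of the modified hexagon of order 4 to the
vertices `2 * b` and `2 * b + 1` of the hexagon of order 5. -/
def compoundRel : ZMod 7812 ⊕ ZMod 2754 → ZMod 7812 ⊕ ZMod 2754 → Prop
  | .inl x, .inl y => ∃ d ∈ hexagonDisp (x.val % 252), y = x + (d : ZMod 7812)
  | .inr x, .inr y => ∃ d ∈ modifiedDisp (x.val % 2754), y = x + (d : ZMod 2754)
  | .inl x, .inr y => x.val = 2 * y.val ∨ x.val = 2 * y.val + 1
  | .inr x, .inl y => y.val = 2 * x.val ∨ y.val = 2 * x.val + 1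

theorem compoundRel_symm {u v : ZMod 7812 ⊕ ZMod 2754} (h : compoundRel u v) :
    compoundRel v u := by
  rcases u with x | x <;> rcases v with y | y
  · exact exists_mem_neg (by norm_num) (by norm_num) symmCheck_hexagon h
  · exact h
  · exact h
  · exact exists_mem_neg (by norm_num) (by norm_num) symmCheck_modified h

/-- The hexagon of order 5 compounded with the modified hexagon of order 4. -/
def compound : SimpleGraph (ZMod 7812 ⊕ ZMod 2754) := .fromRel compoundRel

theorem edist_compound_le_one {u v : ZMod 7812 ⊕ ZMod 2754} (h : compoundRel u v) :
    compound.edist u v ≤ 1 := by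
  rw [SimpleGraph.edist_le_one_iff_adj_or_eq]
  by_cases huv : u = v
  · exact .inr huv
  · exact .inl ⟨huv, .inl h⟩

theorem ncard_setOf_mem_le {α : Type*} (l : List α) : {a | a ∈ l}.ncard ≤ l.length := by
  classical
  have : {a | a ∈ l} = (l.toFinset : Set α) := by ext; simp
  rw [this, Set.ncard_coe_finset]
  exact l.toFinset_card_le

theorem ncard_neighborSet_compound_le (v : ZMod 7812 ⊕ ZMod 2754) :
    (compound.neighborSet v).ncard ≤ 7 := by
  have key : ∃ l : List (ZMod 7812 ⊕ ZMod 2754), l.length = 7 ∧ ∀ w, compoundRel v w → w ∈ l := by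
    rcases v with x | x
    · refine ⟨.inr ((x.val / 2 : ℕ) : ZMod 2754) ::
        (hexagonDisp (x.val % 252)).map fun d : ℕ ↦ .inl (x + (d : ZMod 7812)),
        by simp [hexagonDisp, length_digits], ?_⟩
      rintro (y | y) h
      · obtain ⟨d, hd, rfl⟩ := h
        simp only [List.mem_cons, List.mem_map]
        exact .inr ⟨d, hd, rfl⟩
      · have h : x.val = 2 * y.val ∨ x.val = 2 * y.val + 1 := h
        have : x.val / 2 = y.val := by omega
        simp [this]
    · refine ⟨.inl ((2 * x.val : ℕ) : ZMod 7812) :: .inl ((2 * x.val + 1 : ℕ) : ZMod 7812) ::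
        (modifiedDisp (x.val % 2754)).map fun d : ℕ ↦ .inr (x + (d : ZMod 2754)),
        by simp [modifiedDisp, length_digits], ?_⟩
      rintro (y | y) h
      · have h : y.val = 2 * x.val ∨ y.val = 2 * x.val + 1 := h
        rcases h with h | h <;> simp only [← h, ZMod.natCast_val, ZMod.cast_id', id_eq] <;> simp
      · obtain ⟨d, hd, rfl⟩ := h
        simp only [List.mem_cons, List.mem_map]
        exact .inr (.inr ⟨d, hd, rfl⟩)
  obtain ⟨l, hl, h⟩ := key
  refine (Set.ncard_le_ncard (fun w hw ↦ ?_) (List.finite_toSet l)).trans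
    ((ncard_setOf_mem_le l).trans_eq hl)
  exact h w (hw.2.elim id compoundRel_symm)

theorem edist_compound_inr_inl_le (b : ZMod 2754) (a : ZMod 7812) :
    compound.edist (.inr b) (.inl a) ≤ 6 := by
  have hb := b.val_lt
  have h0 : compoundRel (.inr b) (.inl ((2 * b.val : ℕ) : ZMod 7812)) :=
    .inl (ZMod.val_natCast_of_lt (by omega))
  have h1 : compoundRel (.inr b) (.inl ((2 * b.val : ℕ) + 1 : ZMod 7812)) := by
    rw [← Nat.cast_succ]
    exact .inr (ZMod.val_natCast_of_lt (by omega))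
  have h6 : (1 : ℕ∞) + (5 : ℕ) = 6 := by norm_num
  rw [← h6]
  rcases edist_le_of_pairCheck (G := compound) (φ := Sum.inl) (by norm_num) (by norm_num)
    (fun x d hd ↦ edist_compound_le_one ⟨d, hd, rfl⟩) pairCheck_hexagon
    ((2 * b.val : ℕ) : ZMod 7812) a with h | h
  · exact SimpleGraph.edist_triangle.trans (add_le_add (edist_compound_le_one h0) h)
  · exact SimpleGraph.edist_triangle.trans (add_le_add (edist_compound_le_one h1) h)

theorem edist_compound_le (u v : ZMod 7812 ⊕ ZMod 2754) : compound.edist u v ≤ 6 := by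
  rcases u with x | x <;> rcases v with y | y
  · exact edist_le_of_diamCheck (G := compound) (φ := Sum.inl) (by norm_num) (by norm_num)
      (fun x d hd ↦ edist_compound_le_one ⟨d, hd, rfl⟩) diamCheck_hexagon x y
  · rw [SimpleGraph.edist_comm]
    exact edist_compound_inr_inl_le y x
  · exact edist_compound_inr_inl_le x y
  · exact edist_le_of_diamCheck (G := compound) (φ := Sum.inr) (by norm_num) (by norm_num)
      (fun x d hd ↦ edist_compound_le_one ⟨d, hd, rfl⟩) diamCheck_modified x y

end HexagonCompound

open HexagonCompound

/-- There exists a connected finite simple graph with exactly 10566 vertices,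
maximum degree at most 7, and diameter at most 6. -/
theorem exists_connected_graph_card_10566_maxDegree_le_7_diam_le_6 :
    ∃ G : SimpleGraph (Fin 10566), G.Connected ∧
      (∀ v : Fin 10566, (G.neighborSet v).ncard ≤ 7) ∧ G.diam ≤ 6 := by
  let e : Fin 10566 ≃ ZMod 7812 ⊕ ZMod 2754 := (finSumFinEquiv (m := 7812) (n := 2754)).symm
  let f : compound.comap e ≃g compound := SimpleGraph.Iso.comap e compound
  have hdiam : (compound.comap e).ediam ≤ 6 := by
    refine SimpleGraph.ediam_le_of_edist_le fun u v ↦ ?_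
    have h := edist_compound_le (e u) (e v)
    obtain ⟨p, hp⟩ := SimpleGraph.exists_walk_of_edist_ne_top (h.trans_lt (by decide)).ne
    have hq := SimpleGraph.edist_le (p.map f.symm.toHom)
    rw [SimpleGraph.Walk.length_map, hp] at hq
    simpa [f] using hq.trans h
  refine ⟨compound.comap e, SimpleGraph.connected_of_ediam_ne_top (hdiam.trans_lt (by decide)).ne,
    fun v ↦ ?_, ENat.toNat_le_of_le_natCast hdiam⟩
  refine le_trans (Set.ncard_le_ncard_of_injOn e (fun w hw ↦ hw) e.injective.injOn
    (Set.toFinite (compound.neighborSet (e v)))) (ncard_neighborSet_compound_le (e v))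
end

section
/- There exists a connected finite simple graph with exactly 39396 vertices, maximum degree at most 8, and diameter at most 6. -/
namespace SplitCayleyHexagon

/-- Points of the split Cayley hexagon over `F` in hexagonal coordinates. -/
inductive Pt (F : Type)
  | p0 : Pt F
  | p1 (a : F) : Pt F
  | p2 (k b : F) : Pt F
  | p3 (a l a' : F) : Pt F
  | p4 (k b k' b' : F) : Pt F
  | p5 (a l a' l' a'' : F) : Pt F

/-- Lines of the split Cayley hexagon over `F` in hexagonal coordinates. -/
inductive Ln (F : Type)
  | l0 : Ln F
  | l1 (k : F) : Ln F
  | l2 (a l : F) : Ln F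
  | l3 (k b k' : F) : Ln F
  | l4 (a l a' l' : F) : Ln F
  | l5 (k b k' b' k'' : F) : Ln F

open Pt Ln

variable {F : Type} [Field F]

/-- The point on the line `L` with label `j`. -/
def pointOn : Ln F → Option F → Pt F
  | l0, none => p0
  | l0, some a => p1 a
  | l1 _, none => p0
  | l1 k, some b => p2 k b
  | l2 a _, none => p1 a
  | l2 a l, some a' => p3 a l a'
  | l3 k b _, none => p2 k b
  | l3 k b k', some b' => p4 k b k' b'
  | l4 a l a' _, none => p3 a l a'
  | l4 a l a' l', some a'' => p5 a l a' l' a''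
  | l5 k b k' b' _, none => p4 k b k' b'
  | l5 k b k' b' k'', some a =>
      p5 a (k'' - k * a ^ 3 - 3 * a ^ 2 * b - 3 * a * b')
        (k * a ^ 2 + b' + 2 * a * b)
        (k ^ 2 * a ^ 3 + k' + k * k'' + 3 * k * a ^ 2 * b + 3 * b * b' + 3 * a * b ^ 2)
        (k * a + b)

/-- The line through the point `P` with label `j`; the label `none` gives the line which is
closest to the flag of coordinate origin. -/
def lineThrough : Pt F → Option F → Ln F
  | p0, none => l0
  | p0, some k => l1 k
  | p1 _, none => l0
  | p1 a, some l => l2 a l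
  | p2 k _, none => l1 k
  | p2 k b, some k' => l3 k b k'
  | p3 a l _, none => l2 a l
  | p3 a l a', some l' => l4 a l a' l'
  | p4 k b k' _, none => l3 k b k'
  | p4 k b k' b', some k'' => l5 k b k' b' k''
  | p5 a l a' l' _, none => l4 a l a' l'
  | p5 a l a' l' a'', some k =>
      l5 k (a'' - k * a)
        (k ^ 2 * a ^ 3 + l' - k * l - 3 * a ^ 2 * a'' * k - 3 * a' * a'' + 3 * a * a'' ^ 2)
        (k * a ^ 2 + a' - 2 * a * a'')
        (k * a ^ 3 + l - 3 * a'' * a ^ 2 + 3 * a * a')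

theorem lineThrough_injective (P : Pt F) : Function.Injective (lineThrough P) := by
  intro i j h
  cases P <;> cases i <;> cases j <;> simp_all [lineThrough]

/-- Incidence of points and lines. -/
def Inc (P : Pt F) (L : Ln F) : Prop := ∃ j, lineThrough P j = L

theorem pointOn_injective (L : Ln F) : Function.Injective (pointOn L) := by
  intro i j h
  cases L <;> cases i <;> cases j <;> simp_all [pointOn]

theorem inc_pointOn (L : Ln F) (j : Option F) : Inc (pointOn L j) L := by
  cases L <;> cases j <;> simp [Inc, pointOn, lineThrough, Option.exists]
  case l5.some k b k' b' k'' a =>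
    refine ⟨?_, ?_, ?_⟩ <;> ring

theorem inc_iff_exists_pointOn {P : Pt F} {L : Ln F} : Inc P L ↔ ∃ j, pointOn L j = P := by
  constructor
  · rintro ⟨j, rfl⟩
    cases P <;> cases j <;> simp [pointOn, lineThrough, Option.exists]
    case p5.some a l a' l' a'' k =>
      refine ⟨?_, ?_, ?_⟩ <;> ring
  · rintro ⟨j, rfl⟩
    exact inc_pointOn L j

/-- `P` and `Q` are joined by a path of length at most four. -/
def PtNear (P Q : Pt F) : Prop := ∃ M R N, Inc P M ∧ Inc R M ∧ Inc R N ∧ Inc Q N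

/-- `P` and `L` are joined by a path of length at most five. -/
def Near (P : Pt F) (L : Ln F) : Prop := ∃ Q, PtNear P Q ∧ Inc Q L

/-- An incidence-preserving pair of maps, the one on lines being surjective. -/
structure IsShift (f : Pt F → Pt F) (g : Ln F → Ln F) : Prop where
  map_inc : ∀ P j, Inc (f P) (g (lineThrough P j))
  surj : Function.Surjective g

theorem IsShift.near {f : Pt F → Pt F} {g : Ln F → Ln F} (h : IsShift f g) {P : Pt F}
    (hP : ∀ L, Near P L) (L : Ln F) : Near (f P) L := by
  have hm : ∀ {P L}, Inc P L → Inc (f P) (g L) := by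
    rintro P L ⟨j, rfl⟩
    exact h.map_inc P j
  obtain ⟨L, rfl⟩ := h.surj L
  obtain ⟨Q, ⟨M, R, N, h1, h2, h3, h4⟩, h5⟩ := hP L
  exact ⟨f Q, ⟨g M, f R, g N, hm h1, hm h2, hm h3, hm h4⟩, hm h5⟩

def shiftL'Pt (t : F) : Pt F → Pt F
  | p4 k b k' b' => p4 k b (k' + t) b'
  | p5 a l a' l' a'' => p5 a l a' (l' + t) a''
  | P => P

def shiftL'Ln (t : F) : Ln F → Ln F
  | l3 k b k' => l3 k b (k' + t)
  | l4 a l a' l' => l4 a l a' (l' + t)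
  | l5 k b k' b' k'' => l5 k b (k' + t) b' k''
  | L => L

def shiftLPt (t : F) : Pt F → Pt F
  | p3 a l a' => p3 a (l + t) a'
  | p4 k b k' b' => p4 k b (k' - k * t) b'
  | p5 a l a' l' a'' => p5 a (l + t) a' l' a''
  | P => P

def shiftLLn (t : F) : Ln F → Ln F
  | l2 a l => l2 a (l + t)
  | l3 k b k' => l3 k b (k' - k * t)
  | l4 a l a' l' => l4 a (l + t) a' l'
  | l5 k b k' b' k'' => l5 k b (k' - k * t) b' (k'' + t)
  | L => L

def shiftA'Pt (t : F) : Pt F → Pt F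
  | p3 a l a' => p3 a (l - 3 * a * t) (a' + t)
  | p4 k b k' b' => p4 k b (k' - 3 * t * b) (b' + t)
  | p5 a l a' l' a'' => p5 a (l - 3 * a * t) (a' + t) l' a''
  | P => P

def shiftA'Ln (t : F) : Ln F → Ln F
  | l2 a l => l2 a (l - 3 * a * t)
  | l3 k b k' => l3 k b (k' - 3 * t * b)
  | l4 a l a' l' => l4 a (l - 3 * a * t) (a' + t) l'
  | l5 k b k' b' k'' => l5 k b (k' - 3 * t * b) (b' + t) k''
  | L => L

def shiftBPt (t : F) : Pt F → Pt F
  | p2 k b => p2 k (b + t)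
  | p3 a l a' => p3 a (l - 3 * a ^ 2 * t) (a' + 2 * a * t)
  | p4 k b k' b' => p4 k (b + t) k' b'
  | p5 a l a' l' a'' =>
      p5 a (l - 3 * a ^ 2 * t) (a' + 2 * a * t) (l' + 3 * a' * t + 3 * a * t ^ 2) (a'' + t)
  | P => P

def shiftBLn (t : F) : Ln F → Ln F
  | l2 a l => l2 a (l - 3 * a ^ 2 * t)
  | l3 k b k' => l3 k (b + t) k'
  | l4 a l a' l' =>
      l4 a (l - 3 * a ^ 2 * t) (a' + 2 * a * t) (l' + 3 * a' * t + 3 * a * t ^ 2)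
  | l5 k b k' b' k'' => l5 k (b + t) k' b' k''
  | L => L

def shiftAPt (t : F) : Pt F → Pt F
  | p0 => p0
  | p1 a => p1 (a + t)
  | p2 k b => p2 k (b - k * t)
  | p3 a l a' => p3 (a + t) l a'
  | p4 k b k' b' =>
      p4 k (b - k * t) (k' + k ^ 2 * t ^ 3 - 3 * b * k * t ^ 2 + 3 * b ^ 2 * t)
        (b' + k * t ^ 2 - 2 * t * b)
  | p5 a l a' l' a'' => p5 (a + t) l a' l' a''

def shiftALn (t : F) : Ln F → Ln F
  | l0 => l0
  | l1 k => l1 k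
  | l2 a l => l2 (a + t) l
  | l3 k b k' => l3 k (b - k * t) (k' + k ^ 2 * t ^ 3 - 3 * b * k * t ^ 2 + 3 * b ^ 2 * t)
  | l4 a l a' l' => l4 (a + t) l a' l'
  | l5 k b k' b' k'' =>
      l5 k (b - k * t) (k' + k ^ 2 * t ^ 3 - 3 * b * k * t ^ 2 + 3 * b ^ 2 * t)
        (b' + k * t ^ 2 - 2 * t * b) (k'' + k * t ^ 3 - 3 * b * t ^ 2 + 3 * t * b')

def shiftKPt (t : F) : Pt F → Pt F
  | p0 => p0
  | p1 a => p1 a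
  | p2 k b => p2 (k + t) b
  | p3 a l a' => p3 a (l - a ^ 3 * t) (a' + a ^ 2 * t)
  | p4 k b k' b' => p4 (k + t) b k' b'
  | p5 a l a' l' a'' =>
      p5 a (l - a ^ 3 * t) (a' + a ^ 2 * t) (l' + t * l + 3 * a * a' * t + a ^ 3 * t ^ 2)
        (a'' + t * a)

def shiftKLn (t : F) : Ln F → Ln F
  | l0 => l0
  | l1 k => l1 (k + t)
  | l2 a l => l2 a (l - a ^ 3 * t)
  | l3 k b k' => l3 (k + t) b k'
  | l4 a l a' l' =>
      l4 a (l - a ^ 3 * t) (a' + a ^ 2 * t) (l' + t * l + 3 * a * a' * t + a ^ 3 * t ^ 2)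
  | l5 k b k' b' k'' => l5 (k + t) b k' b' k''

theorem isShift_L' (t : F) : IsShift (shiftL'Pt t) (shiftL'Ln t) := by
  constructor
  · intro P j
    cases P <;> cases j <;>
      simp [Inc, shiftL'Pt, shiftL'Ln, lineThrough, Option.exists]
    ring
  · intro L
    refine ⟨shiftL'Ln (-t) L, ?_⟩
    cases L <;> simp [shiftL'Ln]

theorem isShift_L (t : F) : IsShift (shiftLPt t) (shiftLLn t) := by
  constructor
  · intro P j
    cases P <;> cases j <;> simp [Inc, shiftLPt, shiftLLn, lineThrough, Option.exists]
    constructor <;> ring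
  · intro L
    refine ⟨shiftLLn (-t) L, ?_⟩
    cases L <;> simp [shiftLLn]

theorem isShift_A' (t : F) : IsShift (shiftA'Pt t) (shiftA'Ln t) := by
  constructor
  · intro P j
    cases P <;> cases j <;> simp [Inc, shiftA'Pt, shiftA'Ln, lineThrough, Option.exists]
    refine ⟨?_, ?_, ?_⟩ <;> ring
  · intro L
    refine ⟨shiftA'Ln (-t) L, ?_⟩
    cases L <;> simp [shiftA'Ln]

theorem isShift_B (t : F) : IsShift (shiftBPt t) (shiftBLn t) := by
  constructor
  · intro P j
    cases P <;> cases j <;> simp [Inc, shiftBPt, shiftBLn, lineThrough, Option.exists]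
    refine ⟨?_, ?_, ?_, ?_⟩ <;> ring
  · intro L
    refine ⟨shiftBLn (-t) L, ?_⟩
    cases L <;> simp [shiftBLn]
    ring

theorem isShift_A (t : F) : IsShift (shiftAPt t) (shiftALn t) := by
  constructor
  · intro P j
    cases P <;> cases j <;> simp [Inc, shiftAPt, shiftALn, lineThrough, Option.exists]
    refine ⟨?_, ?_, ?_, ?_⟩ <;> ring
  · intro L
    refine ⟨shiftALn (-t) L, ?_⟩
    cases L <;> simp [shiftALn]
    · ring
    · refine ⟨?_, ?_, ?_⟩ <;> ring

theorem isShift_K (t : F) : IsShift (shiftKPt t) (shiftKLn t) := by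
  constructor
  · intro P j
    cases P <;> cases j <;> simp [Inc, shiftKPt, shiftKLn, lineThrough, Option.exists]
    refine ⟨?_, ?_, ?_, ?_⟩ <;> ring
  · intro L
    refine ⟨shiftKLn (-t) L, ?_⟩
    cases L <;> simp [shiftKLn]
    ring

theorem ptNear_p5_zero_p5 {a l a' l' a'' : F}
    (h : a' ^ 2 + l * a'' - a * l' + a * a' * a'' = 0) :
    PtNear (p5 0 0 0 0 0) (p5 a l a' l' a'') := by
  by_cases hD : l + a * a' = 0
  · obtain rfl : l = -(a * a') := by linear_combination hD
    by_cases ha : a = 0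
    · subst ha
      obtain rfl : a' = 0 := by simpa using h
      refine ⟨l4 0 0 0 0, p3 0 0 0, l4 0 0 0 l', ?_, ?_, ?_, ?_⟩ <;>
        simp [Inc, lineThrough, Option.exists]
    · have hl' : l' = a' ^ 2 / a := by field_simp; linear_combination -h
      subst hl'
      refine ⟨l5 (a' / a ^ 2) 0 0 0 0, p5 a (-(a * a')) a' (a' ^ 2 / a) (a' / a),
        l4 a (-(a * a')) a' (a' ^ 2 / a), ?_, ?_, ?_, ?_⟩ <;>
        simp [Inc, lineThrough, Option.exists]
      refine ⟨?_, ?_, ?_, ?_⟩ <;> field_simp <;> ring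
  · by_cases hT : a * a'' - a' = 0
    · obtain rfl : a' = a * a'' := by linear_combination -hT
      by_cases ha : a = 0
      · subst ha
        have hl : l ≠ 0 := by simpa using hD
        obtain rfl : a'' = 0 := by simpa [hl] using h
        refine ⟨l5 (l' / l) 0 0 0 0, p4 (l' / l) 0 0 0, l5 (l' / l) 0 0 0 l, ?_, ?_, ?_, ?_⟩ <;>
          simp [Inc, lineThrough, Option.exists]
        field_simp
        ring
      · refine ⟨l5 (a'' / a) 0 0 0 0, p4 (a'' / a) 0 0 0,
          l5 (a'' / a) 0 0 0 ((l + a * (a * a''))), ?_, ?_, ?_, ?_⟩ <;>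
          simp [Inc, lineThrough, Option.exists]
        have hl' : l' = (a * a'') ^ 2 / a + l * a'' / a + a * a'' * a'' := by
          field_simp; linear_combination -h
        subst hl'
        refine ⟨?_, ?_, ?_, ?_⟩ <;> field_simp <;> ring
    · obtain ⟨e, he⟩ : ∃ e, e = (l + a * a') / (a * a'' - a') := ⟨_, rfl⟩
      have he0 : e ≠ 0 := by rw [he]; exact div_ne_zero hD hT
      have hl : l = e * (a * a'' - a') - a * a' := by rw [he]; field_simp; ring
      subst hl
      by_cases hae : a = e
      · subst hae
        have hl' : l' = (a' ^ 2 + (a * (a * a'' - a') - a * a') * a'' + a * a' * a'') / a := by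
          field_simp; linear_combination -h
        subst hl'
        refine ⟨l4 0 0 0 0, p5 0 0 0 0 (-(a * a'' - a') / a),
          l5 ((a' + 2 * (a * a'' - a')) / a ^ 2) (-(a * a'' - a') / a) 0 0 0, ?_, ?_, ?_, ?_⟩ <;>
          simp [Inc, lineThrough, Option.exists]
        refine ⟨?_, ?_, ?_, ?_⟩ <;> field_simp <;> ring
      · have hc : a - e ≠ 0 := sub_ne_zero.mpr hae
        obtain ⟨c, rfl⟩ : ∃ c, a = c + e := ⟨a - e, by ring⟩
        have hc0 : c ≠ 0 := by simpa using hc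
        obtain ⟨d, hd⟩ : ∃ d, d = ((c + e) * a'' - a') / (e * c) := ⟨_, rfl⟩
        obtain rfl : a' = (c + e) * a'' - d * e * c := by rw [hd]; field_simp; ring
        have hd0 : d ≠ 0 := by
          rintro rfl
          simp at hT
        have key : ∃ k, a'' = k * (c + e) + d * e ∧
            l' = k ^ 2 * (c + e) ^ 3 + k * d * (2 * e ^ 3 + 3 * e ^ 2 * c) + d ^ 2 * e ^ 3 := by
          clear he hd
          by_cases ha : c + e = 0
          · obtain rfl : e = -c := by linear_combination ha
            refine ⟨(l' + d ^ 2 * c ^ 3) / (d * c ^ 3), ?_, ?_⟩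
            · have : d * c ^ 3 * (a'' + d * c) = 0 := by linear_combination h
              have := (mul_eq_zero.mp this).resolve_left (by simp [hd0, hc0])
              linear_combination this
            · field_simp
              ring
          · obtain ⟨k, hk⟩ : ∃ k, k = (a'' - d * e) / (c + e) := ⟨_, rfl⟩
            obtain rfl : a'' = k * (c + e) + d * e := by rw [hk]; field_simp; ring
            refine ⟨k, rfl, mul_left_cancel₀ ha ?_⟩
            linear_combination -h
        obtain ⟨k, rfl, rfl⟩ := key
        refine ⟨l5 k 0 0 0 0, p5 c (-k * c ^ 3) (k * c ^ 2) (k ^ 2 * c ^ 3) (k * c),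
          l5 (k + d) (-d * c) (d ^ 2 * c ^ 3) (d * c ^ 2) (d * c ^ 3), ?_, ?_, ?_, ?_⟩ <;>
          simp [Inc, lineThrough, Option.exists]
        · refine ⟨?_, ?_, ?_⟩ <;> ring
        · refine ⟨?_, ?_, ?_, ?_⟩ <;> ring
        · refine ⟨?_, ?_, ?_, ?_⟩ <;> ring

theorem ptNear_p5_zero_p4 {k b b' : F} : PtNear (p5 0 0 0 0 0) (p4 k b (-(b * b')) b') := by
  by_cases hb : b = 0
  · subst hb
    refine ⟨l5 k 0 0 0 0, p4 k 0 0 0, l3 k 0 0, ?_, ?_, ?_, ?_⟩ <;>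
      simp [Inc, lineThrough, Option.exists]
  by_cases hb' : b' = 0
  · subst hb'
    refine ⟨l4 0 0 0 0, p5 0 0 0 0 b, l5 k b 0 0 0, ?_, ?_, ?_, ?_⟩ <;>
      simp [Inc, lineThrough, Option.exists]
  obtain ⟨a, ha⟩ : ∃ a, a = -b' / b := ⟨_, rfl⟩
  have ha0 : a ≠ 0 := by rw [ha]; exact div_ne_zero (neg_ne_zero.mpr hb') hb
  obtain rfl : b' = -(b * a) := by rw [ha]; field_simp
  clear ha
  obtain ⟨m, hm⟩ : ∃ m, m = k + b / a := ⟨_, rfl⟩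
  obtain rfl : b = (m - k) * a := by rw [hm]; field_simp; ring
  clear hm
  refine ⟨l5 m 0 0 0 0, p5 a (-m * a ^ 3) (m * a ^ 2) (m ^ 2 * a ^ 3) (m * a),
    l5 k ((m - k) * a) (-((m - k) * a * -((m - k) * a * a))) (-((m - k) * a * a))
      ((k - m) * a ^ 3),
    ?_, ?_, ?_, ?_⟩ <;>
    simp [Inc, lineThrough, Option.exists]
  · refine ⟨?_, ?_, ?_⟩ <;> ring
  · refine ⟨?_, ?_, ?_, ?_⟩ <;> ring

theorem ptNear_p5_zero_p3 {a a' : F} : PtNear (p5 0 0 0 0 0) (p3 a (-(a * a')) a') := by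
  by_cases ha : a = 0
  · subst ha
    refine ⟨l4 0 0 0 0, p3 0 0 0, l2 0 0, ?_, ?_, ?_, ?_⟩ <;>
      simp [Inc, lineThrough, Option.exists]
  · refine ⟨l5 (a' / a ^ 2) 0 0 0 0, p5 a (-(a * a')) a' (a' ^ 2 / a) (a' / a),
      l4 a (-(a * a')) a' (a' ^ 2 / a), ?_, ?_, ?_, ?_⟩ <;>
      simp [Inc, lineThrough, Option.exists]
    refine ⟨?_, ?_, ?_, ?_⟩ <;> field_simp <;> ring

theorem ptNear_p5_zero_p2 {k : F} : PtNear (p5 0 0 0 0 0) (p2 k 0) := by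
  refine ⟨l5 k 0 0 0 0, p4 k 0 0 0, l3 k 0 0, ?_, ?_, ?_, ?_⟩ <;>
    simp [Inc, lineThrough, Option.exists]

theorem ptNear_p5_zero_p1 : PtNear (p5 0 0 0 0 0) (p1 (0 : F)) := by
  refine ⟨l4 0 0 0 0, p3 0 0 0, l2 0 0, ?_, ?_, ?_, ?_⟩ <;>
    simp [Inc, lineThrough, Option.exists]

theorem near_p5_zero (L : Ln F) : Near (p5 0 0 0 0 0) L := by
  match L with
  | l0 => exact ⟨_, ptNear_p5_zero_p1, none, rfl⟩
  | l1 k => exact ⟨_, ptNear_p5_zero_p2, none, rfl⟩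
  | l2 a l =>
    by_cases ha : a = 0
    · subst ha
      exact ⟨_, ptNear_p5_zero_p1, some l, rfl⟩
    · obtain ⟨t, rfl⟩ : ∃ t, l = -(a * t) := ⟨-l / a, by field_simp⟩
      exact ⟨_, ptNear_p5_zero_p3, none, rfl⟩
  | l3 k b k' =>
    by_cases hb : b = 0
    · subst hb
      exact ⟨_, ptNear_p5_zero_p2, some k', rfl⟩
    · obtain ⟨t, rfl⟩ : ∃ t, k' = -(b * t) := ⟨-k' / b, by field_simp⟩
      exact ⟨_, ptNear_p5_zero_p4, none, rfl⟩
  | l4 a l a' l' =>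
    by_cases hD : l + a * a' = 0
    · obtain rfl : l = -(a * a') := by linear_combination hD
      exact ⟨_, ptNear_p5_zero_p3, some l', rfl⟩
    · obtain ⟨D, rfl⟩ : ∃ D, l = D - a * a' := ⟨l + a * a', by ring⟩
      have hD0 : D ≠ 0 := by simpa using hD
      refine ⟨p5 a (D - a * a') a' l' ((a * l' - a' ^ 2) / D), ptNear_p5_zero_p5 ?_, none, rfl⟩
      field_simp
      ring
  | l5 k b k' b' k'' =>
    by_cases hD : k' + b * b' = 0
    · obtain rfl : k' = -(b * b') := by linear_combination hD
      exact ⟨_, ptNear_p5_zero_p4, some k'', rfl⟩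
    · obtain ⟨D, rfl⟩ : ∃ D, k' = D - b * b' := ⟨k' + b * b', by ring⟩
      have hD0 : D ≠ 0 := by simpa using hD
      have h := inc_pointOn (l5 k b (D - b * b') b' k'') (some ((b' ^ 2 + b * k'') / D))
      refine ⟨_, ?_, h⟩
      simp only [pointOn]
      apply ptNear_p5_zero_p5
      field_simp
      ring

theorem ptNear_p4_zero_p5 {a l a' a'' : F} :
    PtNear (p4 0 0 0 0) (p5 a l a' (a' * a'') a'') := by
  by_cases ha' : a' = 0
  · subst ha'
    refine ⟨l5 0 0 0 0 l, p5 a l 0 0 0, l4 a l 0 0, ?_, ?_, ?_, ?_⟩ <;>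
      simp [Inc, lineThrough, Option.exists]
  by_cases ha'' : a'' = 0
  · subst ha''
    refine ⟨l3 0 0 0, p4 0 0 0 a', l5 0 0 0 a' (l + 3 * a * a'), ?_, ?_, ?_, ?_⟩ <;>
      simp [Inc, lineThrough, Option.exists]
  obtain ⟨d, hd⟩ : ∃ d, d = -a' / a'' := ⟨_, rfl⟩
  have hd0 : d ≠ 0 := by rw [hd]; exact div_ne_zero (neg_ne_zero.mpr ha') ha''
  obtain ⟨m, hm⟩ : ∃ m, m = -a'' / d := ⟨_, rfl⟩
  obtain rfl : a' = -(d * a'') := by rw [hd]; field_simp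
  obtain rfl : a'' = -(m * d) := by rw [hm]; field_simp
  clear hd hm
  obtain ⟨c, rfl⟩ : ∃ c, l = c + m * d ^ 3 := ⟨l - m * d ^ 3, by ring⟩
  refine ⟨l5 0 0 0 0 c, p5 (a + d) c 0 0 0, l5 m (-m * (a + d))
    (m ^ 2 * (a + d) ^ 3 - m * c) (m * (a + d) ^ 2) (m * (a + d) ^ 3 + c), ?_, ?_, ?_, ?_⟩ <;>
    simp [Inc, lineThrough, Option.exists]
  refine ⟨?_, ?_, ?_, ?_⟩ <;> ring

theorem ptNear_p4_zero_p4 {k b k' b' : F} (h : b ^ 2 = k * b') :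
    PtNear (p4 0 0 0 0) (p4 k b k' b') := by
  by_cases hk : k = 0
  · subst hk
    obtain rfl : b = 0 := by simpa using h
    refine ⟨l3 0 0 0, p2 0 0, l3 0 0 k', ?_, ?_, ?_, ?_⟩ <;>
      simp [Inc, lineThrough, Option.exists]
  · obtain ⟨a, ha⟩ : ∃ a, a = -b / k := ⟨_, rfl⟩
    obtain rfl : b = -(k * a) := by rw [ha]; field_simp
    obtain rfl : b' = k * a ^ 2 := mul_left_cancel₀ hk (by linear_combination -h)
    obtain ⟨c, hc⟩ : ∃ c, c = k * a ^ 3 - k' / k := ⟨_, rfl⟩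
    obtain rfl : k' = k * (k * a ^ 3 - c) := by rw [hc]; field_simp; ring
    refine ⟨l5 0 0 0 0 c, p5 a c 0 0 0, l5 k (-(k * a)) (k * (k * a ^ 3 - c)) (k * a ^ 2)
      (k * a ^ 3 + c), ?_, ?_, ?_, ?_⟩ <;>
      simp [Inc, lineThrough, Option.exists]
    ring

theorem ptNear_p4_zero_p3 {a l : F} : PtNear (p4 0 0 0 0) (p3 a l 0) := by
  refine ⟨l5 0 0 0 0 l, p5 a l 0 0 0, l4 a l 0 0, ?_, ?_, ?_, ?_⟩ <;>
    simp [Inc, lineThrough, Option.exists]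

theorem ptNear_p4_zero_p2 {b : F} : PtNear (p4 0 0 0 0) (p2 0 b) := by
  refine ⟨l3 0 0 0, p2 0 0, l1 0, ?_, ?_, ?_, ?_⟩ <;>
    simp [Inc, lineThrough, Option.exists]

theorem ptNear_p4_zero_p0 : PtNear (p4 0 0 0 (0 : F)) p0 := by
  refine ⟨l3 0 0 0, p2 0 0, l1 0, ?_, ?_, ?_, ?_⟩ <;>
    simp [Inc, lineThrough, Option.exists]

theorem near_p4_zero (L : Ln F) : Near (p4 0 0 0 0) L := by
  match L with
  | l0 => exact ⟨_, ptNear_p4_zero_p0, none, rfl⟩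
  | l1 k => exact ⟨_, ptNear_p4_zero_p0, some k, rfl⟩
  | l2 a l => exact ⟨_, ptNear_p4_zero_p3, none, rfl⟩
  | l3 k b k' =>
    by_cases hk : k = 0
    · subst hk
      exact ⟨_, ptNear_p4_zero_p2, some k', rfl⟩
    · exact ⟨p4 k b k' (b ^ 2 / k), ptNear_p4_zero_p4 (by field_simp), none, rfl⟩
  | l4 a l a' l' =>
    by_cases ha' : a' = 0
    · subst ha'
      exact ⟨_, ptNear_p4_zero_p3, some l', rfl⟩
    · obtain ⟨t, rfl⟩ : ∃ t, l' = a' * t := ⟨l' / a', by field_simp⟩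
      exact ⟨_, ptNear_p4_zero_p5, none, rfl⟩
  | l5 k b k' b' k'' =>
    by_cases hD : b ^ 2 = k * b'
    · exact ⟨_, ptNear_p4_zero_p4 hD, some k'', rfl⟩
    · have hD' : b ^ 2 - k * b' ≠ 0 := sub_ne_zero.mpr hD
      have h := inc_pointOn (l5 k b k' b' k'')
        (some (-(k' + k * k'' + 2 * b * b') / (b ^ 2 - k * b')))
      refine ⟨_, ?_, h⟩
      simp only [pointOn]
      convert ptNear_p4_zero_p5 using 2
      field_simp
      ring

theorem ptNear_p3_zero_p5 {a l a' l' a'' : F} (h : l + 2 * a * a' - a ^ 2 * a'' = 0) :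
    PtNear (p3 0 0 0) (p5 a l a' l' a'') := by
  obtain rfl : l = a ^ 2 * a'' - 2 * a * a' := by linear_combination h
  by_cases ha : a = 0
  · subst ha
    refine ⟨l2 0 0, p3 0 0 a', l4 0 0 a' l', ?_, ?_, ?_, ?_⟩ <;>
      simp [Inc, lineThrough, Option.exists]
  · obtain ⟨m, hm⟩ : ∃ m, m = (2 * a * a'' - a') / a ^ 2 := ⟨_, rfl⟩
    obtain rfl : a' = 2 * a * a'' - m * a ^ 2 := by rw [hm]; field_simp; ring
    obtain ⟨d, rfl⟩ : ∃ d, a'' = d + m * a := ⟨a'' - m * a, by ring⟩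
    refine ⟨l4 0 0 0 (l' - m ^ 2 * a ^ 3 - 3 * m * a ^ 2 * d - 3 * a * d ^ 2),
      p5 0 0 0 (l' - m ^ 2 * a ^ 3 - 3 * m * a ^ 2 * d - 3 * a * d ^ 2) d,
      l5 m d (l' - m ^ 2 * a ^ 3 - 3 * m * a ^ 2 * d - 3 * a * d ^ 2) 0 0, ?_, ?_, ?_, ?_⟩ <;>
      simp [Inc, lineThrough, Option.exists]
    constructor <;> ring

theorem ptNear_p3_zero_p4 {k b k' : F} : PtNear (p3 0 0 0) (p4 k b k' 0) := by
  refine ⟨l4 0 0 0 k', p5 0 0 0 k' b, l5 k b k' 0 0, ?_, ?_, ?_, ?_⟩ <;>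
    simp [Inc, lineThrough, Option.exists]

theorem ptNear_p3_zero_p3 {l a' : F} : PtNear (p3 0 0 0) (p3 0 l a') := by
  refine ⟨l2 0 0, p1 0, l2 0 l, ?_, ?_, ?_, ?_⟩ <;>
    simp [Inc, lineThrough, Option.exists]

theorem ptNear_p3_zero_p1 {a : F} : PtNear (p3 0 0 0) (p1 a) := by
  refine ⟨l2 0 0, p1 0, l0, ?_, ?_, ?_, ?_⟩ <;>
    simp [Inc, lineThrough, Option.exists]

theorem ptNear_p3_zero_p0 : PtNear (p3 0 0 (0 : F)) p0 := by
  refine ⟨l2 0 0, p1 0, l0, ?_, ?_, ?_, ?_⟩ <;>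
    simp [Inc, lineThrough, Option.exists]

theorem near_p3_zero (L : Ln F) : Near (p3 0 0 0) L := by
  match L with
  | l0 => exact ⟨_, ptNear_p3_zero_p0, none, rfl⟩
  | l1 k => exact ⟨_, ptNear_p3_zero_p0, some k, rfl⟩
  | l2 a l => exact ⟨_, ptNear_p3_zero_p1, some l, rfl⟩
  | l3 k b k' => exact ⟨_, ptNear_p3_zero_p4, none, rfl⟩
  | l4 a l a' l' =>
    by_cases ha : a = 0
    · subst ha
      exact ⟨_, ptNear_p3_zero_p3, some l', rfl⟩
    · refine ⟨p5 a l a' l' ((l + 2 * a * a') / a ^ 2), ptNear_p3_zero_p5 ?_, none, rfl⟩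
      field_simp
      ring
  | l5 k b k' b' k'' =>
    by_cases hb' : b' = 0
    · subst hb'
      exact ⟨_, ptNear_p3_zero_p4, some k'', rfl⟩
    · have h := inc_pointOn (l5 k b k' b' k'') (some (k'' / b'))
      refine ⟨_, ?_, h⟩
      simp only [pointOn]
      apply ptNear_p3_zero_p5
      field_simp
      ring

theorem near_p2_zero (L : Ln F) : Near (p2 0 0) L := by
  match L with
  | l0 => exact ⟨p0, ⟨l1 0, p0, l0, ⟨none, rfl⟩, ⟨some 0, rfl⟩, ⟨none, rfl⟩, ⟨none, rfl⟩⟩,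
      none, rfl⟩
  | l1 k => exact ⟨p0, ⟨l1 0, p0, l0, ⟨none, rfl⟩, ⟨some 0, rfl⟩, ⟨none, rfl⟩, ⟨none, rfl⟩⟩,
      some k, rfl⟩
  | l2 a l => exact ⟨p1 a, ⟨l1 0, p0, l0, ⟨none, rfl⟩, ⟨some 0, rfl⟩, ⟨none, rfl⟩, ⟨none, rfl⟩⟩,
      some l, rfl⟩
  | l3 k b k' =>
    exact ⟨p2 k b, ⟨l1 0, p0, l1 k, ⟨none, rfl⟩, ⟨some 0, rfl⟩, ⟨some k, rfl⟩, ⟨none, rfl⟩⟩,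
      some k', rfl⟩
  | l4 a l a' l' =>
    refine ⟨p5 a l a' l' 0, ⟨l3 0 0 l', p4 0 0 l' a', l5 0 0 l' a' (l + 3 * a * a'),
      ?_, ?_, ?_, ?_⟩, none, rfl⟩ <;>
      simp [Inc, lineThrough, Option.exists]
  | l5 k b k' b' k'' =>
    by_cases hk : k = 0
    · subst hk
      exact ⟨p4 0 b k' b', ⟨l1 0, p2 0 b, l3 0 b k', ⟨none, rfl⟩, ⟨none, rfl⟩, ⟨some k', rfl⟩,
        ⟨none, rfl⟩⟩, some k'', rfl⟩
    · obtain ⟨a, ha⟩ : ∃ a, a = -b / k := ⟨_, rfl⟩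
      obtain rfl : b = -(k * a) := by rw [ha]; field_simp
      have key : ∀ l a' l' : F, PtNear (p2 0 0) (p5 a l a' l' 0) := by
        intro l a' l'
        refine ⟨l3 0 0 l', p4 0 0 l' a', l5 0 0 l' a' (l + 3 * a * a'), ?_, ?_, ?_, ?_⟩ <;>
          simp [Inc, lineThrough, Option.exists]
      refine ⟨_, ?_, inc_pointOn _ (some a)⟩
      simp only [pointOn, add_neg_cancel]
      exact key _ _ _

theorem near_p1_zero (L : Ln F) : Near (p1 0) L := by
  match L with
  | l0 => exact ⟨p0, ⟨l0, p0, l0, ⟨none, rfl⟩, ⟨none, rfl⟩, ⟨none, rfl⟩, ⟨none, rfl⟩⟩,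
      none, rfl⟩
  | l1 k => exact ⟨p0, ⟨l0, p0, l0, ⟨none, rfl⟩, ⟨none, rfl⟩, ⟨none, rfl⟩, ⟨none, rfl⟩⟩,
      some k, rfl⟩
  | l2 a l => exact ⟨p1 a, ⟨l0, p0, l0, ⟨none, rfl⟩, ⟨none, rfl⟩, ⟨none, rfl⟩, ⟨none, rfl⟩⟩,
      some l, rfl⟩
  | l3 k b k' =>
    exact ⟨p2 k b, ⟨l0, p0, l1 k, ⟨none, rfl⟩, ⟨none, rfl⟩, ⟨some k, rfl⟩, ⟨none, rfl⟩⟩,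
      some k', rfl⟩
  | l4 a l a' l' =>
    exact ⟨p3 a l a', ⟨l0, p1 a, l2 a l, ⟨none, rfl⟩, ⟨none, rfl⟩, ⟨some l, rfl⟩, ⟨none, rfl⟩⟩,
      some l', rfl⟩
  | l5 k b k' b' k'' =>
    refine ⟨_, ?_, inc_pointOn _ (some 0)⟩
    exact ⟨l2 0 _, p3 0 _ _, l4 0 _ _ _, ⟨some _, rfl⟩, ⟨none, rfl⟩, ⟨some _, rfl⟩, ⟨none, rfl⟩⟩

theorem near_p0 (L : Ln F) : Near p0 L := by
  match L with
  | l0 => exact ⟨p0, ⟨l0, p0, l0, ⟨none, rfl⟩, ⟨none, rfl⟩, ⟨none, rfl⟩, ⟨none, rfl⟩⟩,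
      none, rfl⟩
  | l1 k => exact ⟨p0, ⟨l0, p0, l0, ⟨none, rfl⟩, ⟨none, rfl⟩, ⟨none, rfl⟩, ⟨none, rfl⟩⟩,
      some k, rfl⟩
  | l2 a l => exact ⟨p1 a, ⟨l0, p0, l0, ⟨none, rfl⟩, ⟨none, rfl⟩, ⟨none, rfl⟩, ⟨none, rfl⟩⟩,
      some l, rfl⟩
  | l3 k b k' =>
    exact ⟨p2 k b, ⟨l0, p0, l1 k, ⟨none, rfl⟩, ⟨none, rfl⟩, ⟨some k, rfl⟩, ⟨none, rfl⟩⟩,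
      some k', rfl⟩
  | l4 a l a' l' =>
    exact ⟨p3 a l a', ⟨l0, p1 a, l2 a l, ⟨none, rfl⟩, ⟨none, rfl⟩, ⟨some l, rfl⟩, ⟨none, rfl⟩⟩,
      some l', rfl⟩
  | l5 k b k' b' k'' =>
    exact ⟨p4 k b k' b', ⟨l1 k, p2 k b, l3 k b k', ⟨some k, rfl⟩, ⟨none, rfl⟩, ⟨some k', rfl⟩,
      ⟨none, rfl⟩⟩, some k'', rfl⟩

/-- A point and a line of the hexagon are joined by a path of length at most five. -/
theorem near (P : Pt F) (L : Ln F) : Near P L := by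
  revert L
  match P with
  | p0 => exact near_p0
  | p1 a => simpa [shiftAPt] using (isShift_A a).near near_p1_zero
  | p2 k b =>
    simpa [shiftKPt, shiftBPt] using (isShift_B b).near ((isShift_K k).near near_p2_zero)
  | p3 a l a' =>
    have h := (isShift_L (l + 3 * a * a')).near
      ((isShift_A' a').near ((isShift_A a).near near_p3_zero))
    simpa [shiftAPt, shiftA'Pt, shiftLPt] using h
  | p4 k b k' b' =>
    have h := (isShift_L' (k' + 3 * b' * b)).near ((isShift_A' b').near
      ((isShift_B b).near ((isShift_K k).near near_p4_zero)))
    simpa [shiftKPt, shiftBPt, shiftA'Pt, shiftL'Pt] using h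
  | p5 a l a' l' a'' =>
    have h := (isShift_L' (l' - 3 * a * a'' ^ 2)).near
      ((isShift_L (l + 3 * a ^ 2 * a'' + 3 * a * (a' - 2 * a * a''))).near
      ((isShift_A' (a' - 2 * a * a'')).near
      ((isShift_B a'').near ((isShift_A a).near near_p5_zero))))
    have e : shiftL'Pt (l' - 3 * a * a'' ^ 2)
        (shiftLPt (l + 3 * a ^ 2 * a'' + 3 * a * (a' - 2 * a * a''))
        (shiftA'Pt (a' - 2 * a * a'') (shiftBPt a'' (shiftAPt a (p5 0 0 0 0 0))))) =
        p5 a l a' l' a'' := by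
      simp [shiftAPt, shiftBPt, shiftA'Pt, shiftLPt, shiftL'Pt]
    rwa [e] at h

/-- Two lines of the shape `l5 0 s t 0 s` which are joined by a path of length at most four
coincide. -/
theorem l5_eq_of_path (h2 : (2 : F) ≠ 0) (hsq : ∀ x : F, x ^ 2 ≠ -1) {s t s' t' : F} {p q : Pt F}
    {M : Ln F} (hp : Inc p (l5 0 s t 0 s)) (hpM : Inc p M) (hqM : Inc q M)
    (hq : Inc q (l5 0 s' t' 0 s')) : s = s' ∧ t = t' := by
  obtain ⟨i, rfl⟩ := hpM
  obtain ⟨j, h⟩ := hqM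
  obtain ⟨m, rfl⟩ := inc_iff_exists_pointOn.mp hp
  obtain ⟨n, rfl⟩ := inc_iff_exists_pointOn.mp hq
  cases m <;> cases n <;> cases i <;> cases j <;> simp [pointOn, lineThrough] at h ⊢
  case none.none.none.none => exact ⟨h.1.symm, h.2.symm⟩
  case none.none.some.some => exact ⟨h.1.symm, h.2.1.symm⟩
  case none.some.some.some a c k =>
    obtain ⟨rfl, h, h', -⟩ := h
    obtain rfl : s' = s := by linear_combination h
    exact ⟨rfl, by linear_combination -h'⟩
  case some.none.some.some a k c =>
    obtain ⟨rfl, h, h', -⟩ := h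
    obtain rfl : s' = s := by linear_combination h
    exact ⟨rfl, by linear_combination -h'⟩
  case some.some.none.none a b =>
    obtain ⟨rfl, h, h', h''⟩ := h
    have hs : s' = s := by
      by_cases hb : b = 0
      · subst hb
        linear_combination h
      · refine mul_left_cancel₀ (mul_ne_zero h2 hb) ?_
        linear_combination h'
    subst hs
    exact ⟨rfl, by linear_combination -h''⟩
  case some.some.some.some a b m k =>
    obtain ⟨rfl, hb, hk, hb', hk'⟩ := h
    by_cases hk0 : k = 0
    · subst hk0
      obtain rfl : s' = s := by linear_combination hb
      exact ⟨rfl, by linear_combination -hk⟩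
    by_cases hba : b = a
    · subst hba
      obtain rfl : s' = s := by linear_combination hb
      exact ⟨rfl, by linear_combination -hk⟩
    obtain rfl : b = -a := by
      have := mul_left_cancel₀ hk0 hb'
      exact (sq_eq_sq_iff_eq_or_eq_neg.mp this).resolve_left hba
    have ha : a ≠ 0 := by
      rintro rfl
      simp at hba
    refine absurd ?_ (hsq a)
    refine mul_left_cancel₀ (mul_ne_zero (mul_ne_zero h2 hk0) ha) ?_
    linear_combination hb - hk'

open Finset in
open scoped Classical in
/-- A layer `T` all of whose elements are related to the layer `S`, where every element of `S` has
`q + 1` neighbours, one of them outside of `T`, has at most `q * #S` elements; in the case of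
equality every element of `T` is related to only one element of `S`. -/
theorem card_layer_le {α β : Type} [Fintype β] (r : α → β → Prop) {q : ℕ} {S : Finset α}
    {T : Finset β} (hdeg : ∀ a ∈ S, #{b | r a b} = q + 1) (hout : ∀ a ∈ S, ∃ b ∉ T, r a b)
    (hcov : ∀ b ∈ T, ∃ a ∈ S, r a b) :
    #T ≤ q * #S ∧ (q * #S ≤ #T →
      ∀ b ∈ T, ∀ a ∈ S, ∀ a' ∈ S, r a b → r a' b → a = a') := by
  have h1 : ∀ a ∈ S, #(T.bipartiteAbove r a) ≤ q := by
    intro a ha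
    obtain ⟨b, hb, hab⟩ := hout a ha
    have : T.bipartiteAbove r a ⊂ ({b | r a b} : Finset β) := by
      rw [Finset.ssubset_iff_of_subset (fun x hx => by simp [bipartiteAbove] at hx ⊢; exact hx.2)]
      exact ⟨b, by simpa using hab, by simp [bipartiteAbove, hb]⟩
    have := card_lt_card this
    rw [hdeg a ha] at this
    omega
  have h2 : ∀ b ∈ T, 1 ≤ #(S.bipartiteBelow r b) := by
    intro b hb
    obtain ⟨a, ha, hab⟩ := hcov b hb
    exact card_pos.mpr ⟨a, by simp [bipartiteBelow, ha, hab]⟩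
  have h3 := sum_card_bipartiteAbove_eq_sum_card_bipartiteBelow r (s := S) (t := T)
  have h4 : ∑ a ∈ S, #(T.bipartiteAbove r a) ≤ q * #S := by
    rw [mul_comm]
    exact sum_le_card_nsmul S _ q h1
  have h5 : #T ≤ ∑ b ∈ T, #(S.bipartiteBelow r b) := by
    simpa using card_nsmul_le_sum T _ 1 h2
  refine ⟨by omega, fun h b hb a ha a' ha' hab hab' => ?_⟩
  have h6 : ∑ b ∈ T, 1 = ∑ b ∈ T, #(S.bipartiteBelow r b) := by
    rw [← card_eq_sum_ones]
    omega
  have h7 := (sum_eq_sum_iff_of_le h2).mp h6 b hb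
  exact card_le_one.mp h7.ge a (by simp [bipartiteBelow, ha, hab]) a'
    (by simp [bipartiteBelow, ha', hab'])

open Finset in
open scoped Classical in
/-- In a biregular incidence geometry which attains the Moore bound of generalized hexagons,
shortest paths to a line `w` of length less than six are unique. -/
theorem unique_path_of_card {P L : Type} [Fintype P] [Fintype L] {I : P → L → Prop} {q : ℕ}
    (hL : ∀ l, #{p | I p l} = q + 1) (hP : ∀ p, #{l | I p l} = q + 1)
    (hcard : (q + 1) * (1 + q ^ 2 + q ^ 4) ≤ Fintype.card P) (w : L)
    (hnear : ∀ p, ∃ M r N s, I p M ∧ I r M ∧ I r N ∧ I s N ∧ I s w) :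
    (∀ y, y ≠ w → ∀ n n', I n y → I n' y → I n w → I n' w → n = n') ∧
    (∀ y, (¬ ∃ p, I p w ∧ I p y) → ∀ n n', I n y → I n' y →
      (∃ p M, I p w ∧ I p M ∧ I n M) → (∃ p M, I p w ∧ I p M ∧ I n' M) → n = n') ∧
    (∀ y, (¬ ∃ p M, I p w ∧ I p M ∧ I y M) → ∀ n n', I y n → I y n' →
      (∃ p M s, I p w ∧ I p M ∧ I s M ∧ I s n) →
      (∃ p M s, I p w ∧ I p M ∧ I s M ∧ I s n') → n = n') := by
  have sepP : ∀ Q : P → Prop, ∃ A : Finset P, ∀ p, p ∈ A ↔ Q p := fun Q => ⟨filter Q univ, by simp⟩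
  have sepL : ∀ Q : L → Prop, ∃ A : Finset L, ∀ m, m ∈ A ↔ Q m := fun Q => ⟨filter Q univ, by simp⟩
  obtain ⟨A1, hA1⟩ : ∃ A : Finset P, ∀ p, p ∈ A ↔ I p w := sepP _
  obtain ⟨A2, hA2⟩ : ∃ A : Finset L, ∀ m, m ∈ A ↔ m ≠ w ∧ ∃ p ∈ A1, I p m := sepL _
  obtain ⟨A3, hA3⟩ : ∃ A : Finset P, ∀ p, p ∈ A ↔ p ∉ A1 ∧ ∃ m ∈ A2, I p m := sepP _
  obtain ⟨A4, hA4⟩ : ∃ A : Finset L, ∀ m, m ∈ A ↔ (m ∉ A2 ∧ m ≠ w) ∧ ∃ p ∈ A3, I p m := sepL _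
  obtain ⟨A5, hA5⟩ : ∃ A : Finset P, ∀ p, p ∈ A ↔ (p ∉ A1 ∧ p ∉ A3) ∧ ∃ m ∈ A4, I p m := sepP _
  have c1 : #A1 = q + 1 := by
    rw [← hL w]
    congr 1
    ext p
    simp [hA1]
  obtain ⟨c2, u2⟩ := card_layer_le (q := q) I (S := A1) (T := A2) (fun a _ => hP a)
    (fun a ha => ⟨w, by simp [hA2], (hA1 a).mp ha⟩) (fun b hb => ((hA2 b).mp hb).2)
  obtain ⟨c3, u3⟩ := card_layer_le (q := q) (fun l p => I p l) (S := A2) (T := A3)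
    (fun a _ => hL a)
    (fun a ha => by
      obtain ⟨p, hp, h⟩ := ((hA2 a).mp ha).2
      exact ⟨p, by simp [hA3, hp], h⟩) (fun b hb => ((hA3 b).mp hb).2)
  obtain ⟨c4, u4⟩ := card_layer_le (q := q) I (S := A3) (T := A4) (fun a _ => hP a)
    (fun a ha => by
      obtain ⟨p, hp, h⟩ := ((hA3 a).mp ha).2
      exact ⟨p, by simp [hA4, hp], h⟩) (fun b hb => ((hA4 b).mp hb).2)
  obtain ⟨c5, u5⟩ := card_layer_le (q := q) (fun l p => I p l) (S := A4) (T := A5)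
    (fun a _ => hL a)
    (fun a ha => by
      obtain ⟨p, hp, h⟩ := ((hA4 a).mp ha).2
      exact ⟨p, by simp [hA5, hp], h⟩) (fun b hb => ((hA5 b).mp hb).2)
  have m2 : ∀ {p m}, I p w → I p m → m = w ∨ m ∈ A2 := by
    intro p m h h'
    by_cases hm : m = w
    · exact .inl hm
    · exact .inr ((hA2 m).mpr ⟨hm, p, (hA1 p).mpr h, h'⟩)
  have m3 : ∀ {p M s}, I p w → I p M → I s M → s ∈ A1 ∨ s ∈ A3 := by
    intro p M s h h' h''
    by_cases hs : s ∈ A1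
    · exact .inl hs
    rcases m2 h h' with rfl | hM
    · exact .inl ((hA1 s).mpr h'')
    · exact .inr ((hA3 s).mpr ⟨hs, M, hM, h''⟩)
  have m4 : ∀ {p M s n}, I p w → I p M → I s M → I s n → n = w ∨ n ∈ A2 ∨ n ∈ A4 := by
    intro p M s n h h' h'' h'''
    by_cases hn : n = w ∨ n ∈ A2
    · tauto
    push Not at hn
    rcases m3 h h' h'' with hs | hs
    · exact (m2 ((hA1 s).mp hs) h''').imp_right .inl
    · exact .inr (.inr ((hA4 n).mpr ⟨hn.symm, s, hs, h'''⟩))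
  have cov : (univ : Finset P) ⊆ A1 ∪ A3 ∪ A5 := by
    intro p _
    simp only [mem_union]
    by_cases hp : p ∈ A1 ∨ p ∈ A3
    · exact .inl hp
    push Not at hp
    obtain ⟨M, r, N, s, h1, h2, h3, h4, h5⟩ := hnear p
    rcases m4 h5 h4 h3 h2 with rfl | hM | hM
    · exact absurd ((hA1 p).mpr h1) hp.1
    · exact absurd ((hA3 p).mpr ⟨hp.1, M, hM, h1⟩) hp.2
    · exact .inr ((hA5 p).mpr ⟨hp, M, hM, h1⟩)
  have ctot : (q + 1) * (1 + q ^ 2 + q ^ 4) ≤ #A1 + #A3 + #A5 :=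
    calc _ ≤ #(univ : Finset P) := hcard
      _ ≤ _ := card_le_card cov
      _ ≤ _ := (card_union_le _ _).trans (Nat.add_le_add_right (card_union_le _ _) _)
  have hq : q = 0 ∨ 0 < q := q.eq_zero_or_pos
  have e2 : q * #A1 ≤ #A2 ∧ q * #A2 ≤ #A3 ∧ q * #A3 ≤ #A4 ∧ q * #A4 ≤ #A5 := by
    have b3 : #A3 ≤ q * (q * (q + 1)) := c3.trans (by rw [← c1]; gcongr)
    have b4 : q * #A4 ≤ q * (q * #A3) := by gcongr
    have b4' : q * (q * #A3) ≤ q * (q * (q * #A2)) := by gcongr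
    have b2 : q * #A2 ≤ q * (q * (q + 1)) := by rw [← c1]; gcongr
    have b2' : q * (q * (q * #A2)) ≤ q * (q * (q * (q * (q + 1)))) := by gcongr
    have t : (q + 1) * (1 + q ^ 2 + q ^ 4) =
      (q + 1) + q * (q * (q + 1)) + q * (q * (q * (q * (q + 1)))) := by ring
    rcases hq with rfl | hq
    · simp
    · refine ⟨?_, by omega, ?_, by omega⟩
      · rw [c1]
        refine Nat.le_of_mul_le_mul_left ?_ hq
        omega
      · refine Nat.le_of_mul_le_mul_left ?_ hq
        omega
  refine ⟨?_, ?_, ?_⟩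
  · intro y hy n n' h1 h2 h3 h4
    exact u2 e2.1 y ((m2 h3 h1).resolve_left hy) n ((hA1 _).mpr h3) n' ((hA1 _).mpr h4) h1 h2
  · rintro y hy n n' h1 h2 ⟨p, M, a1, a2, a3⟩ ⟨p', M', b1, b2, b3⟩
    have hno : ∀ n, I n y → n ∉ A1 := fun n hn h => hy ⟨n, (hA1 n).mp h, hn⟩
    have hn := (m3 a1 a2 a3).resolve_left (hno n h1)
    have hn' := (m3 b1 b2 b3).resolve_left (hno n' h2)
    refine u4 e2.2.2.1 y ((hA4 y).mpr ⟨⟨?_, ?_⟩, n, hn, h1⟩) n hn n' hn' h1 h2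
    · intro h
      obtain ⟨p, hp, h⟩ := ((hA2 y).mp h).2
      exact hno p h hp
    · rintro rfl
      exact hno n h1 ((hA1 n).mpr h1)
  · rintro y hy n n' h1 h2 ⟨p, M, s, a1, a2, a3, a4⟩ ⟨p', M', s', b1, b2, b3, b4⟩
    have hy1 : y ∉ A1 := fun h => hy ⟨y, w, (hA1 y).mp h, (hA1 y).mp h, (hA1 y).mp h⟩
    have hy2 : ∀ m ∈ A2, ¬ I y m := by
      intro m hm h
      obtain ⟨p, hp, h'⟩ := ((hA2 m).mp hm).2
      exact hy ⟨p, m, (hA1 p).mp hp, h', h⟩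
    have hy3 : y ∉ A3 := by
      intro h
      obtain ⟨m, hm, h⟩ := ((hA3 y).mp h).2
      exact hy2 m hm h
    have key : ∀ n, I y n → (n = w ∨ n ∈ A2 ∨ n ∈ A4) → n ∈ A4 := by
      rintro n hn (rfl | h | h)
      · exact absurd ((hA1 y).mpr hn) hy1
      · exact absurd hn (hy2 n h)
      · exact h
    have hn := key n h1 (m4 a1 a2 a3 a4)
    have hn' := key n' h2 (m4 b1 b2 b3 b4)
    exact u5 e2.2.2.2 y ((hA5 y).mpr ⟨⟨hy1, hy3⟩, n, hn, h1⟩) n hn n' hn' h1 h2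

/-- The points of the hexagon as a disjoint union of powers of the field. -/
def ptEquiv (F : Type) : Pt F ≃
    (Unit ⊕ F) ⊕ ((F × F) ⊕ (F × F × F)) ⊕ ((F × F × F × F) ⊕ (F × F × F × F × F)) where
  toFun
    | p0 => .inl (.inl ())
    | p1 a => .inl (.inr a)
    | p2 k b => .inr (.inl (.inl (k, b)))
    | p3 a l a' => .inr (.inl (.inr (a, l, a')))
    | p4 k b k' b' => .inr (.inr (.inl (k, b, k', b')))
    | p5 a l a' l' a'' => .inr (.inr (.inr (a, l, a', l', a'')))
  invFun
    | .inl (.inl ()) => p0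
    | .inl (.inr a) => p1 a
    | .inr (.inl (.inl (k, b))) => p2 k b
    | .inr (.inl (.inr (a, l, a'))) => p3 a l a'
    | .inr (.inr (.inl (k, b, k', b'))) => p4 k b k' b'
    | .inr (.inr (.inr (a, l, a', l', a''))) => p5 a l a' l' a''
  left_inv P := by cases P <;> rfl
  right_inv := by rintro ((_ | _) | (_ | _) | (_ | _)) <;> rfl

/-- The lines of the hexagon as a disjoint union of powers of the field. -/
def lnEquiv (F : Type) : Ln F ≃ Pt F where
  toFun
    | l0 => p0
    | l1 k => p1 k
    | l2 a l => p2 a l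
    | l3 k b k' => p3 k b k'
    | l4 a l a' l' => p4 a l a' l'
    | l5 k b k' b' k'' => p5 k b k' b' k''
  invFun
    | p0 => l0
    | p1 k => l1 k
    | p2 a l => l2 a l
    | p3 k b k' => l3 k b k'
    | p4 a l a' l' => l4 a l a' l'
    | p5 k b k' b' k'' => l5 k b k' b' k''
  left_inv L := by cases L <;> rfl
  right_inv P := by cases P <;> rfl

instance [Fintype F] : Fintype (Pt F) := Fintype.ofEquiv _ (ptEquiv F).symm

instance [Fintype F] : Fintype (Ln F) := Fintype.ofEquiv _ (lnEquiv F).symm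

theorem card_pt {F : Type} [Fintype F] : Fintype.card (Pt F) =
    (Fintype.card F + 1) * (1 + Fintype.card F ^ 2 + Fintype.card F ^ 4) := by
  rw [Fintype.card_congr (ptEquiv F)]
  simp only [Fintype.card_sum, Fintype.card_prod, Fintype.card_unit]
  ring

theorem card_ln {F : Type} [Fintype F] : Fintype.card (Ln F) =
    (Fintype.card F + 1) * (1 + Fintype.card F ^ 2 + Fintype.card F ^ 4) := by
  rw [Fintype.card_congr (lnEquiv F), card_pt]

open scoped Classical in
theorem card_lines_through [Fintype F] (P : Pt F) :
    ({L | Inc P L} : Finset (Ln F)).card = Fintype.card F + 1 := by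
  rw [← Fintype.card_option, ← Finset.card_univ,
    ← Finset.card_image_of_injective _ (lineThrough_injective P)]
  congr 1
  ext L
  simp only [Finset.mem_filter_univ, Finset.mem_image, Finset.mem_univ, true_and]
  rfl

open scoped Classical in
theorem card_points_on [Fintype F] (L : Ln F) :
    ({P | Inc P L} : Finset (Pt F)).card = Fintype.card F + 1 := by
  rw [← Fintype.card_option, ← Finset.card_univ,
    ← Finset.card_image_of_injective _ (pointOn_injective L)]
  congr 1
  ext P
  simp only [Finset.mem_filter_univ, Finset.mem_image, Finset.mem_univ, true_and]
  exact inc_iff_exists_pointOn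

/-- Shortest paths to a line of the hexagon of length less than six are unique. -/
theorem unique_path [Finite F] (w : Ln F) :
    (∀ y, y ≠ w → ∀ n n' : Pt F, Inc n y → Inc n' y → Inc n w → Inc n' w → n = n') ∧
    (∀ y, (¬ ∃ p, Inc p w ∧ Inc p y) → ∀ n n' : Pt F, Inc n y → Inc n' y →
      (∃ p M, Inc p w ∧ Inc p M ∧ Inc n M) → (∃ p M, Inc p w ∧ Inc p M ∧ Inc n' M) → n = n') ∧
    (∀ y : Pt F, (¬ ∃ p M, Inc p w ∧ Inc p M ∧ Inc y M) → ∀ n n', Inc y n → Inc y n' →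
      (∃ p M s, Inc p w ∧ Inc p M ∧ Inc s M ∧ Inc s n) →
      (∃ p M s, Inc p w ∧ Inc p M ∧ Inc s M ∧ Inc s n') → n = n') := by
  have := Fintype.ofFinite F
  refine unique_path_of_card card_points_on card_lines_through card_pt.ge w fun p => ?_
  obtain ⟨s, ⟨M, r, N, h1, h2, h3, h4⟩, h5⟩ := near p w
  exact ⟨M, r, N, s, h1, h2, h3, h4, h5⟩

/-- A point on none of the lines `l5 0 s t 0 s` is on a line which meets none of them. -/
theorem exists_line_disjoint_l5 (h2 : (2 : F) ≠ 0) (P : Pt F)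
    (hP : ∀ s t, ¬ Inc P (l5 0 s t 0 s)) :
    ∃ n, Inc P n ∧ ∀ s t p, Inc p (l5 0 s t 0 s) → ¬ Inc p n := by
  have hoff : ∀ b k' b' k'' : F, b' ≠ 0 → ∀ s t p, Inc p (l5 0 s t 0 s) →
      ¬ Inc p (l5 0 b k' b' k'') := by
    intro b k' b' k'' hb' s t p hp hn
    obtain ⟨i, rfl⟩ := inc_iff_exists_pointOn.mp hp
    obtain ⟨j, h⟩ := inc_iff_exists_pointOn.mp hn
    cases i <;> cases j <;> simp [pointOn] at h
    · exact hb' h.2.2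
    · obtain ⟨rfl, -, h, -, rfl⟩ := h
      exact hb' (by linear_combination h)
  match P with
  | p0 =>
    refine ⟨l0, ⟨none, rfl⟩, fun s t p hp hn => ?_⟩
    obtain ⟨i, rfl⟩ := inc_iff_exists_pointOn.mp hp
    obtain ⟨j, h⟩ := inc_iff_exists_pointOn.mp hn
    cases i <;> cases j <;> simp [pointOn] at h
  | p1 a =>
    refine ⟨l0, ⟨none, rfl⟩, fun s t p hp hn => ?_⟩
    obtain ⟨i, rfl⟩ := inc_iff_exists_pointOn.mp hp
    obtain ⟨j, h⟩ := inc_iff_exists_pointOn.mp hn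
    cases i <;> cases j <;> simp [pointOn] at h
  | p2 k b =>
    refine ⟨l1 k, ⟨none, rfl⟩, fun s t p hp hn => ?_⟩
    obtain ⟨i, rfl⟩ := inc_iff_exists_pointOn.mp hp
    obtain ⟨j, h⟩ := inc_iff_exists_pointOn.mp hn
    cases i <;> cases j <;> simp [pointOn] at h
  | p3 a l a' =>
    refine ⟨l2 a l, ⟨none, rfl⟩, fun s t p hp hn => ?_⟩
    obtain ⟨i, rfl⟩ := inc_iff_exists_pointOn.mp hp
    obtain ⟨j, h⟩ := inc_iff_exists_pointOn.mp hn
    cases i <;> cases j <;> simp [pointOn] at h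
  | p4 k b k' b' =>
    by_cases hk : k = 0
    · subst hk
      refine ⟨l5 0 b k' b' 0, ⟨some 0, rfl⟩, hoff _ _ _ _ ?_⟩
      rintro rfl
      exact hP b k' ⟨some b, rfl⟩
    · refine ⟨l3 k b k', ⟨none, rfl⟩, fun s t p hp hn => ?_⟩
      obtain ⟨i, rfl⟩ := inc_iff_exists_pointOn.mp hp
      obtain ⟨j, h⟩ := inc_iff_exists_pointOn.mp hn
      cases i <;> cases j <;> simp [pointOn, hk] at h
  | p5 a l a' l' a'' =>
    by_cases ha' : a' = 2 * a * a''
    · by_cases ha : a = 0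
      · subst ha
        obtain rfl : a' = 0 := by simpa using ha'
        refine ⟨_, ⟨some 1, rfl⟩, fun s t p hp hn => ?_⟩
        obtain ⟨i, rfl⟩ := inc_iff_exists_pointOn.mp hp
        obtain ⟨j, h⟩ := inc_iff_exists_pointOn.mp hn
        cases i <;> cases j <;> simp [pointOn, lineThrough] at h
        obtain ⟨rfl, h1, h3, h4, h5⟩ := h
        rename_i c
        have hc : c = 0 := by
          refine pow_eq_zero_iff (two_ne_zero) |>.mp ?_
          linear_combination -h3 + 2 * c * h5
        subst hc
        obtain rfl : l = s := by linear_combination h1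
        obtain rfl : a'' = l := by linear_combination h5
        refine hP a'' l' ⟨some 0, ?_⟩
        simp [lineThrough]
      · refine ⟨l4 a l a' l', ⟨none, rfl⟩, fun s t p hp hn => ?_⟩
        obtain ⟨i, rfl⟩ := inc_iff_exists_pointOn.mp hp
        obtain ⟨j, h⟩ := inc_iff_exists_pointOn.mp hn
        cases i <;> cases j <;> simp [pointOn] at h
        obtain ⟨rfl, h1, h3, h4, rfl⟩ := h
        rename_i c
        have hc : c = a'' := mul_left_cancel₀ (mul_ne_zero h2 ha) (by linear_combination ha' - h3)
        subst hc
        exact hP c t (inc_iff_exists_pointOn.mpr ⟨some a, by simp [pointOn, h1, h3, h4]⟩)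
    · refine ⟨_, ⟨some 0, rfl⟩, ?_⟩
      apply hoff
      simpa [sub_eq_zero] using ha'

instance : Fact (Nat.Prime 7) := ⟨by norm_num⟩

/-- Thirty-six lines of the hexagon over `ZMod 7`, no two of which are joined by a path of length
at most four. -/
def farLine (x y : Fin 6) : Ln (ZMod 7) :=
  l5 0 ((x : ℕ) : ZMod 7) ((y : ℕ) : ZMod 7) 0 ((x : ℕ) : ZMod 7)

theorem farLine_eq_of_path {x y x' y' : Fin 6} {p q : Pt (ZMod 7)} {M : Ln (ZMod 7)}
    (hp : Inc p (farLine x y)) (hpM : Inc p M) (hqM : Inc q M) (hq : Inc q (farLine x' y')) :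
    x = x' ∧ y = y' := by
  have hinj : ∀ i j : Fin 6, ((i : ℕ) : ZMod 7) = ((j : ℕ) : ZMod 7) → i = j := by decide
  obtain ⟨hx, hy⟩ := l5_eq_of_path (by decide) (by decide) hp hpM hqM hq
  exact ⟨hinj _ _ hx, hinj _ _ hy⟩

/-- `L` is one of the thirty-six chosen lines. -/
def IsFar (L : Ln (ZMod 7)) : Prop := ∃ x y, L = farLine x y

theorem IsFar.eq_of_path {w w' M : Ln (ZMod 7)} (hw : IsFar w) (hw' : IsFar w')
    {p q : Pt (ZMod 7)} (hp : Inc p w) (hpM : Inc p M) (hqM : Inc q M) (hq : Inc q w') :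
    w = w' := by
  obtain ⟨x, y, rfl⟩ := hw
  obtain ⟨x', y', rfl⟩ := hw'
  obtain ⟨rfl, rfl⟩ := farLine_eq_of_path hp hpM hqM hq
  rfl

theorem IsFar.eq_of_inc {w w' : Ln (ZMod 7)} (hw : IsFar w) (hw' : IsFar w') {p : Pt (ZMod 7)}
    (hp : Inc p w) (hp' : Inc p w') : w = w' :=
  hw.eq_of_path hw' hp hp' hp' hp'

/-- A point on none of the chosen lines is on a line which meets none of them. -/
theorem exists_line_disjoint_isFar {p : Pt (ZMod 7)} (hp : ∀ w, IsFar w → ¬ Inc p w) :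
    ∃ n, Inc p n ∧ ∀ w, IsFar w → ∀ q, Inc q w → ¬ Inc q n := by
  by_cases h : ∃ s t, Inc p (l5 0 s t 0 s)
  · obtain ⟨s, t, hst⟩ := h
    refine ⟨_, hst, ?_⟩
    rintro _ ⟨x, y, rfl⟩ q hq hqn
    obtain ⟨rfl, rfl⟩ := l5_eq_of_path (by decide) (by decide) hqn hqn hqn hq
    exact hp _ ⟨x, y, rfl⟩ hst
  · push Not at h
    obtain ⟨n, hn, hn'⟩ := exists_line_disjoint_l5 (by decide) p h
    refine ⟨n, hn, ?_⟩
    rintro _ ⟨x, y, rfl⟩ q hq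
    exact hn' _ _ q hq

/-- The vertex of the copy `(x, y)` of the complete graph which is attached to the point with
label `j` of the replaced line. -/
def slot (x y : Fin 6) : Option (ZMod 7) → Fin 6
  | none => x
  | some a => if h : a.val < 6 then ⟨a.val, h⟩ else y

theorem slot_some_natCast (x y i : Fin 6) : slot x y (some ((i : ℕ) : ZMod 7)) = i := by
  revert x y i
  decide

theorem eq_of_slot_eq {x y i : Fin 6} {j : Option (ZMod 7)} (h : slot x y j = i) :
    j = some ((i : ℕ) : ZMod 7) ∨ (i = x ∧ j = none) ∨ (i = y ∧ j = some 6) := by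
  revert x y i j
  decide

/-- The vertices: points, lines which are not replaced, and the vertices of thirty-six copies of
the complete graph on six vertices. -/
inductive Vtx
  | pt (P : Pt (ZMod 7)) : Vtx
  | ln (L : {L : Ln (ZMod 7) // ¬ IsFar L}) : Vtx
  | cp (x y i : Fin 6) : Vtx

open Vtx

/-- The adjacency relation. -/
def VtxAdj : Vtx → Vtx → Prop
  | pt P, ln L => Inc P L
  | ln L, pt P => Inc P L
  | pt P, cp x y i => ∃ j, pointOn (farLine x y) j = P ∧ slot x y j = i
  | cp x y i, pt P => ∃ j, pointOn (farLine x y) j = P ∧ slot x y j = i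
  | cp x y i, cp x' y' i' =>
      (x = x' ∧ y = y' ∧ i ≠ i') ∨ (y = y' ∧ x ≠ x' ∧ i = x' ∧ i' = x) ∨
        (x = x' ∧ y ≠ y' ∧ i = y' ∧ i' = y)
  | pt _, pt _ => False
  | ln _, ln _ => False
  | ln _, cp _ _ _ => False
  | cp _ _ _, ln _ => False

/-- The hexagon with thirty-six lines replaced by complete graphs on six vertices. -/
def hexGraph : SimpleGraph Vtx where
  Adj := VtxAdj
  symm := ⟨by
    rintro (P | L | ⟨x, y, i⟩) (P' | L' | ⟨x', y', i'⟩) h <;>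
      first
        | exact h
        | (simp only [VtxAdj] at h ⊢
           tauto)⟩
  loopless := ⟨by
    rintro (P | L | ⟨x, y, i⟩) h <;> simp [VtxAdj] at h⟩

theorem ncard_neighborSet_pt_le (P : Pt (ZMod 7)) : (hexGraph.neighborSet (pt P)).ncard ≤ 8 := by
  let f : Vtx → Ln (ZMod 7)
    | pt _ => l0
    | ln L => L
    | cp x y _ => farLine x y
  have h1 : (hexGraph.neighborSet (pt P)).ncard ≤ (Set.range (lineThrough P)).ncard := by
    refine Set.ncard_le_ncard_of_injOn f ?_ ?_ (Set.toFinite _)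
    · rintro (Q | L | ⟨x, y, i⟩) h
      · exact h.elim
      · exact h
      · obtain ⟨j, rfl, -⟩ := h
        exact inc_pointOn _ j
    · rintro (Q | L | ⟨x, y, i⟩) h (Q' | L' | ⟨x', y', i'⟩) h' e
      · exact h.elim
      · exact h.elim
      · exact h.elim
      · exact h'.elim
      · exact congrArg ln (Subtype.ext e)
      · exact (L.2 ⟨x', y', e⟩).elim
      · exact h'.elim
      · exact (L'.2 ⟨x, y, e.symm⟩).elim
      · obtain ⟨j, rfl, rfl⟩ := h
        obtain ⟨j', hj, rfl⟩ := h'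
        have e' : farLine x y = farLine x' y' := e
        have hq : Inc (pointOn (farLine x y) j) (farLine x' y') := e' ▸ inc_pointOn _ j
        obtain ⟨rfl, rfl⟩ := farLine_eq_of_path (inc_pointOn _ j) (inc_pointOn _ j)
          (inc_pointOn _ j) hq
        rw [pointOn_injective _ hj]
  refine h1.trans ?_
  rw [← Set.image_univ]
  refine (Set.ncard_image_le (Set.toFinite _)).trans ?_
  simp [Set.ncard_univ]

theorem ncard_neighborSet_ln_le (L : {L : Ln (ZMod 7) // ¬ IsFar L}) :
    (hexGraph.neighborSet (ln L)).ncard ≤ 8 := by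
  have h1 : hexGraph.neighborSet (ln L) ⊆ (fun j => pt (pointOn L j)) '' Set.univ := by
    rintro (Q | L | ⟨x, y, i⟩) h
    · obtain ⟨j, rfl⟩ := inc_iff_exists_pointOn.mp h
      exact ⟨j, trivial, rfl⟩
    · exact h.elim
    · exact h.elim
  refine (Set.ncard_le_ncard h1 (Set.toFinite _)).trans
    ((Set.ncard_image_le (Set.toFinite _)).trans ?_)
  simp [Set.ncard_univ]

theorem ncard_neighborSet_cp_le (x y i : Fin 6) :
    (hexGraph.neighborSet (cp x y i)).ncard ≤ 8 := by
  let g : Option (Option (Fin 6)) → Vtx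
    | none => if i = x then pt (pointOn (farLine x y) none) else cp i y x
    | some none => if i = y then pt (pointOn (farLine x y) (some 6)) else cp x i y
    | some (some j) =>
        if j = i then pt (pointOn (farLine x y) (some ((i : ℕ) : ZMod 7))) else cp x y j
  have h1 : hexGraph.neighborSet (cp x y i) ⊆ g '' Set.univ := by
    rintro (Q | L | ⟨x', y', i'⟩) h
    · obtain ⟨j, rfl, hj⟩ := h
      rcases eq_of_slot_eq hj with rfl | ⟨hi, rfl⟩ | ⟨hi, rfl⟩
      · exact ⟨some (some i), trivial, if_pos rfl⟩
      · exact ⟨none, trivial, if_pos hi⟩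
      · exact ⟨some none, trivial, if_pos hi⟩
    · exact h.elim
    · rcases h with ⟨rfl, rfl, hi⟩ | ⟨rfl, hx, rfl, rfl⟩ | ⟨rfl, hy, rfl, rfl⟩
      · exact ⟨some (some i'), trivial, if_neg hi.symm⟩
      · exact ⟨none, trivial, if_neg hx.symm⟩
      · exact ⟨some none, trivial, if_neg hy.symm⟩
  refine (Set.ncard_le_ncard h1 (Set.toFinite _)).trans
    ((Set.ncard_image_le (Set.toFinite _)).trans ?_)
  simp [Set.ncard_univ]

theorem ncard_neighborSet_le (v : Vtx) : (hexGraph.neighborSet v).ncard ≤ 8 := by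
  cases v
  · exact ncard_neighborSet_pt_le _
  · exact ncard_neighborSet_ln_le _
  · exact ncard_neighborSet_cp_le _ _ _

/-- `Vtx` as a disjoint union. -/
def vtxEquiv : Vtx ≃
    Pt (ZMod 7) ⊕ {L : Ln (ZMod 7) // ¬ IsFar L} ⊕ (Fin 6 × Fin 6 × Fin 6) where
  toFun
    | pt P => .inl P
    | ln L => .inr (.inl L)
    | cp x y i => .inr (.inr (x, y, i))
  invFun
    | .inl P => pt P
    | .inr (.inl L) => ln L
    | .inr (.inr (x, y, i)) => cp x y i
  left_inv v := by cases v <;> rfl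
  right_inv := by rintro (_ | _ | _) <;> rfl

theorem nat_card_vtx : Nat.card Vtx = 39396 := by
  classical
  have h1 : Fintype.card {L : Ln (ZMod 7) // IsFar L} = 36 := by
    let f : Fin 6 × Fin 6 → {L : Ln (ZMod 7) // IsFar L} := fun x => ⟨farLine x.1 x.2, _, _, rfl⟩
    have hf : Function.Bijective f := by
      constructor
      · rintro ⟨x, y⟩ ⟨x', y'⟩ h
        have e : farLine x y = farLine x' y' := congrArg Subtype.val h
        have hq : Inc (pointOn (farLine x y) none) (farLine x' y') := e ▸ inc_pointOn _ _
        obtain ⟨rfl, rfl⟩ := farLine_eq_of_path (inc_pointOn _ none) (inc_pointOn _ none)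
          (inc_pointOn _ none) hq
        rfl
      · rintro ⟨_, x, y, rfl⟩
        exact ⟨(x, y), rfl⟩
    rw [← Fintype.card_of_bijective hf]
    simp
  rw [Nat.card_congr vtxEquiv, Nat.card_eq_fintype_card, Fintype.card_sum, Fintype.card_sum,
    Fintype.card_subtype_compl, h1, card_pt, card_ln]
  simp [ZMod.card]

/-- `u` and `v` are joined by a walk of length at most `n`. -/
def Within (n : ℕ) (u v : Vtx) : Prop := ∃ w : hexGraph.Walk u v, w.length ≤ n

theorem Within.refl (n : ℕ) (u : Vtx) : Within n u u := ⟨.nil, Nat.zero_le n⟩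

theorem Within.mono {m n : ℕ} {u v : Vtx} (h : Within m u v) (hmn : m ≤ n := by norm_num) :
    Within n u v :=
  h.imp fun _ hw => hw.trans hmn

theorem Within.symm {n : ℕ} {u v : Vtx} (h : Within n u v) : Within n v u := by
  obtain ⟨w, hw⟩ := h
  exact ⟨w.reverse, by simpa using hw⟩

theorem Within.trans {m n : ℕ} {u v w : Vtx} (h : Within m u v) (h' : Within n v w) :
    Within (m + n) u w := by
  obtain ⟨p, hp⟩ := h
  obtain ⟨p', hp'⟩ := h'
  exact ⟨p.append p', by rw [SimpleGraph.Walk.length_append]; omega⟩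

theorem Within.of_adj {u v : Vtx} (h : VtxAdj u v) : Within 1 u v :=
  ⟨.cons (show hexGraph.Adj u v from h) .nil, by simp⟩

theorem within_pt_ln_of_inc {P : Pt (ZMod 7)} {L : {L : Ln (ZMod 7) // ¬ IsFar L}}
    (h : Inc P L.1) : Within 1 (pt P) (ln L) :=
  .of_adj h

theorem within_cp_pointOn (x y : Fin 6) (j : Option (ZMod 7)) :
    Within 1 (cp x y (slot x y j)) (pt (pointOn (farLine x y) j)) :=
  .of_adj ⟨j, rfl, rfl⟩

theorem within_cp_cp (x y i j : Fin 6) : Within 1 (cp x y i) (cp x y j) := by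
  by_cases h : i = j
  · exact h ▸ Within.refl _ _
  · exact .of_adj (.inl ⟨rfl, rfl, h⟩)

theorem within_cp_of_inc {P : Pt (ZMod 7)} {x y : Fin 6} (h : Inc P (farLine x y)) (i : Fin 6) :
    Within 2 (cp x y i) (pt P) := by
  obtain ⟨j, rfl⟩ := inc_iff_exists_pointOn.mp h
  exact (within_cp_cp x y i (slot x y j)).trans (within_cp_pointOn x y j)

theorem within_pt_pt_of_not_isFar {P Q : Pt (ZMod 7)} {M : Ln (ZMod 7)} (hP : Inc P M)
    (hQ : Inc Q M) (hM : ¬ IsFar M) : Within 2 (pt P) (pt Q) :=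
  (within_pt_ln_of_inc (L := ⟨M, hM⟩) hP).trans (within_pt_ln_of_inc hQ).symm

theorem within_pt_pt_of_inc {P Q : Pt (ZMod 7)} {M : Ln (ZMod 7)} (hP : Inc P M)
    (hQ : Inc Q M) : Within 3 (pt P) (pt Q) := by
  by_cases hM : IsFar M
  · obtain ⟨x, y, rfl⟩ := hM
    obtain ⟨j, rfl⟩ := inc_iff_exists_pointOn.mp hP
    exact (within_cp_pointOn x y j).symm.trans (within_cp_of_inc hQ _)
  · exact (within_pt_pt_of_not_isFar hP hQ hM).mono

/-- A path of two lines of which at most one is replaced. -/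
theorem within_pt_pt_of_path {P R Q : Pt (ZMod 7)} {M N : Ln (ZMod 7)} (hP : Inc P M)
    (hRM : Inc R M) (hRN : Inc R N) (hQ : Inc Q N) : Within 5 (pt P) (pt Q) := by
  by_cases hM : IsFar M
  · by_cases hN : IsFar N
    · obtain rfl := hM.eq_of_inc hN hRM hRN
      exact (within_pt_pt_of_inc hP hQ).mono
    · exact (within_pt_pt_of_inc hP hRM).trans (within_pt_pt_of_not_isFar hRN hQ hN)
  · exact (within_pt_pt_of_not_isFar hP hRM hM).trans (within_pt_pt_of_inc hRN hQ)

theorem within_pt_ln (P : Pt (ZMod 7)) (L : {L : Ln (ZMod 7) // ¬ IsFar L}) :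
    Within 6 (pt P) (ln L) := by
  obtain ⟨Q, ⟨M, R, N, h1, h2, h3, h4⟩, h5⟩ := near P L.1
  exact (within_pt_pt_of_path h1 h2 h3 h4).trans (within_pt_ln_of_inc h5)

theorem within_cp_cp_of_ne (x y i x' y' j : Fin 6) : Within 5 (cp x y i) (cp x' y' j) := by
  have h1 : Within 1 (cp x y x') (cp x' y x) := by
    by_cases h : x = x'
    · subst h
      exact .refl _ _
    · exact .of_adj (.inr (.inl ⟨rfl, h, rfl, rfl⟩))
  have h2 : Within 1 (cp x' y y') (cp x' y' y) := by
    by_cases h : y = y'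
    · subst h
      exact .refl _ _
    · exact .of_adj (.inr (.inr ⟨rfl, h, rfl, rfl⟩))
  exact ((((within_cp_cp x y i x').trans h1).trans (within_cp_cp x' y x y')).trans h2).trans
    (within_cp_cp x' y' y j)

theorem within_cp_pt (x y i : Fin 6) (P : Pt (ZMod 7)) : Within 6 (cp x y i) (pt P) := by
  by_cases hP : ∃ w, IsFar w ∧ Inc P w
  · obtain ⟨_, ⟨x', y', rfl⟩, h⟩ := hP
    obtain ⟨j, rfl⟩ := inc_iff_exists_pointOn.mp h
    exact (within_cp_cp_of_ne x y i x' y' (slot x' y' j)).trans (within_cp_pointOn x' y' j)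
  · push Not at hP
    obtain ⟨Q, ⟨M, R, N, h1, h2, h3, h4⟩, h5⟩ := near P (farLine x y)
    have hM : ¬ IsFar M := fun h => hP M h h1
    by_cases hN : IsFar N
    · obtain rfl := hN.eq_of_inc ⟨x, y, rfl⟩ h4 h5
      exact ((within_cp_of_inc h3 i).trans (within_pt_pt_of_inc h2 h1)).mono
    · exact ((within_cp_of_inc h5 i).trans (within_pt_pt_of_not_isFar h4 h3 hN)).trans
        (within_pt_pt_of_not_isFar h2 h1 hM)

theorem within_cp_ln (x y i : Fin 6) (L : {L : Ln (ZMod 7) // ¬ IsFar L}) :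
    Within 6 (cp x y i) (ln L) := by
  have hw : IsFar (farLine x y) := ⟨x, y, rfl⟩
  have hn := inc_pointOn (farLine x y) (some ((i : ℕ) : ZMod 7))
  have hadj : Within 1 (cp x y i) (pt (pointOn (farLine x y) (some ((i : ℕ) : ZMod 7)))) :=
    .of_adj ⟨_, rfl, slot_some_natCast x y i⟩
  obtain ⟨Q, ⟨M, R, N, h1, h2, h3, h4⟩, h5⟩ :=
    near (pointOn (farLine x y) (some ((i : ℕ) : ZMod 7))) L.1
  have hL : Within 1 (pt Q) (ln L) := within_pt_ln_of_inc h5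
  by_cases hM : IsFar M
  · obtain rfl := hM.eq_of_inc hw h1 hn
    exact (((within_cp_of_inc h2 i).trans (within_pt_pt_of_inc h3 h4)).trans hL).mono
  by_cases hN : IsFar N
  · obtain rfl := hN.eq_of_path hw h3 h2 h1 hn
    exact ((within_cp_of_inc h4 i).trans hL).mono
  exact ((hadj.trans (within_pt_pt_of_not_isFar h1 h2 hM)).trans
    (within_pt_pt_of_not_isFar h3 h4 hN)).trans hL

theorem exists_ne_ne_inc (P : Pt (ZMod 7)) (w : Ln (ZMod 7)) :
    ∃ n n', n ≠ w ∧ n' ≠ w ∧ n ≠ n' ∧ Inc P n ∧ Inc P n' := by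
  have h : ∀ i j, i ≠ j → lineThrough P i ≠ lineThrough P j :=
    fun i j hij h => hij (lineThrough_injective P h)
  have h01 := h (some 0) (some 1) (by decide)
  have h02 := h (some 0) (some 2) (by decide)
  have h12 := h (some 1) (some 2) (by decide)
  by_cases h0 : lineThrough P (some 0) = w
  · exact ⟨_, _, h0 ▸ h01.symm, h0 ▸ h02.symm, h12, ⟨_, rfl⟩, ⟨_, rfl⟩⟩
  by_cases h1 : lineThrough P (some 1) = w
  · exact ⟨_, _, h0, h1 ▸ h12.symm, h02, ⟨_, rfl⟩, ⟨_, rfl⟩⟩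
  · exact ⟨_, _, h0, h1, h01, ⟨_, rfl⟩, ⟨_, rfl⟩⟩

theorem within_pt_pt_of_inc_isFar {P P' : Pt (ZMod 7)} {w : Ln (ZMod 7)} (hw : IsFar w)
    (hP'w : Inc P' w) : Within 6 (pt P) (pt P') := by
  by_cases hPP' : ∃ R M N, Inc P M ∧ Inc R M ∧ Inc R N ∧ Inc P' N
  · obtain ⟨R, M, N, h1, h2, h3, h4⟩ := hPP'
    exact (within_pt_pt_of_path h1 h2 h3 h4).mono
  by_contra hfar
  have key : ∀ n, n ≠ w → Inc P' n → ∃ M, IsFar M ∧ Inc P M ∧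
      ∃ R N S, Inc R M ∧ Inc R N ∧ Inc S N ∧ Inc S n := by
    intro n hnw hn
    obtain ⟨S, ⟨M, R, N, h1, h2, h3, h4⟩, h5⟩ := near P n
    by_cases hM : IsFar M
    · exact ⟨M, hM, h1, R, N, S, h2, h3, h4, h5⟩
    have hnfar : ¬ IsFar n := fun h => hnw (h.eq_of_inc hw hn hP'w)
    have hN : ¬ IsFar N := by
      intro hN
      obtain rfl := hN.eq_of_path hw h4 h5 hn hP'w
      exact hPP' ⟨R, M, N, h1, h2, h3, hP'w⟩
    exact (hfar (((within_pt_pt_of_not_isFar h1 h2 hM).trans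
      (within_pt_pt_of_not_isFar h3 h4 hN)).trans (within_pt_pt_of_not_isFar h5 hn hnfar))).elim
  obtain ⟨n, n', hn, hn', hne, hPn, hPn'⟩ := exists_ne_ne_inc P' w
  obtain ⟨M, hM, hPM, R, N, S, h1, h2, h3, h4⟩ := key n hn hPn
  obtain ⟨M', hM', hPM', R', N', S', h1', h2', h3', h4'⟩ := key n' hn' hPn'
  obtain rfl := hM.eq_of_inc hM' hPM hPM'
  refine hne ((unique_path M).2.2 P' ?_ n n' hPn hPn' ⟨R, N, S, h1, h2, h3, h4⟩
    ⟨R', N', S', h1', h2', h3', h4'⟩)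
  rintro ⟨R, N, hR, hRN, hP'N⟩
  exact hPP' ⟨R, M, N, hPM, hR, hRN, hP'N⟩

theorem within_pt_pt (P P' : Pt (ZMod 7)) : Within 6 (pt P) (pt P') := by
  by_cases hP' : ∃ w, IsFar w ∧ Inc P' w
  · obtain ⟨w, hw, h⟩ := hP'
    exact within_pt_pt_of_inc_isFar hw h
  by_cases hP : ∃ w, IsFar w ∧ Inc P w
  · obtain ⟨w, hw, h⟩ := hP
    exact (within_pt_pt_of_inc_isFar hw h).symm
  push Not at hP hP'
  obtain ⟨n, hn, hdisj⟩ := exists_line_disjoint_isFar hP'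
  obtain ⟨S, ⟨M, R, N, h1, h2, h3, h4⟩, h5⟩ := near P n
  have hM : ¬ IsFar M := fun h => hP M h h1
  have hN : ¬ IsFar N := fun h => hdisj N h S h4 h5
  have hnfar : ¬ IsFar n := fun h => hP' n h hn
  exact ((within_pt_pt_of_not_isFar h1 h2 hM).trans
    (within_pt_pt_of_not_isFar h3 h4 hN)).trans (within_pt_pt_of_not_isFar h5 hn hnfar)

theorem within_ln_ln (L L' : {L : Ln (ZMod 7) // ¬ IsFar L}) : Within 6 (ln L) (ln L') := by
  by_cases hLL' : ∃ P M Q, Inc P L'.1 ∧ Inc P M ∧ Inc Q M ∧ Inc Q L.1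
  · obtain ⟨P, M, Q, h1, h2, h3, h4⟩ := hLL'
    exact (((within_pt_ln_of_inc h4).symm.trans (within_pt_pt_of_inc h3 h2)).trans
      (within_pt_ln_of_inc h1)).mono
  by_contra hfar
  have key : ∀ n, Inc n L'.1 → (∃ w, IsFar w ∧ Inc n w) ∨
      ∃ N, IsFar N ∧ (∃ S, Inc S N ∧ Inc S L.1) ∧ ∃ R M, Inc R N ∧ Inc R M ∧ Inc n M := by
    intro n hn
    obtain ⟨S, ⟨M, R, N, h1, h2, h3, h4⟩, h5⟩ := near n L.1
    by_cases hM : IsFar M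
    · exact .inl ⟨M, hM, h1⟩
    by_cases hN : IsFar N
    · exact .inr ⟨N, hN, ⟨S, h4, h5⟩, R, M, h3, h2, h1⟩
    exact (hfar ((((within_pt_ln_of_inc h5).symm.trans
      (within_pt_pt_of_not_isFar h4 h3 hN)).trans (within_pt_pt_of_not_isFar h2 h1 hM)).trans
      (within_pt_ln_of_inc hn))).elim
  have huniq1 : ∀ n n', Inc n L'.1 → Inc n' L'.1 → (∃ w, IsFar w ∧ Inc n w) →
      (∃ w, IsFar w ∧ Inc n' w) → n = n' := by
    rintro n n' hn hn' ⟨w, hw, hnw⟩ ⟨w', hw', hnw'⟩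
    obtain rfl := hw.eq_of_path hw' hnw hn hn' hnw'
    exact (unique_path w).1 L'.1 (fun h => L'.2 (h ▸ hw)) n n' hn hn' hnw hnw'
  have huniq2 : ∀ n n', Inc n L'.1 → Inc n' L'.1 →
      (∃ N, IsFar N ∧ (∃ S, Inc S N ∧ Inc S L.1) ∧ ∃ R M, Inc R N ∧ Inc R M ∧ Inc n M) →
      (∃ N, IsFar N ∧ (∃ S, Inc S N ∧ Inc S L.1) ∧ ∃ R M, Inc R N ∧ Inc R M ∧ Inc n' M) →
      n = n' := by
    rintro n n' hn hn' ⟨N, hN, ⟨S, hS, hSL⟩, h⟩ ⟨N', hN', ⟨S', hS', hSL'⟩, h'⟩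
    obtain rfl := hN.eq_of_path hN' hS hSL hSL' hS'
    refine (unique_path N).2.1 L'.1 ?_ n n' hn hn' h h'
    rintro ⟨P, hP, hPL⟩
    exact hLL' ⟨P, N, S, hPL, hP, hS, hSL⟩
  have hinc := fun j => inc_pointOn L'.1 j
  have hne : ∀ i j, i ≠ j → pointOn L'.1 i ≠ pointOn L'.1 j :=
    fun i j hij h => hij (pointOn_injective _ h)
  have h01 := hne (some 0) (some 1) (by decide)
  have h02 := hne (some 0) (some 2) (by decide)
  have h12 := hne (some 1) (some 2) (by decide)
  rcases key _ (hinc (some 0)) with a0 | a0 <;> rcases key _ (hinc (some 1)) with a1 | a1 <;>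
    rcases key _ (hinc (some 2)) with a2 | a2 <;>
    first
      | exact h01 (huniq1 _ _ (hinc _) (hinc _) a0 a1)
      | exact h02 (huniq1 _ _ (hinc _) (hinc _) a0 a2)
      | exact h12 (huniq1 _ _ (hinc _) (hinc _) a1 a2)
      | exact h01 (huniq2 _ _ (hinc _) (hinc _) a0 a1)
      | exact h02 (huniq2 _ _ (hinc _) (hinc _) a0 a2)
      | exact h12 (huniq2 _ _ (hinc _) (hinc _) a1 a2)

theorem within_six : ∀ u v : Vtx, Within 6 u v
  | pt P, pt P' => within_pt_pt P P'
  | pt P, ln L => within_pt_ln P L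
  | pt P, cp x y i => (within_cp_pt x y i P).symm
  | ln L, pt P => (within_pt_ln P L).symm
  | ln L, ln L' => within_ln_ln L L'
  | ln L, cp x y i => (within_cp_ln x y i L).symm
  | cp x y i, pt P => within_cp_pt x y i P
  | cp x y i, ln L => within_cp_ln x y i L
  | cp x y i, cp x' y' i' => (within_cp_cp_of_ne x y i x' y' i').mono

end SplitCayleyHexagon

/-- There exists a connected finite simple graph with exactly 39396 vertices,
maximum degree at most 8, and diameter at most 6. -/
theorem exists_connected_graph_card_39396_maxDegree_le_8_diam_le_6 :
    ∃ G : SimpleGraph (Fin 39396), G.Connected ∧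
      (∀ v : Fin 39396, (G.neighborSet v).ncard ≤ 8) ∧ G.diam ≤ 6 := by
  have hfin : Finite SplitCayleyHexagon.Vtx :=
    Nat.finite_of_card_ne_zero (by rw [SplitCayleyHexagon.nat_card_vtx]; norm_num)
  let e : Fin 39396 ≃ SplitCayleyHexagon.Vtx :=
    (Finite.equivFinOfCardEq SplitCayleyHexagon.nat_card_vtx).symm
  let G : SimpleGraph (Fin 39396) := SplitCayleyHexagon.hexGraph.comap e
  let f : G ≃g SplitCayleyHexagon.hexGraph := SimpleGraph.Iso.comap e _
  have hdist : ∀ u v, ∃ w : G.Walk u v, w.length ≤ 6 := by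
    intro u v
    obtain ⟨w, hw⟩ := SplitCayleyHexagon.within_six (f u) (f v)
    exact ⟨(w.map f.symm.toHom).copy (f.symm_apply_apply u) (f.symm_apply_apply v),
      by simpa using hw⟩
  have hediam : G.ediam ≤ 6 := by
    refine SimpleGraph.ediam_le_of_edist_le fun u v => ?_
    obtain ⟨w, hw⟩ := hdist u v
    exact (SimpleGraph.edist_le w).trans (by exact_mod_cast hw)
  have : Nonempty (Fin 39396) := ⟨0⟩
  refine ⟨G, SimpleGraph.connected_of_ediam_ne_top ?_, fun v => ?_, ?_⟩
  · exact ne_top_of_le_ne_top (by decide) hediam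
  · refine le_trans ?_ (SplitCayleyHexagon.ncard_neighborSet_le (e v))
    exact Set.ncard_le_ncard_of_injOn e (fun _ h => h) e.injective.injOn (Set.toFinite _)
  · exact ENat.toNat_le_of_le_natCast hediam
end
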